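/- Let n ≥ 1 and let u : ℝⁿ → ℝ be a smooth stable solution of the triharmonic Lane–Emden equation (−Δ)³u = |u|^{p−1}u on ℝⁿ. If 1 < p and, in the case n ≥ 15, additionally p < p_c(n) (no upper restriction on p when n ≤ 14), then u is identically zero. -/

import Mathlib

open MeasureTheory Filter

noncomputable section

/-- The Euclidean Laplacian of `u` at `x`. -/
def laplacian {n : ℕ} (u : EuclideanSpace ℝ (Fin n) → ℝ) (x : EuclideanSpace ℝ (Fin n)) : ℝ :=
  ∑ i : Fin n, iteratedFDeriv ℝ 2 u x ![EuclideanSpace.single i 1, EuclideanSpace.single i 1]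

def dd1 (n : ℝ) : ℝ :=
  -108*n^6 + 1296*n^5 - 3024*n^4 - 10368*n^3 + 103104*n^2 + 20736*n - 94976

def dd2 (n : ℝ) : ℝ :=
  9*n^12 - 216*n^11 + 1800*n^10 - 4320*n^9 - 30864*n^8 + 251136*n^7 - 690432*n^6
    - 1936384*n^5 + 6915840*n^4 + 4818944*n^3 - 16644096*n^2 - 3039232*n + 6131712

/-- `d₀(n)`, the real cube root of `-(d₁(n) + 36√(d₂(n)))`. -/
def dd0 (n : ℝ) : ℝ := (-(dd1 n + 36 * Real.sqrt (dd2 n))) ^ ((1 : ℝ)/3)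

def dfn (n : ℝ) : ℝ :=
  (1/6) * Real.sqrt (9*n^2 + 96 - (1536 + 1152*n^2) / dd0 n - (3/2) * dd0 n)

/-- The Joseph–Lundgren exponent `p_c(n)` (for `n ≥ 15`; `p_c(n) = +∞` for `n ≤ 14`,
which is encoded by imposing the bound `p < pc n` only when `15 ≤ n`). -/
def pc (n : ℝ) : ℝ := (n + 4 - 2 * dfn n) / (n - 8 - 2 * dfn n)


section Helpers
/-! ### Smooth functions and partial derivatives -/

/-- The algebra of smooth functions. -/
def Sm (n : ℕ) : Subalgebra ℝ (EuclideanSpace ℝ (Fin n) → ℝ) where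
  carrier := {f | ContDiff ℝ (⊤ : ℕ∞) f}
  mul_mem' := by
    intro f g hf hg
    simp only [Set.mem_ofPred_eq] at *
    exact hf.mul hg
  add_mem' := by
    intro f g hf hg
    simp only [Set.mem_ofPred_eq] at *
    exact hf.add hg
  algebraMap_mem' := fun r => by
    change ContDiff ℝ (⊤ : ℕ∞) (fun _ : EuclideanSpace ℝ (Fin n) => r)
    exact contDiff_const

variable {n : ℕ}

instance smCoeFun : CoeFun (Sm n) (fun _ => EuclideanSpace ℝ (Fin n) → ℝ) := ⟨fun f => f.1⟩

lemma smcd (f : Sm n) : ContDiff ℝ (⊤ : ℕ∞) (f : EuclideanSpace ℝ (Fin n) → ℝ) := f.2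

lemma smdiff (f : Sm n) : Differentiable ℝ (f : EuclideanSpace ℝ (Fin n) → ℝ) :=
  (smcd f).differentiable (by simp)

lemma smcont (f : Sm n) : Continuous (f : EuclideanSpace ℝ (Fin n) → ℝ) := (smcd f).continuous

@[ext] lemma Sm.ext' {f g : Sm n} (h : ∀ x, f x = g x) : f = g := Subtype.ext (funext h)

@[simp] lemma Sm.add_ap (f g : Sm n) (x) : (f + g) x = f x + g x := rfl
@[simp] lemma Sm.mul_ap (f g : Sm n) (x) : (f * g) x = f x * g x := rfl
@[simp] lemma Sm.sub_ap (f g : Sm n) (x) : (f - g) x = f x - g x := rfl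
@[simp] lemma Sm.neg_ap (f : Sm n) (x) : (-f) x = - f x := rfl
@[simp] lemma Sm.smul_ap (c : ℝ) (f : Sm n) (x) : (c • f) x = c * f x := rfl
@[simp] lemma Sm.zero_ap (x) : (0 : Sm n) x = 0 := rfl
@[simp] lemma Sm.one_ap (x) : (1 : Sm n) x = 1 := rfl
@[simp] lemma Sm.pow_ap (f : Sm n) (k : ℕ) (x) : (f ^ k) x = f x ^ k := rfl
@[simp] lemma Sm.sum_ap {ι : Type*} (s : Finset ι) (f : ι → Sm n) (x) :
    (∑ i ∈ s, f i) x = ∑ i ∈ s, f i x := by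
  classical
  induction s using Finset.induction_on with
  | empty => simp
  | insert a s ha ih => rw [Finset.sum_insert ha, Finset.sum_insert ha, ← ih]; rfl

/-- The standard basis vectors. -/
def bv (i : Fin n) : EuclideanSpace ℝ (Fin n) := EuclideanSpace.single i 1

/-- Partial derivative as a derivation. -/
def pd (i : Fin n) : Derivation ℝ (Sm n) (Sm n) :=
  Derivation.mk'
    { toFun := fun f => ⟨fun x => fderiv ℝ f x (bv i), by
        have := (smcd f).fderiv_right (m := ((⊤ : ℕ∞) : WithTop ℕ∞)) (by simp)
        exact this.clm_apply contDiff_const⟩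
      map_add' := fun f g => by
        ext x
        change fderiv ℝ (f.1 + g.1) x (bv i) = _
        rw [fderiv_add ((smdiff f) x) ((smdiff g) x)]; rfl
      map_smul' := fun c f => by
        ext x
        change fderiv ℝ (c • f.1) x (bv i) = _
        rw [fderiv_const_smul ((smdiff f) x)]; rfl }
    (fun f g => by
        ext x
        change fderiv ℝ (f.1 * g.1) x (bv i) = f.1 x * fderiv ℝ g.1 x (bv i)
          + g.1 x * fderiv ℝ f.1 x (bv i)
        rw [fderiv_mul ((smdiff f) x) ((smdiff g) x)]; rfl)

lemma pd_ap (i : Fin n) (f : Sm n) (x) : (pd i f) x = fderiv ℝ f x (bv i) := rfl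

lemma pd_mul (i : Fin n) (f g : Sm n) : pd i (f * g) = f * pd i g + g * pd i f := by
  rw [Derivation.leibniz]; rfl

lemma pd_comm (i j : Fin n) (f : Sm n) : pd i (pd j f) = pd j (pd i f) := by
  ext x
  have h : ∀ a b : Fin n, (pd a (pd b f)) x = fderiv ℝ (fderiv ℝ f) x (bv a) (bv b) := by
    intro a b
    have hd : DifferentiableAt ℝ (fderiv ℝ f.1) x :=
      (((smcd f).fderiv_right (m := ((⊤ : ℕ∞) : WithTop ℕ∞)) (by simp)).differentiable (by simp)) x
    change fderiv ℝ (fun y => fderiv ℝ f.1 y (bv b)) x (bv a) = _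
    rw [fderiv_clm_apply hd (differentiableAt_const _)]
    simp
  rw [h, h]
  have hs : IsSymmSndFDerivAt ℝ f.1 x :=
    ((smcd f).contDiffAt).isSymmSndFDerivAt (by simp; exact WithTop.coe_le_coe.mpr le_top)
  exact hs _ _

/-- The Laplacian on smooth functions. -/
def Lap : Sm n →ₗ[ℝ] Sm n := ∑ i, (pd i).toLinearMap ∘ₗ (pd i).toLinearMap

lemma Lap_eq (f : Sm n) : Lap f = ∑ i, pd i (pd i f) := by
  simp [Lap]

lemma laplacian_eq (f : Sm n) : laplacian f.1 = (Lap f).1 := by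
  funext x
  have hd : DifferentiableAt ℝ (fderiv ℝ f.1) x :=
      (((smcd f).fderiv_right (m := ((⊤ : ℕ∞) : WithTop ℕ∞)) (by simp)).differentiable (by simp)) x
  rw [Lap_eq, Sm.sum_ap]
  unfold laplacian
  refine Finset.sum_congr rfl fun i _ => ?_
  rw [iteratedFDeriv_two_apply]
  change _ = fderiv ℝ (fun y => fderiv ℝ f.1 y (bv i)) x (bv i)
  rw [fderiv_clm_apply hd (differentiableAt_const _)]
  simp [bv]

lemma gradient_sq (f : Sm n) (x) : ‖gradient f.1 x‖ ^ 2 = ∑ i, (pd i f) x ^ 2 := by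
  rw [EuclideanSpace.norm_sq_eq]
  refine Finset.sum_congr rfl fun i _ => ?_
  have h1 : (pd i f) x = gradient f.1 x i := by
    have : fderiv ℝ f.1 x (bv i) = inner ℝ (gradient f.1 x) (bv i) := by
      rw [gradient, InnerProductSpace.toDual_symm_apply]
    rw [pd_ap, this]
    unfold bv
    rw [EuclideanSpace.inner_single_right]; simp
  rw [h1]; simp

/-- Compact support. -/
def CS (f : EuclideanSpace ℝ (Fin n) → ℝ) : Prop := Continuous f ∧ HasCompactSupport f

lemma CS.int {f : EuclideanSpace ℝ (Fin n) → ℝ} (h : CS f) : Integrable f :=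
  h.1.integrable_of_hasCompactSupport h.2

lemma pd_cs (i : Fin n) (f : Sm n) (h : HasCompactSupport f.1) : HasCompactSupport (pd i f).1 :=
  h.fderiv_apply ℝ (bv i)

lemma int_pd (i : Fin n) (f : Sm n) (h : HasCompactSupport f.1) : ∫ x, (pd i f) x = 0 := by
  have h1 := integral_mul_fderiv_eq_neg_fderiv_mul_of_integrable (μ := volume) (𝕜 := ℝ)
    (f := fun _ : EuclideanSpace ℝ (Fin n) => (1 : ℝ)) (g := f.1) (v := bv i)
    (by simp) (by
      have := CS.int (f := (pd i f).1) ⟨smcont (pd i f), pd_cs i f h⟩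
      simp only [one_mul]; exact this)
    (by simpa using CS.int (f := f.1) ⟨(smcont f), h⟩) (fun x _ => differentiableAt_const _) (fun x _ => smdiff f x)
  simpa [pd_ap] using h1

lemma pd_supp (i : Fin n) (f : Sm n) : tsupport (pd i f).1 ⊆ tsupport f.1 := by
  refine closure_minimal ?_ (isClosed_tsupport _)
  intro x hx
  by_contra hx'
  have h0 : f.1 =ᶠ[nhds x] 0 := notMem_tsupport_iff_eventuallyEq.mp hx'
  apply hx
  change fderiv ℝ f.1 x (bv i) = 0
  rw [h0.fderiv_eq]; simp

/-- Coordinate function. -/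
def co (i : Fin n) : Sm n := ⟨fun x => x i, by
  change ContDiff ℝ (⊤ : ℕ∞) (fun x : EuclideanSpace ℝ (Fin n) => x i)
  fun_prop⟩

lemma pd_co (i j : Fin n) : pd i (co j) = if i = j then 1 else 0 := by
  ext x
  have h : (pd i (co j)) x = (bv i : EuclideanSpace ℝ (Fin n)) j := by
    have : HasFDerivAt (fun x : EuclideanSpace ℝ (Fin n) => x j)
        (EuclideanSpace.proj j : EuclideanSpace ℝ (Fin n) →L[ℝ] ℝ) x :=
      (EuclideanSpace.proj j : EuclideanSpace ℝ (Fin n) →L[ℝ] ℝ).hasFDerivAt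
    rw [pd_ap]
    change fderiv ℝ (fun x : EuclideanSpace ℝ (Fin n) => x j) x (bv i) = _
    rw [this.fderiv]; rfl
  rw [h, bv]
  by_cases hij : i = j
  · subst hij; simp
  · have : j ≠ i := fun h => hij h.symm
    simp [hij, this]

set_option linter.unusedSimpArgs false

/-! ### Euler operator, spherical Laplacian -/

/-- Euler operator `x·∇`. -/
def Eu : Derivation ℝ (Sm n) (Sm n) := ∑ i, co i • pd i

lemma Eu_eq (f : Sm n) : Eu f = ∑ i, co i * pd i f := by
  have : ∀ s : Finset (Fin n), (∑ i ∈ s, co i • pd i : Derivation ℝ (Sm n) (Sm n)) f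
      = ∑ i ∈ s, co i * pd i f := by
    intro s
    classical
    induction s using Finset.induction_on with
    | empty => simp
    | insert a s ha ih =>
      rw [Finset.sum_insert ha, Finset.sum_insert ha, Derivation.add_apply, ih]; rfl
  exact this _

lemma Eu_mul (f g : Sm n) : Eu (f * g) = f * Eu g + g * Eu f := by
  rw [Derivation.leibniz]; rfl

/-- `|x|²`. -/
def r2 : Sm n := ∑ i, co i * co i

lemma pd_r2 (i : Fin n) : pd i (r2 : Sm n) = (2 : ℝ) • co i := by
  unfold r2
  simp only [map_sum, pd_mul, pd_co]
  simp [Finset.sum_add_distrib, two_smul]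

lemma Eu_r2 : Eu (r2 : Sm n) = (2 : ℝ) • r2 := by
  rw [Eu_eq]
  simp only [pd_r2, mul_smul_comm, ← Finset.smul_sum]
  rfl

lemma pd_Eu (j : Fin n) (f : Sm n) : pd j (Eu f) = pd j f + Eu (pd j f) := by
  simp only [Eu_eq, map_sum, pd_mul, pd_co, Finset.sum_add_distrib]
  rw [add_comm]
  congr 1
  · simp
  · exact Finset.sum_congr rfl fun i _ => by rw [pd_comm]

lemma Lap_Eu (f : Sm n) : Lap (Eu f) = Eu (Lap f) + (2 : ℝ) • Lap f := by
  simp only [Lap_eq, pd_Eu, map_add, map_sum, Finset.sum_add_distrib, two_smul]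
  abel

lemma Lap_mul (f g : Sm n) : Lap (f * g) = f * Lap g + g * Lap f
    + (2 : ℝ) • ∑ i, pd i f * pd i g := by
  simp only [Lap_eq, pd_mul, map_add, Finset.mul_sum, Finset.smul_sum, ← Finset.sum_add_distrib]
  refine Finset.sum_congr rfl fun i _ => ?_
  rw [two_smul]; ring

/-- Minus the spherical Laplacian. -/
def Zo : Sm n →ₗ[ℝ] Sm n where
  toFun f := -(r2 * Lap f) + Eu (Eu f) + ((n : ℝ) - 2) • Eu f
  map_add' f g := by simp only [map_add, mul_add, smul_add]; abel
  map_smul' c f := by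
    simp only [map_smul, Derivation.map_smul, mul_smul_comm, RingHom.id_apply]
    module

lemma Zo_eq (f : Sm n) : Zo f = -(r2 * Lap f) + Eu (Eu f) + ((n : ℝ) - 2) • Eu f := rfl

lemma Eu_Zo (f : Sm n) : Eu (Zo f) = Zo (Eu f) := by
  simp only [Zo_eq, map_add, map_neg, Eu_mul, Eu_r2, Lap_Eu, Derivation.map_smul, mul_add,
    mul_smul_comm, smul_mul_assoc]
  rw [mul_comm (Lap f) r2]

/-- The spherical carré du champ. -/
def Ga (f g : Sm n) : Sm n := r2 * (∑ i, pd i f * pd i g) - Eu f * Eu g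

lemma Ga_comm (f g : Sm n) : Ga f g = Ga g f := by
  unfold Ga
  simp only [mul_comm]

lemma Ga_add (f g h : Sm n) : Ga (f + g) h = Ga f h + Ga g h := by
  simp only [Ga, map_add, add_mul, Finset.sum_add_distrib]; ring

lemma Ga_smul (c : ℝ) (f h : Sm n) : Ga (c • f) h = c • Ga f h := by
  simp only [Ga, Derivation.map_smul, smul_mul_assoc, ← Finset.smul_sum, mul_smul_comm]
  module

/-- Radial smooth functions. -/
def IsRad (ρ : Sm n) : Prop := ∀ i, r2 * pd i ρ = co i * Eu ρ

lemma Ga_rad {ρ : Sm n} (h : IsRad ρ) (g : Sm n) : Ga ρ g = 0 := by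
  unfold Ga
  rw [Finset.mul_sum]
  have : ∀ i, r2 * (pd i ρ * pd i g) = Eu ρ * (co i * pd i g) := by
    intro i; rw [← mul_assoc, h i]; ring
  simp only [this, ← Finset.mul_sum]
  rw [← Eu_eq]; ring

lemma Ga_rad_mul {ρ : Sm n} (h : IsRad ρ) (f g : Sm n) : Ga (ρ * f) g = ρ * Ga f g := by
  have h1 : Ga (ρ * f) g = ρ * Ga f g + f * Ga ρ g := by
    simp only [Ga, pd_mul, Eu_mul, add_mul, Finset.sum_add_distrib, mul_sub, Finset.mul_sum]
    have e1 : ∀ i, r2 * (ρ * pd i f * pd i g) = ρ * (r2 * (pd i f * pd i g)) := by intro i; ring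
    have e2 : ∀ i, r2 * (f * pd i ρ * pd i g) = f * (r2 * (pd i ρ * pd i g)) := by intro i; ring
    simp only [mul_add, Finset.mul_sum, e1, e2]
    ring
  rw [h1, Ga_rad h]; ring

lemma Zo_rad {ρ : Sm n} (h : IsRad ρ) : Zo ρ = 0 := by
  have h1 : ∑ i, pd i (r2 * pd i ρ) = ∑ i, pd i (co i * Eu ρ) :=
    Finset.sum_congr rfl fun i _ => by rw [h i]
  simp only [pd_mul, pd_r2, pd_co, Finset.sum_add_distrib, ← Finset.mul_sum] at h1
  rw [← Eu_eq, ← Lap_eq] at h1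
  simp only [if_true, mul_one, Finset.sum_const, Finset.card_univ, Fintype.card_fin] at h1
  have h2 : ∑ i, pd i ρ * (2 : ℝ) • co i = (2 : ℝ) • Eu ρ := by
    rw [Eu_eq, Finset.smul_sum]
    exact Finset.sum_congr rfl fun i _ => by rw [mul_smul_comm, mul_comm]
  rw [h2] at h1
  rw [Zo_eq]
  have h3 : r2 * Lap ρ = Eu (Eu ρ) + n • Eu ρ - (2 : ℝ) • Eu ρ := by
    rw [mul_smul_comm, mul_one] at h1; rw [← h1]; abel
  rw [h3, sub_smul, Nat.cast_smul_eq_nsmul]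
  abel

lemma Zo_rad_mul {ρ : Sm n} (h : IsRad ρ) (f : Sm n) : Zo (ρ * f) = ρ * Zo f := by
  have h1 : Zo (ρ * f) = ρ * Zo f + f * Zo ρ - (2 : ℝ) • Ga ρ f := by
    simp only [Zo_eq, Ga, Lap_mul, Eu_mul, map_add, mul_add, mul_smul_comm, smul_sub, smul_add]
    have e : ∀ a b : Sm n, (((n : ℝ) - 2) • (a * b)) = a * (((n : ℝ) - 2) • b) :=
      fun a b => by rw [mul_smul_comm]
    simp only [e, two_smul]
    ring
  rw [h1, Zo_rad h, Ga_rad h]; simp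

lemma isRad_r2 : IsRad (r2 : Sm n) := by
  intro i
  rw [pd_r2, Eu_r2, mul_smul_comm, mul_smul_comm, mul_comm]

/-- The shifted Euler operator. -/
def Ao (k : ℝ) : Sm n →ₗ[ℝ] Sm n where
  toFun f := Eu f + k • f
  map_add' f g := by simp only [map_add, smul_add]; abel
  map_smul' c f := by
    simp only [Derivation.map_smul, RingHom.id_apply]
    module

lemma Ao_eq (k : ℝ) (f : Sm n) : Ao k f = Eu f + k • f := rfl

lemma Ao_Zo (k : ℝ) (f : Sm n) : Ao k (Zo f) = Zo (Ao k f) := by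
  simp only [Ao_eq, map_add, Eu_Zo, map_smul]

lemma Ao_r2 (k : ℝ) (f : Sm n) : Ao k (r2 * f) = r2 * (Ao k f + (2 : ℝ) • f) := by
  simp only [Ao_eq, Eu_mul, Eu_r2, mul_add, mul_smul_comm]
  rw [mul_comm f r2]; module

/-- The factors of the conjugated tri-Laplacian. -/
def To (k b j : ℝ) (f : Sm n) : Sm n :=
  Zo f + ((k + b + 2) ^ 2 - (b + j) ^ 2) • f - (2 * (b + j)) • Ao k f - Ao k (Ao k f)

lemma To_two {k b : ℝ} (h : (n : ℝ) = 2 * (k + b) + 6) (f : Sm n) :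
    r2 * Lap f = - To k b 2 f := by
  simp only [To, Zo_eq, Ao_eq, h, map_add, Derivation.map_smul]
  module

lemma To_r2 (k b j : ℝ) (f : Sm n) : To k b j (r2 * f) = r2 * To k b (j + 2) f := by
  simp only [To, Zo_rad_mul isRad_r2, Ao_r2, map_add, map_smul, mul_sub, mul_add, mul_smul_comm]
  module

lemma To_neg (k b j : ℝ) (f : Sm n) : To k b j (-f) = - To k b j f := by
  simp only [To, map_neg]; module

lemma six {k b : ℝ} (h : (n : ℝ) = 2 * (k + b) + 6) (f : Sm n) :
    r2 ^ 3 * (- Lap (Lap (Lap f))) = To k b (-2) (To k b 0 (To k b 2 f)) := by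
  have e1 : To k b 2 f = - (r2 * Lap f) := by rw [To_two h]; simp
  have e2 : To k b 0 (To k b 2 f) = r2 * (r2 * Lap (Lap f)) := by
    rw [e1, To_neg, To_r2, zero_add, To_two h]; ring
  rw [e2, To_r2, To_r2]
  have : (-2 + 2 + 2 : ℝ) = 2 := by norm_num
  have e3 : To k b 2 (Lap (Lap f)) = -(r2 * Lap (Lap (Lap f))) := by rw [To_two h]; simp
  rw [this, e3]; ring


/-! ### Integral identities with radial weights -/

lemma cs_mul_right (f g : Sm n) (h : HasCompactSupport g.1) : HasCompactSupport (f * g).1 :=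
  HasCompactSupport.mul_left (f := f.1) h

lemma cs_mul_left (f g : Sm n) (h : HasCompactSupport f.1) : HasCompactSupport (f * g).1 :=
  HasCompactSupport.mul_right (f' := g.1) h

lemma cs_add {f g : Sm n} (hf : HasCompactSupport f.1) (hg : HasCompactSupport g.1) :
    HasCompactSupport (f + g).1 := HasCompactSupport.add hf hg

lemma cs_smul (c : ℝ) {f : Sm n} (hf : HasCompactSupport f.1) : HasCompactSupport (c • f).1 := by
  have : c • f = (c • (1 : Sm n)) * f := by rw [smul_mul_assoc, one_mul]
  rw [this]; exact cs_mul_right _ _ hf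

lemma cs_sum {ι : Type*} (s : Finset ι) (f : ι → Sm n) (h : ∀ i, HasCompactSupport (f i).1) :
    HasCompactSupport (∑ i ∈ s, f i).1 := by
  classical
  induction s using Finset.induction_on with
  | empty => exact HasCompactSupport.zero
  | insert a s ha ih => rw [Finset.sum_insert ha]; exact cs_add (h a) ih

lemma cs_Eu {f : Sm n} (h : HasCompactSupport f.1) : HasCompactSupport (Eu f).1 := by
  rw [Eu_eq]
  exact cs_sum _ _ fun i => cs_mul_right _ _ (pd_cs i f h)

lemma cs_int {f : Sm n} (h : HasCompactSupport f.1) : Integrable f.1 :=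
  CS.int ⟨smcont f, h⟩

lemma int_add' {f g : Sm n} (hf : HasCompactSupport f.1) (hg : HasCompactSupport g.1) :
    ∫ x, (f + g) x = (∫ x, f x) + ∫ x, g x := integral_add (cs_int hf) (cs_int hg)

lemma int_smul' (c : ℝ) (f : Sm n) : ∫ x, (c • f) x = c * ∫ x, f x :=
  integral_const_mul c f.1

lemma int_sum_pd (f : Fin n → Sm n) (h : ∀ i, HasCompactSupport (f i).1) :
    ∫ x, (∑ i, pd i (f i)) x = 0 := by
  simp only [Sm.sum_ap]
  rw [integral_finsetSum _ (fun i _ => cs_int (pd_cs i (f i) (h i)))]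
  exact Finset.sum_eq_zero fun i _ => int_pd i _ (h i)

lemma int_Eu (f : Sm n) (h : HasCompactSupport f.1) :
    ∫ x, (Eu f) x = -(n : ℝ) * ∫ x, f x := by
  have e : Eu f = (∑ i, pd i (co i * f)) + (-(n : ℝ)) • f := by
    simp only [pd_mul, pd_co, Finset.sum_add_distrib, Eu_eq]
    simp only [if_true, mul_one, Finset.sum_const, Finset.card_univ, Fintype.card_fin]
    rw [neg_smul, Nat.cast_smul_eq_nsmul]; abel
  have hs : ∀ i, HasCompactSupport (co i * f).1 := fun i => cs_mul_right _ _ h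
  rw [e, int_add' (cs_sum _ _ fun i => pd_cs i _ (hs i)) (cs_smul _ h), int_sum_pd _ hs,
    int_smul', zero_add]

lemma int_Zo (f h : Sm n) (hh : HasCompactSupport h.1) :
    ∫ x, (Zo f * h) x = ∫ x, (Ga f h) x := by
  have hs : ∀ i, HasCompactSupport (h * (r2 * pd i f)).1 := fun i => cs_mul_left _ _ hh
  have h2 : HasCompactSupport (h * Eu f).1 := cs_mul_left _ _ hh
  have hd : HasCompactSupport (∑ i, pd i (h * (r2 * pd i f))).1 :=
    cs_sum _ _ fun i => pd_cs i _ (hs i)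
  have e : Ga f h = (∑ i, pd i (h * (r2 * pd i f))) + ((-1 : ℝ) • Eu (h * Eu f)
      + ((-(n : ℝ)) • (h * Eu f) + Zo f * h)) := by
    have e1 : ∑ i, pd i (h * (r2 * pd i f)) = h * (r2 * Lap f) + (2 : ℝ) • (h * Eu f)
        + r2 * ∑ i, pd i f * pd i h := by
      rw [Lap_eq, Eu_eq]
      simp only [Finset.mul_sum, Finset.smul_sum, ← Finset.sum_add_distrib]
      refine Finset.sum_congr rfl fun i _ => ?_
      simp only [pd_mul, pd_r2, mul_add, mul_smul_comm]
      rw [mul_comm (pd i f) (co i)]; ring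
    rw [e1]
    simp only [Ga, Eu_mul, Zo_eq, add_mul, smul_mul_assoc, neg_mul]
    have c0 : -(r2 * Lap f) * h = -(r2 * Lap f * h) := by ring
    rw [c0, mul_comm h (r2 * Lap f), mul_comm h (Eu f), mul_comm h (Eu (Eu f))]
    module
  rw [e, int_add' hd (cs_add (cs_smul _ (cs_Eu h2)) (cs_add (cs_smul _ h2) (cs_mul_right _ _ hh))),
    int_sum_pd _ hs, int_add' (cs_smul _ (cs_Eu h2)) (cs_add (cs_smul _ h2) (cs_mul_right _ _ hh)),
    int_add' (cs_smul _ h2) (cs_mul_right _ _ hh), int_smul', int_smul', int_Eu _ h2]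
  ring

lemma isRad_Eu {ρ : Sm n} (h : IsRad ρ) : IsRad (Eu ρ) := by
  intro i
  have h1 := congrArg Eu (h i)
  have h3 : Eu (co i : Sm n) = co i := by
    rw [Eu_eq]; simp [pd_co]
  simp only [Eu_mul, Eu_r2, h3] at h1
  rw [pd_Eu, mul_add]
  have h2 := h i
  rw [mul_smul_comm, two_smul, mul_comm (pd i ρ) r2, h2, mul_comm (Eu ρ)] at h1
  have h4 : r2 * Eu (pd i ρ) = co i * Eu (Eu ρ) - co i * Eu ρ := by
    linear_combination h1
  rw [h4, h2]; ring

lemma isRad_mul {ρ σ : Sm n} (h : IsRad ρ) (h' : IsRad σ) : IsRad (ρ * σ) := by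
  intro i
  rw [pd_mul, Eu_mul]
  linear_combination σ * h i + ρ * h' i

lemma isRad_add {ρ σ : Sm n} (h : IsRad ρ) (h' : IsRad σ) : IsRad (ρ + σ) := by
  intro i
  rw [map_add, map_add]
  linear_combination h i + h' i

lemma isRad_smul (c : ℝ) {ρ : Sm n} (h : IsRad ρ) : IsRad (c • ρ) := by
  intro i
  rw [Derivation.map_smul, Derivation.map_smul, mul_smul_comm, h i, mul_smul_comm]

/-- Radial weights with compact support. -/
def Wt (n : ℕ) := {W : Sm n // IsRad W ∧ HasCompactSupport W.1}

/-- The operator on weights dual to `Ao k`. -/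
def Th (k : ℝ) (W : Wt n) : Wt n :=
  ⟨Ao ((n : ℝ) - 2 * k) W.1, isRad_add (isRad_Eu W.2.1) (isRad_smul _ W.2.1),
    cs_add (cs_Eu W.2.2) (cs_smul _ W.2.2)⟩

/-- The weighted integral. -/
def Jw (W : Wt n) (g : Sm n) : Sm n →ₗ[ℝ] ℝ where
  toFun f := ∫ x, (f * g * W.1) x
  map_add' f f' := by
    rw [add_mul, add_mul]
    exact int_add' (cs_mul_right _ _ W.2.2) (cs_mul_right _ _ W.2.2)
  map_smul' c f := by
    rw [smul_mul_assoc, smul_mul_assoc, int_smul']; rfl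

lemma Jw_eq (W : Wt n) (f g : Sm n) : Jw W g f = ∫ x, (f * g * W.1) x := rfl

lemma Jw_symm (W : Wt n) (f g : Sm n) : Jw W g f = Jw W f g := by
  rw [Jw_eq, Jw_eq, mul_comm f g]

lemma Jw_Ao (k : ℝ) (W : Wt n) (f g : Sm n) :
    Jw W g (Ao k f) = - Jw W (Ao k g) f - Jw (Th k W) g f := by
  have hs := fun f g : Sm n => cs_mul_right (f * g) W.1 W.2.2
  have hs' := fun f g : Sm n => cs_mul_right (f * g) (Th k W).1 (Th k W).2.2
  have e : Ao k f * g * W.1 + (f * Ao k g * W.1 + f * g * (Th k W).1)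
      = Eu (f * g * W.1) + (n : ℝ) • (f * g * W.1) := by
    simp only [Th, Ao_eq, Eu_mul, mul_add, add_mul, smul_mul_assoc, mul_smul_comm]
    have c1 : f * Eu g * W.1 = W.1 * (f * Eu g) := by ring
    have c2 : Eu f * g * W.1 = W.1 * (g * Eu f) := by ring
    rw [c1, c2]; module
  have h := congrArg (fun F : Sm n => ∫ x, F x) e
  beta_reduce at h
  rw [int_add' (hs _ _) (cs_add (hs _ _) (hs' _ _)), int_add' (hs _ _) (hs' _ _),
    int_add' (cs_Eu (hs _ _)) (cs_smul _ (hs _ _)), int_Eu _ (hs _ _), int_smul'] at h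
  simp only [Jw_eq]
  linarith

lemma Jw_Zo_Ga (W : Wt n) (f g : Sm n) : Jw W g (Zo f) = ∫ x, (Ga f g * W.1) x := by
  rw [Jw_eq, mul_assoc, int_Zo _ _ (cs_mul_right _ _ W.2.2), Ga_comm, mul_comm g,
    Ga_rad_mul W.2.1, Ga_comm, mul_comm]

lemma Jw_Zo (W : Wt n) (f g : Sm n) : Jw W g (Zo f) = Jw W (Zo g) f := by
  rw [Jw_Zo_Ga, Jw_symm, Jw_Zo_Ga, Ga_comm]

/-- The bilinear forms. -/
def Bf (j : ℕ) (W : Wt n) (f g : Sm n) : ℝ := Jw W g ((Zo ^ j) f)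

lemma Zo_pow_succ (j : ℕ) (f : Sm n) : (Zo ^ (j + 1)) f = Zo ((Zo ^ j) f) := by
  rw [pow_succ']; rfl

lemma Zo_pow_succ' (j : ℕ) (f : Sm n) : (Zo ^ (j + 1)) f = (Zo ^ j) (Zo f) := by
  rw [pow_succ]; rfl

lemma Bf_symm (j : ℕ) (W : Wt n) (f g : Sm n) : Bf j W f g = Bf j W g f := by
  unfold Bf
  have : ∀ (j : ℕ) (f g : Sm n), Jw W g ((Zo ^ j) f) = Jw W ((Zo ^ j) g) f := by
    intro j
    induction j with
    | zero => intro f g; simp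
    | succ j ih => intro f g; rw [Zo_pow_succ', ih, Jw_Zo, Zo_pow_succ]
  rw [this, Jw_symm]

lemma Ao_Zo_pow (k : ℝ) (j : ℕ) (f : Sm n) : Ao k ((Zo ^ j) f) = (Zo ^ j) (Ao k f) := by
  induction j with
  | zero => simp
  | succ j ih => rw [Zo_pow_succ, Zo_pow_succ, Ao_Zo, ih]

lemma Bf_Ao (k : ℝ) (j : ℕ) (W : Wt n) (f g : Sm n) :
    Bf j W (Ao k f) g = - Bf j W f (Ao k g) - Bf j (Th k W) f g := by
  unfold Bf
  rw [← Ao_Zo_pow, Jw_Ao]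

lemma Bf_add (j : ℕ) (W : Wt n) (f f' g : Sm n) :
    Bf j W (f + f') g = Bf j W f g + Bf j W f' g := by
  unfold Bf; rw [map_add, map_add]

lemma Bf_smul (j : ℕ) (W : Wt n) (c : ℝ) (f g : Sm n) :
    Bf j W (c • f) g = c * Bf j W f g := by
  unfold Bf; rw [map_smul, map_smul]; rfl

/-- Pointwise densities of the bilinear forms. -/
def ed : ℕ → Sm n → Sm n → Sm n
  | 0, f, g => f * g
  | 1, f, g => Ga f g
  | 2, f, g => Zo f * Zo g
  | 3, f, g => Ga (Zo f) (Zo g)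
  | _, _, _ => 0

lemma Bf_ed (j : ℕ) (hj : j ≤ 3) (W : Wt n) (f g : Sm n) :
    Bf j W f g = ∫ x, (ed j f g * W.1) x := by
  unfold Bf
  interval_cases j
  · rw [pow_zero]; rfl
  · rw [pow_one, Jw_Zo_Ga]; rfl
  · rw [pow_two]; change Jw W g (Zo (Zo f)) = _; rw [Jw_Zo]; rfl
  · rw [pow_succ, pow_two]; change Jw W g (Zo (Zo (Zo f))) = _; rw [Jw_Zo, Jw_Zo_Ga]; rfl

lemma r2_ap (x : EuclideanSpace ℝ (Fin n)) : (r2 : Sm n) x = ∑ i, x i * x i := by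
  rw [r2, Sm.sum_ap]; rfl

lemma r2_norm (x : EuclideanSpace ℝ (Fin n)) : (r2 : Sm n) x = ‖x‖ ^ 2 := by
  rw [r2_ap, EuclideanSpace.norm_sq_eq]
  exact Finset.sum_congr rfl fun i _ => by simp [sq]

lemma Ga_nonneg (f : Sm n) (x) : 0 ≤ (Ga f f) x := by
  have h := Finset.sum_mul_sq_le_sq_mul_sq Finset.univ (fun i => x i) (fun i => (pd i f) x)
  have h2 : (Eu f) x = ∑ i, x i * (pd i f) x := by rw [Eu_eq, Sm.sum_ap]; rfl
  simp only [Ga, Sm.sub_ap, Sm.mul_ap, Sm.sum_ap, r2_ap, h2]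
  simp only [sq] at h
  linarith

lemma Ga_add_right (f g h : Sm n) : Ga h (f + g) = Ga h f + Ga h g := by
  rw [Ga_comm, Ga_add, Ga_comm f, Ga_comm g]

lemma Ga_smul_right (c : ℝ) (f h : Sm n) : Ga h (c • f) = c • Ga h f := by
  rw [Ga_comm, Ga_smul, Ga_comm f]

lemma ed_nonneg (j : ℕ) (f : Sm n) (x) : 0 ≤ (ed j f f) x := by
  match j with
  | 0 => exact mul_self_nonneg _
  | 1 => exact Ga_nonneg _ _
  | 2 => exact mul_self_nonneg _
  | 3 => exact Ga_nonneg _ _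
  | _ + 4 => exact le_rfl

lemma ed_add (j : ℕ) (f f' g : Sm n) : ed j (f + f') g = ed j f g + ed j f' g := by
  match j with
  | 0 => exact add_mul _ _ _
  | 1 => exact Ga_add _ _ _
  | 2 => simp only [ed, map_add, add_mul]
  | 3 => simp only [ed, map_add, Ga_add]
  | _ + 4 => simp [ed]

lemma ed_smul (j : ℕ) (c : ℝ) (f g : Sm n) : ed j (c • f) g = c • ed j f g := by
  match j with
  | 0 => simp only [ed, smul_mul_assoc]
  | 1 => exact Ga_smul _ _ _
  | 2 => simp only [ed, map_smul, smul_mul_assoc]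
  | 3 => simp only [ed, map_smul, Ga_smul]
  | _ + 4 => simp [ed]

lemma ed_comm (j : ℕ) (f g : Sm n) : ed j f g = ed j g f := by
  match j with
  | 0 => exact mul_comm _ _
  | 1 => exact Ga_comm _ _
  | 2 => exact mul_comm _ _
  | 3 => exact Ga_comm _ _
  | _ + 4 => rfl

lemma ed_abs (j : ℕ) (f g : Sm n) (x) : |(ed j f g) x| ≤ (ed j f f) x + (ed j g g) x := by
  have h1 := ed_nonneg j (f + g) x
  have h2 := ed_nonneg j (f + (-1 : ℝ) • g) x
  have h3 := ed_nonneg j f x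
  have h4 := ed_nonneg j g x
  rw [ed_add, ed_comm j f, ed_comm j g, ed_add, ed_add, ed_comm j g f] at h1
  rw [ed_add, ed_comm j f, ed_smul, ed_comm j g, ed_add, ed_add, ed_smul, ed_smul,
    ed_comm j g f] at h2
  simp only [Sm.add_ap, Sm.smul_ap] at h1 h2
  rw [abs_le]; constructor <;> linarith

lemma ed_rad_mul (j : ℕ) {ρ : Sm n} (h : IsRad ρ) (f g : Sm n) :
    ed j (ρ * f) g = ρ * ed j f g := by
  match j with
  | 0 => simp only [ed, mul_assoc]
  | 1 => exact Ga_rad_mul h _ _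
  | 2 => simp only [ed, Zo_rad_mul h, mul_assoc]
  | 3 => simp only [ed, Zo_rad_mul h, Ga_rad_mul h]
  | _ + 4 => simp [ed]

/-! ### Abstract reduction lemma -/

section Seq
variable {V : Type*} [AddCommGroup V] [Module ℝ V] (E : Submodule ℝ V) (b : ℕ → ℕ → ℕ → V) (L : ℕ)

lemma seq_err (hs : ∀ s i i', b s i i' = b s i' i)
    (hr : ∀ s i i', b s (i + 1) i' = - b s i (i' + 1) - b (s + 1) i i')
    (hd : ∀ s l, 1 ≤ s → l ≤ L → b s l l ∈ E) :
    ∀ m s i, 1 ≤ s → 2 * i + m ≤ 2 * L + 1 → b s (i + m) i ∈ E := by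
  intro m
  induction m using Nat.strong_induction_on with
  | _ m ih =>
    intro s i h1 h2
    match m with
    | 0 => exact hd s i h1 (by omega)
    | 1 =>
      have h := hr s i i
      rw [hs s i (i + 1)] at h
      have h3 := hd (s + 1) i (by omega) (by omega)
      have : b s (i + 1) i = (-(1 / 2) : ℝ) • b (s + 1) i i := by
        have h5 : (2 : ℝ) • b s (i + 1) i = - b (s + 1) i i := by
          rw [two_smul]; nth_rewrite 1 [h]; abel
        have h6 := congrArg (fun v => (1 / 2 : ℝ) • v) h5
        simp only [smul_smul] at h6
        norm_num at h6
        rw [h6]; module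
      rw [this]; exact E.smul_mem _ h3
    | m + 2 =>
      have h := hr s (i + (m + 1)) i
      have e1 := ih m (by omega) s (i + 1) h1 (by omega)
      have e2 := ih (m + 1) (by omega) (s + 1) i (by omega) (by omega)
      have e3 : i + (m + 2) = i + (m + 1) + 1 := by omega
      have e4 : i + 1 + m = i + (m + 1) := by omega
      rw [e3, h]
      rw [e4] at e1
      exact E.sub_mem (E.neg_mem e1) e2

lemma seq_step (hs : ∀ s i i', b s i i' = b s i' i)
    (hr : ∀ s i i', b s (i + 1) i' = - b s i (i' + 1) - b (s + 1) i i')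
    (hd : ∀ s l, 1 ≤ s → l ≤ L → b s l l ∈ E) (i m : ℕ) (h2 : 2 * i + m + 1 ≤ 2 * L + 2) :
    b 0 (i + m + 1) i + b 0 (i + m) (i + 1) ∈ E := by
  have h := hr 0 (i + m) i
  have := seq_err E b L hs hr hd m 1 i le_rfl (by omega)
  rw [h]
  have e : -b 0 (i + m) (i + 1) - b (0 + 1) (i + m) i + b 0 (i + m) (i + 1) = - b 1 (i + m) i := by
    rw [zero_add]; abel
  rw [e]; exact E.neg_mem this

lemma seq_odd1 (hs : ∀ s i i', b s i i' = b s i' i)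
    (hr : ∀ s i i', b s (i + 1) i' = - b s i (i' + 1) - b (s + 1) i i')
    (hd : ∀ s l, 1 ≤ s → l ≤ L → b s l l ∈ E) (i : ℕ) (h2 : i ≤ L) :
    b 0 (i + 1) i ∈ E := by
  have h := seq_step E b L hs hr hd i 0 (by omega)
  simp only [add_zero] at h
  rw [hs 0 i (i + 1), ← two_smul ℝ] at h
  have := E.smul_mem (1 / 2 : ℝ) h
  rw [smul_smul] at this
  norm_num at this
  exact this
end Seq

/-! ### Expansion of the operator -/

lemma expansion (k b M : ℝ) (hM : M = k + b + 2) (f : Sm n) :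
    To k b (-2) (To k b 0 (To k b 2 f)) =
    (M^6-8*M^4+16*M^2-3*M^4*b^2+3*M^2*b^4-16*b^2+8*b^4-b^6) • f
    + (-32*b+32*b^3-6*b^5+12*M^2*b^3-6*M^4*b) • Ao k f
    + (-16+48*b^2-15*b^4+18*M^2*b^2-3*M^4) • Ao k (Ao k f)
    + (32*b-20*b^3+12*M^2*b) • Ao k (Ao k (Ao k f))
    + (8-15*b^2+3*M^2) • Ao k (Ao k (Ao k (Ao k f)))
    + (-6*b) • Ao k (Ao k (Ao k (Ao k (Ao k f))))
    - Ao k (Ao k (Ao k (Ao k (Ao k (Ao k f)))))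
    + (16+3*b^4-16*M^2-6*M^2*b^2+3*M^4) • Zo f
    + (12*b^3-12*M^2*b) • Zo (Ao k f)
    + (18*b^2-6*M^2) • Zo (Ao k (Ao k f))
    + (12*b) • Zo (Ao k (Ao k (Ao k f)))
    + (3 : ℝ) • Zo (Ao k (Ao k (Ao k (Ao k f))))
    + (-8-3*b^2+3*M^2) • Zo (Zo f)
    + (-6*b) • Zo (Zo (Ao k f))
    + (-3 : ℝ) • Zo (Zo (Ao k (Ao k f)))
    + Zo (Zo (Zo f)) := by
  subst hM
  simp only [To, map_add, map_sub, map_smul, Ao_Zo]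
  module


section Seq2
variable {Q : Type*} [AddCommGroup Q] [Module ℝ Q] (b : ℕ → ℕ → ℕ → Q)

/-- Hypotheses of the reduction lemma, with values in a quotient. -/
structure SeqH (L : ℕ) : Prop where
  hs : ∀ s i i', b s i i' = b s i' i
  hr : ∀ s i i', b s (i + 1) i' = - b s i (i' + 1) - b (s + 1) i i'
  hd : ∀ s l, 1 ≤ s → l ≤ L → b s l l = 0

variable {b}

lemma SeqH.odd {L : ℕ} (h : SeqH b L) (i : ℕ) (hi : i ≤ L) : b 0 (i + 1) i = 0 := by
  simpa using seq_odd1 ⊥ b L h.hs h.hr (by simpa using h.hd) i hi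

lemma SeqH.step {L : ℕ} (h : SeqH b L) (i m : ℕ) (hi : 2 * i + m + 1 ≤ 2 * L + 2) :
    b 0 (i + m + 1) i = - b 0 (i + m) (i + 1) := by
  have := seq_step ⊥ b L h.hs h.hr (by simpa using h.hd) i m hi
  rw [Submodule.mem_bot] at this
  exact eq_neg_of_add_eq_zero_left this

lemma SeqH.s0 {L : ℕ} (h : SeqH b L) : b 0 1 0 = 0 ∧ b 0 0 1 = 0 :=
  ⟨h.odd 0 (by omega), by rw [h.hs]; exact h.odd 0 (by omega)⟩

lemma SeqH.s1 {L : ℕ} (h : SeqH b L) (hL : 1 ≤ L) :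
    b 0 2 0 = - b 0 1 1 ∧ b 0 2 1 = 0 ∧ b 0 3 0 = 0 := by
  have h1 := h.odd 1 (by omega)
  refine ⟨h.step 0 1 (by omega), h1, ?_⟩
  rw [h.step 0 2 (by omega)]; simpa using h1

lemma SeqH.s2 {L : ℕ} (h : SeqH b L) (hL : 2 ≤ L) :
    b 0 3 1 = - b 0 2 2 ∧ b 0 4 0 = b 0 2 2 ∧ b 0 4 1 = 0 ∧ b 0 5 0 = 0 := by
  have h1 := h.odd 2 (by omega)
  have h2 : b 0 3 1 = - b 0 2 2 := h.step 1 1 (by omega)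
  have h3 : b 0 4 0 = - b 0 3 1 := h.step 0 3 (by omega)
  have h4 : b 0 4 1 = - b 0 3 2 := h.step 1 2 (by omega)
  have h5 : b 0 5 0 = - b 0 4 1 := h.step 0 4 (by omega)
  simp at h1
  refine ⟨h2, ?_, ?_, ?_⟩
  · rw [h3, h2, neg_neg]
  · rw [h4, h1, neg_zero]
  · rw [h5, h4, h1]; simp

lemma SeqH.s3 {L : ℕ} (h : SeqH b L) (hL : 3 ≤ L) :
    b 0 5 1 = b 0 3 3 ∧ b 0 6 0 = - b 0 3 3 ∧ b 0 6 1 = 0 := by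
  have h1 := h.odd 3 (by omega)
  have h2 : b 0 4 2 = - b 0 3 3 := h.step 2 1 (by omega)
  have h3 : b 0 5 1 = - b 0 4 2 := h.step 1 3 (by omega)
  have h4 : b 0 5 2 = - b 0 4 3 := h.step 2 2 (by omega)
  have h5 : b 0 6 0 = - b 0 5 1 := h.step 0 5 (by omega)
  have h6 : b 0 6 1 = - b 0 5 2 := h.step 1 4 (by omega)
  simp at h1
  refine ⟨?_, ?_, ?_⟩
  · rw [h3, h2, neg_neg]
  · rw [h5, h3, h2, neg_neg]
  · rw [h6, h4, h1]; simp
end Seq2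

lemma test_id (k b M : ℝ) (hM : M = k + b + 2) (hn : (n : ℝ) = 2 * (k + b) + 6) (W : Wt n)
    (f g : Sm n) :
    Jw W g (r2 ^ 3 * (- Lap (Lap (Lap f)))) =
    (M^6-8*M^4+16*M^2-3*M^4*b^2+3*M^2*b^4-16*b^2+8*b^4-b^6) * Bf 0 W ((Ao k ^ 0) f) g
    + (-32*b+32*b^3-6*b^5+12*M^2*b^3-6*M^4*b) * Bf 0 W ((Ao k ^ 1) f) g
    + (-16+48*b^2-15*b^4+18*M^2*b^2-3*M^4) * Bf 0 W ((Ao k ^ 2) f) g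
    + (32*b-20*b^3+12*M^2*b) * Bf 0 W ((Ao k ^ 3) f) g
    + (8-15*b^2+3*M^2) * Bf 0 W ((Ao k ^ 4) f) g
    + (-6*b) * Bf 0 W ((Ao k ^ 5) f) g
    - Bf 0 W ((Ao k ^ 6) f) g
    + (16+3*b^4-16*M^2-6*M^2*b^2+3*M^4) * Bf 1 W ((Ao k ^ 0) f) g
    + (12*b^3-12*M^2*b) * Bf 1 W ((Ao k ^ 1) f) g
    + (18*b^2-6*M^2) * Bf 1 W ((Ao k ^ 2) f) g
    + (12*b) * Bf 1 W ((Ao k ^ 3) f) g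
    + 3 * Bf 1 W ((Ao k ^ 4) f) g
    + (-8-3*b^2+3*M^2) * Bf 2 W ((Ao k ^ 0) f) g
    + (-6*b) * Bf 2 W ((Ao k ^ 1) f) g
    + (-3) * Bf 2 W ((Ao k ^ 2) f) g
    + Bf 3 W ((Ao k ^ 0) f) g := by
  rw [six hn, expansion k b M hM]
  simp only [map_add, map_sub, map_smul, smul_eq_mul]
  have h1 : ∀ (j : ℕ) (f : Sm n), (Ao k ^ (j + 1)) f = (Ao k ^ j) (Ao k f) := by
    intro j f; rw [pow_succ]; rfl
  have h2 : ∀ f : Sm n, (Ao k ^ 0) f = f := by intro f; rw [pow_zero]; rfl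
  have h3 : ∀ f : Sm n, (Zo ^ 0) f = f := by intro f; rw [pow_zero]; rfl
  have e1 : ∀ f : Sm n, (Ao k ^ 1) f = Ao k f := by intro f; rw [h1, h2]
  have e2 : ∀ f : Sm n, (Ao k ^ 2) f = Ao k (Ao k f) := by intro f; rw [h1, e1]
  have e3 : ∀ f : Sm n, (Ao k ^ 3) f = Ao k (Ao k (Ao k f)) := by intro f; rw [h1, e2]
  have e4 : ∀ f : Sm n, (Ao k ^ 4) f = Ao k (Ao k (Ao k (Ao k f))) := by intro f; rw [h1, e3]
  have e5 : ∀ f : Sm n, (Ao k ^ 5) f = Ao k (Ao k (Ao k (Ao k (Ao k f)))) := by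
    intro f; rw [h1, e4]
  have e6 : ∀ f : Sm n, (Ao k ^ 6) f = Ao k (Ao k (Ao k (Ao k (Ao k (Ao k f))))) := by
    intro f; rw [h1, e5]
  have z1 : ∀ f : Sm n, (Zo ^ 1) f = Zo f := by intro f; rw [Zo_pow_succ', h3]
  have z2 : ∀ f : Sm n, (Zo ^ 2) f = Zo (Zo f) := by intro f; rw [Zo_pow_succ', z1]
  have z3 : ∀ f : Sm n, (Zo ^ 3) f = Zo (Zo (Zo f)) := by intro f; rw [Zo_pow_succ', z2]
  simp only [Bf, e1, e2, e3, e4, e5, e6, h2, h3, z1, z2, z3]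

section Fam
variable {I : Type*} (k : ℝ) (W : I → Wt n) (f : I → Sm n)

/-- The family of iterated forms. -/
def bb (j s i i' : ℕ) : I → ℝ := fun ι =>
  Bf j ((Th k)^[s] (W ι)) ((Ao k ^ i) (f ι)) ((Ao k ^ i') (f ι))

variable {k W f}

lemma bb_seq (E : Submodule ℝ (I → ℝ)) (j L : ℕ)
    (hd : ∀ s l, 1 ≤ s → l ≤ L → bb k W f j s l l ∈ E) :
    SeqH (fun s i i' => E.mkQ (bb k W f j s i i')) L where
  hs s i i' := by
    congr 1; funext ι; exact Bf_symm _ _ _ _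
  hr s i i' := by
    rw [← map_neg, ← map_sub]
    congr 1; funext ι
    simp only [bb, Pi.sub_apply, Pi.neg_apply, Function.iterate_succ_apply']
    rw [pow_succ', pow_succ']
    have := Bf_Ao k j ((Th k)^[s] (W ι)) ((Ao k ^ i) (f ι)) ((Ao k ^ i') (f ι))
    change Bf j ((Th k)^[s] (W ι)) (Ao k ((Ao k ^ i) (f ι))) ((Ao k ^ i') (f ι)) = _
    rw [this]; rfl
  hd s l h1 h2 := by
    simpa using hd s l h1 h2

lemma red_b (E : Submodule ℝ (I → ℝ)) {b M : ℝ} (hM : M = k + b + 2)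
    (hn : (n : ℝ) = 2 * (k + b) + 6)
    (hd : ∀ j s l, 1 ≤ s → l + j ≤ 3 → bb k W f j s l l ∈ E) :
    (fun ι => Jw (W ι) (f ι) (r2 ^ 3 * (- Lap (Lap (Lap (f ι)))))) -
    ((M^6-8*M^4+16*M^2-3*M^4*b^2+3*M^2*b^4-16*b^2+8*b^4-b^6) • bb k W f 0 0 0 0
      + (16-48*b^2+15*b^4-18*M^2*b^2+3*M^4) • bb k W f 0 0 1 1
      + (8-15*b^2+3*M^2) • bb k W f 0 0 2 2
      + bb k W f 0 0 3 3
      + (16+3*b^4-16*M^2-6*M^2*b^2+3*M^4) • bb k W f 1 0 0 0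
      + (6*M^2-18*b^2) • bb k W f 1 0 1 1
      + (3 : ℝ) • bb k W f 1 0 2 2
      + (-8-3*b^2+3*M^2) • bb k W f 2 0 0 0
      + (3 : ℝ) • bb k W f 2 0 1 1
      + bb k W f 3 0 0 0) ∈ E := by
  have S0 := bb_seq E 0 3 (fun s l h1 h2 => hd 0 s l h1 (by omega))
  have S1 := bb_seq E 1 2 (fun s l h1 h2 => hd 1 s l h1 (by omega))
  have S2 := bb_seq E 2 1 (fun s l h1 h2 => hd 2 s l h1 (by omega))
  have e : (fun ι => Jw (W ι) (f ι) (r2 ^ 3 * (- Lap (Lap (Lap (f ι)))))) =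
    (M^6-8*M^4+16*M^2-3*M^4*b^2+3*M^2*b^4-16*b^2+8*b^4-b^6) • bb k W f 0 0 0 0
    + (-32*b+32*b^3-6*b^5+12*M^2*b^3-6*M^4*b) • bb k W f 0 0 1 0
    + (-16+48*b^2-15*b^4+18*M^2*b^2-3*M^4) • bb k W f 0 0 2 0
    + (32*b-20*b^3+12*M^2*b) • bb k W f 0 0 3 0
    + (8-15*b^2+3*M^2) • bb k W f 0 0 4 0
    + (-6*b) • bb k W f 0 0 5 0
    - bb k W f 0 0 6 0
    + (16+3*b^4-16*M^2-6*M^2*b^2+3*M^4) • bb k W f 1 0 0 0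
    + (12*b^3-12*M^2*b) • bb k W f 1 0 1 0
    + (18*b^2-6*M^2) • bb k W f 1 0 2 0
    + (12*b) • bb k W f 1 0 3 0
    + (3 : ℝ) • bb k W f 1 0 4 0
    + (-8-3*b^2+3*M^2) • bb k W f 2 0 0 0
    + (-6*b) • bb k W f 2 0 1 0
    + (-3 : ℝ) • bb k W f 2 0 2 0
    + bb k W f 3 0 0 0 := by
    funext ι
    rw [test_id k b M hM hn]; rfl
  rw [e, ← Submodule.ker_mkQ E, LinearMap.mem_ker]
  simp only [map_sub, map_add, map_smul]
  obtain ⟨a1, -⟩ := S0.s0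
  obtain ⟨a2, -, a3⟩ := S0.s1 (by norm_num)
  obtain ⟨-, a4, -, a5⟩ := S0.s2 (by norm_num)
  obtain ⟨-, a6, -⟩ := S0.s3 (by norm_num)
  obtain ⟨b1, -⟩ := S1.s0
  obtain ⟨b2, -, b3⟩ := S1.s1 (by norm_num)
  obtain ⟨-, b4, -, b5⟩ := S1.s2 (by norm_num)
  obtain ⟨c1, -⟩ := S2.s0
  obtain ⟨c2, -, c3⟩ := S2.s1 (by norm_num)
  rw [a1, a2, a3, a4, a5, a6, b1, b2, b3, b4, c1, c2]
  module

lemma red_c (E : Submodule ℝ (I → ℝ)) {b M : ℝ} (hM : M = k + b + 2)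
    (hn : (n : ℝ) = 2 * (k + b) + 6)
    (hd : ∀ j s l, 1 ≤ s → l + j ≤ 3 → bb k W f j s l l ∈ E) :
    (fun ι => Jw (W ι) (Ao k (f ι)) (r2 ^ 3 * (- Lap (Lap (Lap (f ι)))))) -
    (-2 * b) • ((3 * (M^2 - b^2)^2 + 16 - 16 * b^2) • bb k W f 0 0 1 1
      + (6*M^2+16-10*b^2) • bb k W f 0 0 2 2
      + (3 : ℝ) • bb k W f 0 0 3 3
      + (6*(M^2-b^2)) • bb k W f 1 0 1 1
      + (6 : ℝ) • bb k W f 1 0 2 2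
      + (3 : ℝ) • bb k W f 2 0 1 1) ∈ E := by
  have S0 := bb_seq E 0 3 (fun s l h1 h2 => hd 0 s l h1 (by omega))
  have S1 := bb_seq E 1 2 (fun s l h1 h2 => hd 1 s l h1 (by omega))
  have S2 := bb_seq E 2 1 (fun s l h1 h2 => hd 2 s l h1 (by omega))
  have S3 := bb_seq E 3 0 (fun s l h1 h2 => hd 3 s l h1 (by omega))
  have e : (fun ι => Jw (W ι) (Ao k (f ι)) (r2 ^ 3 * (- Lap (Lap (Lap (f ι)))))) =
    (M^6-8*M^4+16*M^2-3*M^4*b^2+3*M^2*b^4-16*b^2+8*b^4-b^6) • bb k W f 0 0 0 1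
    + (-32*b+32*b^3-6*b^5+12*M^2*b^3-6*M^4*b) • bb k W f 0 0 1 1
    + (-16+48*b^2-15*b^4+18*M^2*b^2-3*M^4) • bb k W f 0 0 2 1
    + (32*b-20*b^3+12*M^2*b) • bb k W f 0 0 3 1
    + (8-15*b^2+3*M^2) • bb k W f 0 0 4 1
    + (-6*b) • bb k W f 0 0 5 1
    - bb k W f 0 0 6 1
    + (16+3*b^4-16*M^2-6*M^2*b^2+3*M^4) • bb k W f 1 0 0 1
    + (12*b^3-12*M^2*b) • bb k W f 1 0 1 1
    + (18*b^2-6*M^2) • bb k W f 1 0 2 1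
    + (12*b) • bb k W f 1 0 3 1
    + (3 : ℝ) • bb k W f 1 0 4 1
    + (-8-3*b^2+3*M^2) • bb k W f 2 0 0 1
    + (-6*b) • bb k W f 2 0 1 1
    + (-3 : ℝ) • bb k W f 2 0 2 1
    + bb k W f 3 0 0 1 := by
    funext ι
    rw [test_id k b M hM hn]; rfl
  rw [e, ← Submodule.ker_mkQ E, LinearMap.mem_ker]
  simp only [map_sub, map_add, map_smul]
  obtain ⟨-, a1⟩ := S0.s0
  obtain ⟨-, a2, -⟩ := S0.s1 (by norm_num)
  obtain ⟨a3, -, a4, -⟩ := S0.s2 (by norm_num)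
  obtain ⟨a5, -, a6⟩ := S0.s3 (by norm_num)
  obtain ⟨-, b1⟩ := S1.s0
  obtain ⟨-, b2, -⟩ := S1.s1 (by norm_num)
  obtain ⟨b3, -, b4, -⟩ := S1.s2 (by norm_num)
  obtain ⟨-, c1⟩ := S2.s0
  obtain ⟨-, c2, -⟩ := S2.s1 (by norm_num)
  obtain ⟨-, d1⟩ := S3.s0
  rw [a1, a2, a3, a4, a5, a6, b1, b2, b3, b4, c1, c2, d1]
  module
end Fam


/-! ### Radial cutoffs -/

/-- Composition of a smooth profile with `c |x|²`. -/
def cm (c : ℝ) (h : {h : ℝ → ℝ // ContDiff ℝ (⊤ : ℕ∞) h}) : Sm n :=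
  ⟨fun x => h.1 (c * (r2 : Sm n) x), h.2.comp (contDiff_const.mul (smcd r2))⟩

lemma cm_ap (c : ℝ) (h) (x) : (cm c h : Sm n) x = h.1 (c * (r2 : Sm n) x) := rfl

/-- The action of the Euler operator on profiles. -/
def th (h : {h : ℝ → ℝ // ContDiff ℝ (⊤ : ℕ∞) h}) : {h : ℝ → ℝ // ContDiff ℝ (⊤ : ℕ∞) h} :=
  ⟨fun t => 2 * t * deriv h.1 t, by
    have h1 : ContDiff ℝ (⊤ : ℕ∞) (deriv h.1) := by
      exact (contDiff_succ_iff_deriv (n := ((⊤ : ℕ∞) : WithTop ℕ∞))).mp (h.2.of_le (by simp)) |>.2.2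
    exact (contDiff_const.mul contDiff_id).mul h1⟩

lemma th_ap (h) (t) : (th h).1 t = 2 * t * deriv h.1 t := rfl

lemma pd_cm (i : Fin n) (c : ℝ) (h) (x) :
    (pd i (cm c h)) x = deriv h.1 (c * (r2 : Sm n) x) * (c * (2 * x i)) := by
  have h1 : HasFDerivAt (r2 : Sm n).1 (fderiv ℝ (r2 : Sm n).1 x) x := (smdiff r2 x).hasFDerivAt
  have h2 : HasDerivAt h.1 (deriv h.1 (c * (r2 : Sm n) x)) (c * (r2 : Sm n) x) :=
    ((h.2.differentiable (by simp)) _).hasDerivAt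
  have h3 := h2.comp_hasFDerivAt x (h1.const_mul c)
  have h4 : (pd i (r2 : Sm n)) x = 2 * x i := by rw [pd_r2]; rfl
  rw [pd_ap] at h4 ⊢
  change fderiv ℝ (h.1 ∘ fun y => c * (r2 : Sm n).1 y) x (bv i) = _
  rw [h3.fderiv]
  simp only [smul_apply, smul_eq_mul]
  rw [h4]

lemma Eu_ap (f : Sm n) (x) : (Eu f) x = ∑ i, x i * (pd i f) x := by rw [Eu_eq, Sm.sum_ap]; rfl

lemma Eu_cm (c : ℝ) (h) : Eu (cm c h : Sm n) = cm c (th h) := by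
  ext x
  rw [Eu_ap, cm_ap, th_ap, r2_ap]
  simp only [pd_cm]
  rw [r2_ap]
  have : ∀ i, x i * (deriv h.1 (c * ∑ i, x i * x i) * (c * (2 * x i)))
      = (2 * c * deriv h.1 (c * ∑ i, x i * x i)) * (x i * x i) := by intro i; ring
  simp only [this, ← Finset.mul_sum]
  ring

lemma isRad_cm (c : ℝ) (h) : IsRad (cm c h : Sm n) := by
  intro i
  rw [Eu_cm]
  ext x
  simp only [Sm.mul_ap, pd_cm, cm_ap, th_ap]
  change _ = x i * _
  ring

/-- Profiles that are constant outside an interval. -/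
def Pr (a b c c' : ℝ) (h : {h : ℝ → ℝ // ContDiff ℝ (⊤ : ℕ∞) h}) : Prop :=
  (∀ t < a, h.1 t = c) ∧ (∀ t > b, h.1 t = c')

lemma Pr.th {a b c c' : ℝ} {h} (H : Pr a b c c' h) : Pr a b 0 0 (th h) := by
  constructor
  · intro t ht
    have : h.1 =ᶠ[nhds t] fun _ => c := by
      filter_upwards [Iio_mem_nhds ht] with y hy using H.1 y hy
    rw [th_ap, this.deriv_eq]; simp
  · intro t ht
    have : h.1 =ᶠ[nhds t] fun _ => c' := by
      filter_upwards [Ioi_mem_nhds ht] with y hy using H.2 y hy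
    rw [th_ap, this.deriv_eq]; simp

lemma Pr.bdd {a b c c' : ℝ} {h} (H : Pr a b c c' h) : ∃ C, 0 ≤ C ∧ ∀ t, |h.1 t| ≤ C := by
  obtain ⟨C, hC⟩ := (isCompact_Icc (a := a) (b := b)).exists_bound_of_continuousOn
    h.2.continuous.continuousOn
  refine ⟨|C| + |c| + |c'|, by positivity, fun t => ?_⟩
  have p1 := abs_nonneg C
  have p2 := abs_nonneg c
  have p3 := abs_nonneg c'
  by_cases h1 : t < a
  · rw [H.1 t h1]; linarith
  · by_cases h2 : b < t
    · rw [H.2 t h2]; linarith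
    · have := hC t ⟨not_lt.mp h1, not_lt.mp h2⟩
      rw [Real.norm_eq_abs] at this
      have := le_abs_self C
      linarith

/-- Index set for the cutoffs. -/
abbrev Idx := {R : ℝ // 1 ≤ R}

/-- Inner variable -/
def ti (R : Idx) (x : EuclideanSpace ℝ (Fin n)) : ℝ := R.1 ^ 2 * (r2 : Sm n) x
/-- Outer variable -/
def tq (R : Idx) (x : EuclideanSpace ℝ (Fin n)) : ℝ := (R.1 ^ 2)⁻¹ * (r2 : Sm n) x

lemma ti_cont (R : Idx) : Continuous (ti R : EuclideanSpace ℝ (Fin n) → ℝ) :=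
  continuous_const.mul (smcont r2)
lemma tq_cont (R : Idx) : Continuous (tq R : EuclideanSpace ℝ (Fin n) → ℝ) :=
  continuous_const.mul (smcont r2)

/-- The transition annuli. -/
def ann (n : ℕ) (R : Idx) : Set (EuclideanSpace ℝ (Fin n)) :=
  {x | (1 / 2 ≤ ti R x ∧ ti R x ≤ 1) ∨ (1 ≤ tq R x ∧ tq R x ≤ 2)}

/-- The shell containing the supports. -/
def shell (n : ℕ) (R : Idx) : Set (EuclideanSpace ℝ (Fin n)) :=
  {x | 1 / 2 ≤ ti R x ∧ tq R x ≤ 2}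

/-- The core. -/
def core (n : ℕ) (R : Idx) : Set (EuclideanSpace ℝ (Fin n)) :=
  {x | 1 ≤ ti R x ∧ tq R x ≤ 1}

lemma tq_le_ti (R : Idx) (x : EuclideanSpace ℝ (Fin n)) : tq R x ≤ ti R x := by
  have h0 : 0 ≤ (r2 : Sm n) x := by rw [r2_norm]; positivity
  have h1 : 1 ≤ R.1 ^ 2 := one_le_pow₀ R.2
  have h2 : (R.1 ^ 2)⁻¹ ≤ R.1 ^ 2 := (inv_le_one_of_one_le₀ h1).trans h1
  exact mul_le_mul_of_nonneg_right h2 h0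

lemma ann_sub (R : Idx) : ann n R ⊆ shell n R := by
  rintro x (⟨h1, h2⟩ | ⟨h1, h2⟩)
  · exact ⟨h1, by have := tq_le_ti R x; linarith⟩
  · exact ⟨by have := tq_le_ti R x; linarith, h2⟩

lemma core_sub (R : Idx) : core n R ⊆ shell n R := by
  rintro x ⟨h1, h2⟩
  exact ⟨by linarith, by linarith⟩

lemma shell_compact (R : Idx) : IsCompact (shell n R) := by
  have h1 : IsClosed (shell n R) :=
    (isClosed_le continuous_const (ti_cont R)).inter (isClosed_le (tq_cont R) continuous_const)
  have hR : 0 < R.1 ^ 2 := by have := R.2; positivity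
  refine (isCompact_closedBall (0 : EuclideanSpace ℝ (Fin n)) (2 * R.1 )).of_isClosed_subset h1 ?_
  rintro x ⟨-, h⟩
  rw [mem_closedBall_zero_iff]
  unfold tq at h
  rw [r2_norm, inv_mul_le_iff₀ hR] at h
  have := R.2
  refine (sq_le_sq₀ (norm_nonneg _) (by linarith)).mp ?_
  nlinarith

lemma ann_closed (R : Idx) : IsClosed (ann n R) :=
  ((isClosed_le continuous_const (ti_cont R)).inter
    (isClosed_le (ti_cont R) continuous_const)).union
  ((isClosed_le continuous_const (tq_cont R)).inter (isClosed_le (tq_cont R) continuous_const))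

lemma core_closed (R : Idx) : IsClosed (core n R) :=
  (isClosed_le continuous_const (ti_cont R)).inter (isClosed_le (tq_cont R) continuous_const)

/-- Families supported in the annuli. -/
def AnF (q : Idx → Sm n) : Prop :=
  ∃ C, 0 ≤ C ∧ ∀ R x, |(q R) x| ≤ C ∧ (x ∉ ann n R → (q R) x = 0)

/-- Families supported in the shell. -/
def ShF (q : Idx → Sm n) : Prop :=
  ∃ C, 0 ≤ C ∧ ∀ R x, |(q R) x| ≤ C ∧ (x ∉ shell n R → (q R) x = 0)

lemma AnF.sh {q : Idx → Sm n} (h : AnF q) : ShF q := by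
  obtain ⟨C, hC, h⟩ := h
  exact ⟨C, hC, fun R x => ⟨(h R x).1, fun hx => (h R x).2 fun h' => hx (ann_sub R h')⟩⟩

lemma AnF.add {q q' : Idx → Sm n} (h : AnF q) (h' : AnF q') : AnF (fun R => q R + q' R) := by
  obtain ⟨C, hC, h⟩ := h
  obtain ⟨C', hC', h'⟩ := h'
  refine ⟨C + C', by positivity, fun R x => ⟨?_, fun hx => ?_⟩⟩
  · exact (abs_add_le _ _).trans (add_le_add (h R x).1 (h' R x).1)
  · rw [Sm.add_ap, (h R x).2 hx, (h' R x).2 hx, add_zero]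

lemma AnF.mul {q q' : Idx → Sm n} (h : AnF q) (h' : ShF q') : AnF (fun R => q R * q' R) := by
  obtain ⟨C, hC, h⟩ := h
  obtain ⟨C', hC', h'⟩ := h'
  refine ⟨C * C', by positivity, fun R x => ⟨?_, fun hx => ?_⟩⟩
  · rw [Sm.mul_ap, abs_mul]
    exact mul_le_mul (h R x).1 (h' R x).1 (abs_nonneg _) hC
  · rw [Sm.mul_ap, (h R x).2 hx, zero_mul]

/-- Two-sided cutoffs. -/
def Gc (h1 h2 : {h : ℝ → ℝ // ContDiff ℝ (⊤ : ℕ∞) h}) (R : Idx) : Sm n :=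
  cm (R.1 ^ 2) h1 * cm (R.1 ^ 2)⁻¹ h2

lemma Gc_ap (h1 h2) (R : Idx) (x : EuclideanSpace ℝ (Fin n)) :
    (Gc h1 h2 R) x = h1.1 (ti R x) * h2.1 (tq R x) := rfl

lemma Eu_Gc (h1 h2) (R : Idx) : Eu (Gc h1 h2 R : Sm n) = Gc (th h1) h2 R + Gc h1 (th h2) R := by
  unfold Gc
  rw [Eu_mul, Eu_cm, Eu_cm]; ring

lemma isRad_Gc (h1 h2) (R : Idx) : IsRad (Gc h1 h2 R : Sm n) :=
  isRad_mul (isRad_cm _ _) (isRad_cm _ _)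

lemma Gc_sh {c c' : ℝ} {h1 h2} (H1 : Pr (1 / 2) 1 0 c h1) (H2 : Pr 1 2 c' 0 h2) :
    ShF (fun R => (Gc h1 h2 R : Sm n)) := by
  obtain ⟨C, hC, b1⟩ := H1.bdd
  obtain ⟨C', hC', b2⟩ := H2.bdd
  refine ⟨C * C', by positivity, fun R x => ⟨?_, fun hx => ?_⟩⟩
  · rw [Gc_ap, abs_mul]
    exact mul_le_mul (b1 _) (b2 _) (abs_nonneg _) hC
  · rw [Gc_ap]
    by_cases h : ti R x < 1 / 2
    · rw [H1.1 _ h, zero_mul]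
    · by_cases h' : 2 < tq R x
      · rw [H2.2 _ h', mul_zero]
      · exact absurd ⟨not_lt.mp h, not_lt.mp h'⟩ hx

lemma Gc_an1 {c' : ℝ} {h1 h2} (H1 : Pr (1 / 2) 1 0 0 h1) (H2 : Pr 1 2 c' 0 h2) :
    AnF (fun R => (Gc h1 h2 R : Sm n)) := by
  obtain ⟨C, hC, h⟩ := Gc_sh (n := n) H1 H2
  refine ⟨C, hC, fun R x => ⟨(h R x).1, fun hx => ?_⟩⟩
  rw [Gc_ap]
  by_cases h : ti R x < 1 / 2
  · rw [H1.1 _ h, zero_mul]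
  · by_cases h' : 1 < ti R x
    · rw [H1.2 _ h', zero_mul]
    · exact absurd (Or.inl ⟨not_lt.mp h, not_lt.mp h'⟩) hx

lemma Gc_an2 {c : ℝ} {h1 h2} (H1 : Pr (1 / 2) 1 0 c h1) (H2 : Pr 1 2 0 0 h2) :
    AnF (fun R => (Gc h1 h2 R : Sm n)) := by
  obtain ⟨C, hC, h⟩ := Gc_sh (n := n) H1 H2
  refine ⟨C, hC, fun R x => ⟨(h R x).1, fun hx => ?_⟩⟩
  rw [Gc_ap]
  by_cases h : tq R x < 1
  · rw [H2.1 _ h, mul_zero]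
  · by_cases h' : 2 < tq R x
    · rw [H2.2 _ h', mul_zero]
    · exact absurd (Or.inr ⟨not_lt.mp h, not_lt.mp h'⟩) hx

lemma Gc_an1' (s : ℕ) : ∀ {c' : ℝ} {h1 h2}, Pr (1 / 2) 1 0 0 h1 → Pr 1 2 c' 0 h2 →
    AnF (fun R => Eu^[s] (Gc h1 h2 R : Sm n)) := by
  induction s with
  | zero => intro c' h1 h2 H1 H2; exact Gc_an1 H1 H2
  | succ s ih =>
    intro c' h1 h2 H1 H2
    have : ∀ R, Eu^[s + 1] (Gc h1 h2 R : Sm n) = Eu^[s] (Gc (th h1) h2 R : Sm n)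
        + Eu^[s] (Gc h1 (th h2) R : Sm n) := by
      intro R
      rw [Function.iterate_succ_apply, Eu_Gc]
      exact iterate_map_add Eu s _ _
    simp only [this]
    exact (ih H1.th H2).add (ih H1 H2.th)

lemma Gc_an2' (s : ℕ) : ∀ {c : ℝ} {h1 h2}, Pr (1 / 2) 1 0 c h1 → Pr 1 2 0 0 h2 →
    AnF (fun R => Eu^[s] (Gc h1 h2 R : Sm n)) := by
  induction s with
  | zero => intro c' h1 h2 H1 H2; exact Gc_an2 H1 H2
  | succ s ih =>
    intro c' h1 h2 H1 H2
    have : ∀ R, Eu^[s + 1] (Gc h1 h2 R : Sm n) = Eu^[s] (Gc (th h1) h2 R : Sm n)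
        + Eu^[s] (Gc h1 (th h2) R : Sm n) := by
      intro R
      rw [Function.iterate_succ_apply, Eu_Gc]
      exact iterate_map_add Eu s _ _
    simp only [this]
    exact (ih H1.th H2).add (ih H1 H2.th)

lemma Gc_an (s : ℕ) (hs : 1 ≤ s) {c c' : ℝ} {h1 h2} (H1 : Pr (1 / 2) 1 0 c h1)
    (H2 : Pr 1 2 c' 0 h2) : AnF (fun R => Eu^[s] (Gc h1 h2 R : Sm n)) := by
  obtain ⟨s, rfl⟩ := Nat.exists_eq_add_of_le' hs
  have : ∀ R, Eu^[s + 1] (Gc h1 h2 R : Sm n) = Eu^[s] (Gc (th h1) h2 R : Sm n)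
        + Eu^[s] (Gc h1 (th h2) R : Sm n) := by
    intro R
    rw [Function.iterate_succ_apply, Eu_Gc]
    exact iterate_map_add Eu s _ _
  simp only [this]
  exact (Gc_an1' s H1.th H2).add (Gc_an2' s H1 H2.th)

/-- The basic profiles. -/
def pr1 : {h : ℝ → ℝ // ContDiff ℝ (⊤ : ℕ∞) h} :=
  ⟨fun t => Real.smoothTransition (2 * t - 1),
    Real.smoothTransition.contDiff.comp (by fun_prop)⟩
def pr2 : {h : ℝ → ℝ // ContDiff ℝ (⊤ : ℕ∞) h} :=
  ⟨fun t => Real.smoothTransition (2 - t),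
    Real.smoothTransition.contDiff.comp (by fun_prop)⟩
def sqp (h : {h : ℝ → ℝ // ContDiff ℝ (⊤ : ℕ∞) h}) : {h : ℝ → ℝ // ContDiff ℝ (⊤ : ℕ∞) h} :=
  ⟨fun t => h.1 t * h.1 t, h.2.mul h.2⟩

lemma pr1_Pr : Pr (1 / 2) 1 0 1 pr1 :=
  ⟨fun t ht => Real.smoothTransition.zero_of_nonpos (by linarith),
    fun t ht => Real.smoothTransition.one_of_one_le (by linarith)⟩
lemma pr2_Pr : Pr 1 2 1 0 pr2 :=
  ⟨fun t ht => Real.smoothTransition.one_of_one_le (by linarith),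
    fun t ht => Real.smoothTransition.zero_of_nonpos (by linarith)⟩
lemma sqp_Pr {a b c c' : ℝ} {h} (H : Pr a b c c' h) : Pr a b (c * c) (c' * c') (sqp h) :=
  ⟨fun t ht => by simp only [sqp]; rw [H.1 t ht], fun t ht => by simp only [sqp]; rw [H.2 t ht]⟩

/-- The cutoff and its Euler derivatives. -/
def eta (a : ℕ) (R : Idx) : Sm n := Eu^[a] (Gc pr1 pr2 R)

lemma eta_succ (a : ℕ) (R : Idx) : (eta (a + 1) R : Sm n) = Eu (eta a R) := by
  unfold eta; rw [Function.iterate_succ_apply']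

lemma eta_an (a : ℕ) (ha : 1 ≤ a) : AnF (fun R => (eta a R : Sm n)) := Gc_an a ha pr1_Pr pr2_Pr

lemma eta_sh (a : ℕ) : ShF (fun R => (eta a R : Sm n)) := by
  match a with
  | 0 => exact Gc_sh pr1_Pr pr2_Pr
  | a + 1 => exact (eta_an _ (by omega)).sh

lemma isRad_eta (a : ℕ) (R : Idx) : IsRad (eta a R : Sm n) := by
  induction a with
  | zero => exact isRad_Gc _ _ _
  | succ a ih => rw [eta_succ]; exact isRad_Eu ih

lemma eta_mul_an (a b : ℕ) (h : 1 ≤ a + b) : AnF (fun R => (eta a R * eta b R : Sm n)) := by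
  by_cases ha : 1 ≤ a
  · exact (eta_an a ha).mul (eta_sh b)
  · have := (eta_an (n := n) b (by omega)).mul (eta_sh a)
    simpa only [mul_comm] using this

lemma eta_sq (R : Idx) : (eta 0 R * eta 0 R : Sm n) = Gc (sqp pr1) (sqp pr2) R := by
  ext x
  simp only [eta, Function.iterate_zero, id, Sm.mul_ap, Gc_ap, sqp]; ring

lemma eta_sq_an (s : ℕ) (hs : 1 ≤ s) : AnF (fun R => Eu^[s] (eta 0 R * eta 0 R : Sm n)) := by
  simp only [eta_sq]
  exact Gc_an s hs (by simpa using sqp_Pr pr1_Pr) (by simpa using sqp_Pr pr2_Pr)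

lemma eta_core (R : Idx) (x : EuclideanSpace ℝ (Fin n)) (hx : x ∈ core n R) : (eta 0 R) x = 1 := by
  simp only [eta, Function.iterate_zero, id, Gc_ap, pr1, pr2]
  rw [Real.smoothTransition.one_of_one_le (by linarith [hx.1]),
    Real.smoothTransition.one_of_one_le (by linarith [hx.2]), one_mul]


/-! ### Power weights -/

lemma gp_smooth (a : ℝ) (R : Idx) : ContDiff ℝ (⊤ : ℕ∞)
    (fun t : ℝ => t ^ (a / 2) * Real.smoothTransition (12 * (R.1 ^ 2 * t) - 3)) := by
  have hR : 0 < R.1 ^ 2 := by have := R.2; positivity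
  rw [contDiff_iff_contDiffAt]
  intro t
  have hs : ContDiff ℝ (⊤ : ℕ∞) (fun t : ℝ => Real.smoothTransition (12 * (R.1 ^ 2 * t) - 3)) :=
    Real.smoothTransition.contDiff.comp (by fun_prop)
  by_cases ht : R.1 ^ 2 * t < 1 / 4
  · have ho : IsOpen {t : ℝ | R.1 ^ 2 * t < 1 / 4} :=
      isOpen_lt (continuous_const.mul continuous_id) continuous_const
    have : (fun t : ℝ => t ^ (a / 2) * Real.smoothTransition (12 * (R.1 ^ 2 * t) - 3))
        =ᶠ[nhds t] fun _ => 0 := by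
      filter_upwards [ho.mem_nhds ht] with y hy
      have hy' : R.1 ^ 2 * y < 1 / 4 := hy
      rw [Real.smoothTransition.zero_of_nonpos (by linarith), mul_zero]
    exact contDiffAt_const.congr_of_eventuallyEq this
  · have h0 : t ≠ 0 := by
      rintro rfl
      apply ht; norm_num
    exact (contDiffAt_id.rpow_const_of_ne h0).mul hs.contDiffAt

/-- Truncated powers. -/
def Tp (a : ℝ) (R : Idx) : Sm n := cm 1 ⟨_, gp_smooth a R⟩

lemma ti_pos {R : Idx} {x : EuclideanSpace ℝ (Fin n)} {c : ℝ} (hc : 0 ≤ c) (h : c < ti R x) :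
    0 < (r2 : Sm n) x := by
  have hR : 0 < R.1 ^ 2 := by have := R.2; positivity
  unfold ti at h
  exact pos_of_mul_pos_right (lt_of_le_of_lt hc h) hR.le

lemma Tp_ap (a : ℝ) (R : Idx) (x : EuclideanSpace ℝ (Fin n)) (h : 1 / 3 ≤ ti R x) :
    (Tp a R) x = (r2 : Sm n) x ^ (a / 2) := by
  unfold Tp
  rw [cm_ap]
  simp only [one_mul]
  unfold ti at h
  rw [Real.smoothTransition.one_of_one_le (by linarith), mul_one]

lemma Eu_Tp (a : ℝ) (R : Idx) (x : EuclideanSpace ℝ (Fin n)) (h : 1 / 3 < ti R x) :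
    (Eu (Tp a R)) x = a * (Tp a R) x := by
  rw [Tp_ap a R x h.le]
  unfold Tp
  rw [Eu_cm, cm_ap, th_ap]
  simp only [one_mul]
  have h0 := ti_pos (by norm_num) h
  have ho : IsOpen {t : ℝ | 1 / 3 < R.1 ^ 2 * t} :=
      isOpen_lt continuous_const (continuous_const.mul continuous_id)
  have : (fun t : ℝ => t ^ (a / 2) * Real.smoothTransition (12 * (R.1 ^ 2 * t) - 3))
      =ᶠ[nhds ((r2 : Sm n) x)] fun t => t ^ (a / 2) := by
    filter_upwards [ho.mem_nhds h] with y hy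
    have hy' : 1 / 3 < R.1 ^ 2 * y := hy
    rw [Real.smoothTransition.one_of_one_le (by linarith), mul_one]
  rw [this.deriv_eq, Real.deriv_rpow_const, Real.rpow_sub h0, Real.rpow_one]
  field_simp

lemma isRad_Tp (a : ℝ) (R : Idx) : IsRad (Tp a R : Sm n) := isRad_cm _ _

/-- Radial cutoffs supported in the shell. -/
def Qs (n : ℕ) (R : Idx) := {q : Sm n // IsRad q ∧ ∀ x, x ∉ shell n R → q x = 0}

lemma pd_van (i : Fin n) {q : Sm n} {S : Set (EuclideanSpace ℝ (Fin n))} (hS : IsOpen S)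
    (h : ∀ x ∈ S, q x = 0) : ∀ x ∈ S, (pd i q) x = 0 := by
  intro x hx
  have : q.1 =ᶠ[nhds x] fun _ => 0 := by
    filter_upwards [hS.mem_nhds hx] with y hy using h y hy
  rw [pd_ap, this.fderiv_eq]; simp

lemma Eu_van {q : Sm n} {S : Set (EuclideanSpace ℝ (Fin n))} (hS : IsOpen S)
    (h : ∀ x ∈ S, q x = 0) : ∀ x ∈ S, (Eu q) x = 0 := by
  intro x hx
  rw [Eu_ap]
  exact Finset.sum_eq_zero fun i _ => by rw [pd_van i hS h x hx, mul_zero]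

def EuQ {R : Idx} (q : Qs n R) : Qs n R :=
  ⟨Eu q.1, isRad_Eu q.2.1, Eu_van (shell_compact R).isClosed.isOpen_compl q.2.2⟩

lemma cs_of_van {q : Sm n} {K : Set (EuclideanSpace ℝ (Fin n))} (hK : IsCompact K)
    (h : ∀ x, x ∉ K → q x = 0) : HasCompactSupport q.1 :=
  HasCompactSupport.intro hK h

/-- Weights `|x|^(2k-n) q`. -/
def Wq (k : ℝ) {R : Idx} (q : Qs n R) : Wt n :=
  ⟨Tp (2 * k - n) R * q.1, isRad_mul (isRad_Tp _ _) q.2.1,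
    cs_mul_right _ _ (cs_of_van (shell_compact R) q.2.2)⟩

lemma Eu_Tq (a : ℝ) {R : Idx} (q : Sm n) (hq : ∀ x, x ∉ shell n R → q x = 0) :
    Eu (Tp a R * q) = Tp a R * Eu q + a • (Tp a R * q) := by
  ext x
  simp only [Eu_mul, Sm.add_ap, Sm.mul_ap, Sm.smul_ap]
  by_cases hx : x ∈ shell n R
  · rw [Eu_Tp a R x (by linarith [hx.1])]; ring
  · rw [hq x hx]; ring

lemma Th_Wq (k : ℝ) {R : Idx} (q : Qs n R) : Th k (Wq k q) = Wq k (EuQ q) := by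
  apply Subtype.ext
  simp only [Th, Wq, EuQ, Ao_eq]
  rw [Eu_Tq _ _ q.2.2]; module

lemma Th_Wq_iter (k : ℝ) {R : Idx} (q : Qs n R) (s : ℕ) :
    (Th k)^[s] (Wq k q) = Wq k (EuQ^[s] q) := by
  induction s with
  | zero => rfl
  | succ s ih => rw [Function.iterate_succ_apply', ih, Th_Wq, ← Function.iterate_succ_apply' EuQ]

lemma EuQ_iter {R : Idx} (q : Qs n R) (s : ℕ) : (EuQ^[s] q).1 = Eu^[s] q.1 := by
  induction s with
  | zero => rfl
  | succ s ih => rw [Function.iterate_succ_apply', Function.iterate_succ_apply', ← ih]; rfl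

lemma eta_van (a : ℕ) (R : Idx) (x : EuclideanSpace ℝ (Fin n)) (hx : x ∉ shell n R) :
    (eta a R) x = 0 := by
  obtain ⟨C, -, h⟩ := eta_sh (n := n) a
  exact (h R x).2 hx

/-- The products of derivatives of the cutoff, as elements of `Qs`. -/
def eq2 (n : ℕ) (a b : ℕ) (R : Idx) : Qs n R :=
  ⟨eta a R * eta b R, isRad_mul (isRad_eta _ _) (isRad_eta _ _),
    fun x hx => by rw [Sm.mul_ap, eta_van a R x hx, zero_mul]⟩

/-- Outer cutoff for the reference weight. -/
def pr3 : {h : ℝ → ℝ // ContDiff ℝ (⊤ : ℕ∞) h} :=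
  ⟨fun t => Real.smoothTransition (4 - t),
    Real.smoothTransition.contDiff.comp (by fun_prop)⟩

/-- The reference weight, equal to `|x|^(-6)` near the shell. -/
def W0 (n : ℕ) (R : Idx) : Wt n :=
  ⟨Tp (-6) R * cm (R.1 ^ 2)⁻¹ pr3, isRad_mul (isRad_Tp _ _) (isRad_cm _ _), by
    have hR : 0 < R.1 ^ 2 := by have := R.2; positivity
    refine cs_of_van (isCompact_closedBall (0 : EuclideanSpace ℝ (Fin n)) (2 * R.1)) ?_
    intro x hx
    rw [mem_closedBall_zero_iff, not_le] at hx
    rw [Sm.mul_ap, cm_ap]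
    simp only [pr3]
    rw [Real.smoothTransition.zero_of_nonpos, mul_zero]
    rw [sub_nonpos, r2_norm, le_inv_mul_iff₀ hR]
    have := R.2
    nlinarith⟩

/-- Neighbourhood of the shell where the reference weight is a pure power. -/
def Om (n : ℕ) (R : Idx) : Set (EuclideanSpace ℝ (Fin n)) :=
  {x | 1 / 3 < ti R x ∧ tq R x < 3}

lemma Om_open (R : Idx) : IsOpen (Om n R) :=
  (isOpen_lt continuous_const (ti_cont R)).inter (isOpen_lt (tq_cont R) continuous_const)

lemma shell_Om (R : Idx) : shell n R ⊆ Om n R := fun x hx =>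
  ⟨by linarith [hx.1], by linarith [hx.2]⟩

lemma W0_ap (R : Idx) (x) (hx : x ∈ Om n R) : (W0 n R).1 x = (r2 : Sm n) x ^ (-3 : ℝ) := by
  simp only [W0, Sm.mul_ap, cm_ap, pr3]
  rw [Tp_ap _ _ _ hx.1.le]
  have : (R.1 ^ 2)⁻¹ * (r2 : Sm n) x < 3 := hx.2
  rw [Real.smoothTransition.one_of_one_le (by linarith), mul_one]
  norm_num

lemma Th_W0 {m : ℝ} (hm : (n : ℝ) = 2 * m + 6) (R : Idx) :
    ∀ x ∈ Om n R, (Th m (W0 n R)).1 x = 0 := by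
  intro x hx
  have h1 : ∀ y ∈ Om n R, (W0 n R).1 y - (Tp (-6) R) y = 0 := by
    intro y hy
    rw [W0_ap R y hy, Tp_ap _ _ _ hy.1.le]; norm_num
  have h2 := Eu_van (q := (W0 n R).1 - Tp (-6) R) (Om_open R) h1 x hx
  rw [map_sub, Sm.sub_ap, Eu_Tp _ _ _ hx.1] at h2
  have h3 := h1 x hx
  have h4 : (Th m (W0 n R)).1 x = (Eu (W0 n R).1) x + ((n : ℝ) - 2 * m) * (W0 n R).1 x := rfl
  rw [h4, hm]
  linear_combination h2 + 6 * h3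

lemma Th_W0_iter {m : ℝ} (hm : (n : ℝ) = 2 * m + 6) (R : Idx) (s : ℕ) (hs : 1 ≤ s) :
    ∀ x ∈ Om n R, ((Th m)^[s] (W0 n R)).1 x = 0 := by
  induction s, hs using Nat.le_induction with
  | base => exact Th_W0 hm R
  | succ s hs ih =>
    intro x hx
    rw [Function.iterate_succ_apply']
    have h4 : (Th m ((Th m)^[s] (W0 n R))).1 x = (Eu ((Th m)^[s] (W0 n R)).1) x
      + ((n : ℝ) - 2 * m) * ((Th m)^[s] (W0 n R)).1 x := rfl
    rw [h4, ih x hx, Eu_van (Om_open R) ih x hx]; ring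

/-- The radial multipliers of the test function. -/
def rho (b : ℝ) (a : ℕ) (R : Idx) : Sm n := Tp (-b) R * eta a R

lemma isRad_rho (b : ℝ) (a : ℕ) (R : Idx) : IsRad (rho b a R : Sm n) :=
  isRad_mul (isRad_Tp _ _) (isRad_eta _ _)

lemma rho_van (b : ℝ) (a : ℕ) (R : Idx) (x : EuclideanSpace ℝ (Fin n)) (hx : x ∉ shell n R) :
    (rho b a R) x = 0 := by
  rw [rho, Sm.mul_ap, eta_van a R x hx, mul_zero]

lemma Eu_rho (b : ℝ) (a : ℕ) (R : Idx) :
    Eu (rho b a R : Sm n) = rho b (a + 1) R - b • rho b a R := by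
  unfold rho
  rw [Eu_Tq _ _ (eta_van a R), eta_succ]; module

lemma Ao_rho (k b : ℝ) (a : ℕ) (R : Idx) (f : Sm n) :
    Ao (k + b) (rho b a R * f) = rho b a R * Ao k f + rho b (a + 1) R * f := by
  simp only [Ao_eq, Eu_mul, Eu_rho, mul_add, mul_sub, mul_smul_comm]
  rw [mul_comm f, mul_comm f]; module

lemma rho_W0 {k b : ℝ} (hn : (n : ℝ) = 2 * (k + b) + 6) (a a' : ℕ) (R : Idx) :
    rho b a R * rho b a' R * (W0 n R).1 = (Wq k (eq2 n a a' R)).1 := by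
  ext x
  by_cases hx : x ∈ shell n R
  · have h3 : 1 / 3 < ti R x := by linarith [hx.1]
    have h0 := ti_pos (by norm_num) h3
    simp only [rho, Wq, eq2, Sm.mul_ap]
    rw [W0_ap R x (shell_Om R hx), Tp_ap _ _ _ h3.le, Tp_ap _ _ _ h3.le]
    have : (r2 : Sm n) x ^ ((2 * k - n) / 2) = (r2 : Sm n) x ^ (-b / 2) * (r2 : Sm n) x ^ (-b / 2)
        * (r2 : Sm n) x ^ (-3 : ℝ) := by
      rw [← Real.rpow_add h0, ← Real.rpow_add h0, hn]; congr 1; ring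
    rw [this]; ring
  · simp only [Wq, eq2, Sm.mul_ap]
    rw [rho_van b a R x hx, eta_van a R x hx]; ring

lemma Bf_rho {k b : ℝ} (hn : (n : ℝ) = 2 * (k + b) + 6) (j : ℕ) (hj : j ≤ 3) (a a' : ℕ) (R : Idx)
    (f g : Sm n) : Bf j (W0 n R) (rho b a R * f) (rho b a' R * g)
      = Bf j (Wq k (eq2 n a a' R)) f g := by
  rw [Bf_ed j hj, Bf_ed j hj, ed_rad_mul j (isRad_rho _ _ _), ed_comm,
    ed_rad_mul j (isRad_rho _ _ _), ed_comm, ← rho_W0 hn]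
  congr 1
  funext x
  simp only [Sm.mul_ap]; ring

lemma int_Lap (f g : Sm n) (hg : HasCompactSupport g.1) :
    ∫ x, (∑ i, pd i f * pd i g) x = - ∫ x, (Lap f * g) x := by
  have hs : ∀ i, HasCompactSupport (pd i f * g).1 := fun i => cs_mul_right _ _ hg
  have h1 := int_sum_pd (fun i => pd i f * g) hs
  have e : (∑ i, pd i (pd i f * g)) = (∑ i, pd i f * pd i g) + Lap f * g := by
    rw [Lap_eq, Finset.sum_mul, ← Finset.sum_add_distrib]
    exact Finset.sum_congr rfl fun i _ => by rw [pd_mul]; ring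
  rw [e, int_add' (cs_sum _ _ fun i => cs_mul_right _ _ (pd_cs i g hg)) (cs_mul_right _ _ hg)] at h1
  linarith

lemma Lap_cs (g : Sm n) (hg : HasCompactSupport g.1) : HasCompactSupport (Lap g).1 := by
  rw [Lap_eq]; exact cs_sum _ _ fun i => pd_cs _ _ (pd_cs _ _ hg)

lemma int_Lap_symm (f g : Sm n) (hf : HasCompactSupport f.1) (hg : HasCompactSupport g.1) :
    ∫ x, (Lap f * g) x = ∫ x, (f * Lap g) x := by
  have h1 := int_Lap f g hg
  have h2 := int_Lap g f hf
  have e : (∑ i, pd i f * pd i g) = ∑ i, pd i g * pd i f :=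
    Finset.sum_congr rfl fun i _ => mul_comm _ _
  rw [e, h2, mul_comm (Lap g)] at h1
  linarith

lemma int_grad_Lap (g : Sm n) (hg : HasCompactSupport g.1) :
    ∫ x, ‖gradient (laplacian g.1) x‖ ^ 2 = ∫ x, (- Lap (Lap (Lap g)) * g) x := by
  have e : ∀ x, ‖gradient (laplacian g.1) x‖ ^ 2 = (∑ i, pd i (Lap g) * pd i (Lap g)) x := by
    intro x
    rw [laplacian_eq, gradient_sq, Sm.sum_ap]
    exact Finset.sum_congr rfl fun i _ => by rw [Sm.mul_ap, sq]
  simp only [e]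
  have h2 := Lap_cs _ hg
  have h3 := Lap_cs _ h2
  have h4 := Lap_cs _ h3
  rw [int_Lap _ _ h2, ← int_Lap_symm _ _ h3 hg]
  rw [← integral_neg]
  congr 1; funext x; simp


/-! ### The main weighted inequality -/

/-- Families bounded by a multiple of `N`. -/
def Er (N : Idx → ℝ) : Submodule ℝ (Idx → ℝ) where
  carrier := {v | ∃ C, ∀ R, |v R| ≤ C * N R}
  add_mem' := by
    rintro v w ⟨C, hC⟩ ⟨C', hC'⟩
    refine ⟨C + C', fun R => ?_⟩
    have := abs_add_le (v R) (w R)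
    have h1 := hC R
    have h2 := hC' R
    rw [Pi.add_apply]; linarith
  zero_mem' := ⟨0, fun R => by simp⟩
  smul_mem' := by
    rintro c v ⟨C, hC⟩
    refine ⟨|c| * C, fun R => ?_⟩
    rw [Pi.smul_apply, smul_eq_mul, abs_mul, mul_assoc]
    exact mul_le_mul_of_nonneg_left (hC R) (abs_nonneg _)

/-- Index set of the densities. -/
def ix : Finset (ℕ × ℕ) := (Finset.range 4 ×ˢ Finset.range 4).filter (fun q => q.1 + q.2 ≤ 3)

/-- The total energy density. -/
def Dn (k : ℝ) (u w : Sm n) : Sm n :=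
  ∑ q ∈ ix, ed q.2 ((Ao k ^ q.1) u) ((Ao k ^ q.1) u) + r2 ^ 3 * (w * u)

/-- The weighted total density. -/
def Fn (k : ℝ) (u w : Sm n) (x : EuclideanSpace ℝ (Fin n)) : ℝ :=
  (r2 : Sm n) x ^ ((2 * k - n) / 2) * (Dn k u w) x

/-- Energy in the annuli. -/
def Nn (k : ℝ) (u w : Sm n) (R : Idx) : ℝ := ∫ x in ann n R, Fn k u w x

lemma r2_nonneg (x : EuclideanSpace ℝ (Fin n)) : 0 ≤ (r2 : Sm n) x := by
  rw [r2_norm]; positivity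

section Main
variable {k : ℝ} {u w : Sm n}

lemma wu_nonneg (hwu : ∀ x, 0 ≤ (w * u) x) (x : EuclideanSpace ℝ (Fin n)) : 0 ≤ ((r2 : Sm n) ^ 3 * (w * u) : Sm n) x := by
  rw [Sm.mul_ap, Sm.pow_ap]
  exact mul_nonneg (pow_nonneg (r2_nonneg x) 3) (hwu x)

lemma ed_le_Dn (hwu : ∀ x, 0 ≤ (w * u) x) (j l : ℕ) (h : l + j ≤ 3) (x) :
    (ed j ((Ao k ^ l) u) ((Ao k ^ l) u)) x ≤ (Dn k u w) x := by
  rw [Dn, Sm.add_ap, Sm.sum_ap]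
  have h1 := Finset.single_le_sum (s := ix)
    (f := fun q => (ed q.2 ((Ao k ^ q.1) u) ((Ao k ^ q.1) u)) x)
    (fun q _ => ed_nonneg _ _ _) (a := (l, j)) (by
      simp only [ix, Finset.mem_filter, Finset.mem_product, Finset.mem_range]; omega)
  have h2 := wu_nonneg hwu x
  simp only at h1
  linarith

lemma wu_le_Dn (x : EuclideanSpace ℝ (Fin n)) : ((r2 : Sm n) ^ 3 * (w * u) : Sm n) x ≤ (Dn k u w) x := by
  rw [Dn, Sm.add_ap, Sm.sum_ap]
  have h1 : 0 ≤ ∑ q ∈ ix, (ed q.2 ((Ao k ^ q.1) u) ((Ao k ^ q.1) u)) x :=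
    Finset.sum_nonneg fun q _ => ed_nonneg _ _ _
  linarith

lemma Dn_nonneg (hwu : ∀ x, 0 ≤ (w * u) x) (x) : 0 ≤ (Dn k u w) x := (wu_nonneg hwu x).trans (wu_le_Dn x)

lemma Fn_nonneg (hwu : ∀ x, 0 ≤ (w * u) x) (x) : 0 ≤ Fn k u w x :=
  mul_nonneg (Real.rpow_nonneg (r2_nonneg x) _) (Dn_nonneg hwu x)

lemma Fn_int (R : Idx) : IntegrableOn (Fn k u w) (shell n R) := by
  refine ContinuousOn.integrableOn_compact (shell_compact R) ?_
  refine ContinuousOn.mul ?_ (smcont _).continuousOn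
  refine (smcont r2).continuousOn.rpow_const ?_
  intro x hx
  have := hx.1
  exact Or.inl (ti_pos (R := R) (c := 1 / 3) (by norm_num) (by linarith)).ne'

lemma Nn_nonneg (hwu : ∀ x, 0 ≤ (w * u) x) (R : Idx) : 0 ≤ Nn k u w R :=
  setIntegral_nonneg (ann_closed R).measurableSet fun x _ => Fn_nonneg hwu x

lemma err_mem (hwu : ∀ x, 0 ≤ (w * u) x) (g : Sm n) {C : ℝ} (hg : ∀ x, |g x| ≤ C * (Dn k u w) x) (q : ∀ R, Qs n R)
    (hq : AnF (fun R => (q R).1)) :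
    (fun R => ∫ x, (g * (Wq k (q R)).1) x) ∈ Er (Nn k u w) := by
  obtain ⟨C', hC', h⟩ := hq
  refine ⟨C * C', fun R => ?_⟩
  have hm := (ann_closed (n := n) R).measurableSet
  rw [Nn, ← integral_indicator hm, ← integral_const_mul, ← Real.norm_eq_abs]
  refine norm_integral_le_of_norm_le ?_ (Eventually.of_forall fun x => ?_)
  · refine Integrable.const_mul ?_ _
    rw [integrable_indicator_iff hm]
    exact (Fn_int R).mono_set (ann_sub R)
  · rw [Real.norm_eq_abs]
    by_cases hx : x ∈ ann n R
    · rw [Set.indicator_of_mem hx]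
      have h3 := (ann_sub R hx).1
      simp only [Wq, Sm.mul_ap, Fn]
      rw [Tp_ap _ _ _ (by linarith), abs_mul, abs_mul,
        abs_of_nonneg (Real.rpow_nonneg (r2_nonneg x) _)]
      have e1 := hg x
      have e2 := (h R x).1
      have e3 := Real.rpow_nonneg (r2_nonneg x) ((2 * k - n) / 2)
      have e4 : |g x| * |(q R).1 x| ≤ (C * (Dn k u w) x) * C' :=
        mul_le_mul e1 e2 (abs_nonneg _) ((abs_nonneg _).trans e1)
      have e5 := mul_le_mul_of_nonneg_left e4 e3
      calc _ = (r2 : Sm n) x ^ ((2 * k - n) / 2) * (|g x| * |(q R).1 x|) := by ring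
        _ ≤ _ := e5
        _ = _ := by ring
    · rw [Set.indicator_of_notMem hx]
      simp only [Wq, Sm.mul_ap]
      have h4 : (q R).1 x = 0 := (h R x).2 hx
      rw [h4]; simp

lemma err_ed (hwu : ∀ x, 0 ≤ (w * u) x) (j i i' : ℕ) (h : i + j ≤ 3) (h' : i' + j ≤ 3) (q : ∀ R, Qs n R)
    (hq : AnF (fun R => (q R).1)) :
    (fun R => Bf j (Wq k (q R)) ((Ao k ^ i) u) ((Ao k ^ i') u)) ∈ Er (Nn k u w) := by
  have e : (fun R => Bf j (Wq k (q R)) ((Ao k ^ i) u) ((Ao k ^ i') u))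
      = (fun R => ∫ x, (ed j ((Ao k ^ i) u) ((Ao k ^ i') u) * (Wq k (q R)).1) x) := by
    funext R; rw [Bf_ed j (by omega)]
  rw [e]
  refine err_mem hwu _ (C := 2) (fun x => ?_) q hq
  have h1 := ed_abs j ((Ao k ^ i) u) ((Ao k ^ i') u) x
  have h2 := ed_le_Dn (k := k) hwu j i h x
  have h3 := ed_le_Dn (k := k) hwu j i' h' x
  linarith

/-- The main diagonal forms. -/
lemma err_bb (hwu : ∀ x, 0 ≤ (w * u) x) (j s l : ℕ) (hs : 1 ≤ s) (h : l + j ≤ 3) :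
    bb k (fun R => Wq k (eq2 n 0 0 R)) (fun _ => u) j s l l ∈ Er (Nn k u w) := by
  have e : bb k (fun R => Wq k (eq2 n 0 0 R)) (fun _ => u) j s l l
      = (fun R => Bf j (Wq k (EuQ^[s] (eq2 n 0 0 R))) ((Ao k ^ l) u) ((Ao k ^ l) u)) := by
    funext R; simp only [bb]; rw [Th_Wq_iter]
  rw [e]
  refine err_ed hwu j l l h h _ ?_
  have e2 : (fun R => (EuQ^[s] (eq2 n 0 0 R)).1) = fun R => Eu^[s] (eta 0 R * eta 0 R : Sm n) := by
    funext R; rw [EuQ_iter]; rfl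
  rw [e2]
  exact eta_sq_an s hs

lemma err_rho (hwu : ∀ x, 0 ≤ (w * u) x) {b : ℝ} (hn : (n : ℝ) = 2 * (k + b) + 6) (j a a' i i' : ℕ) (ha : 1 ≤ a + a')
    (h : i + j ≤ 3) (h' : i' + j ≤ 3) :
    (fun R => Bf j (W0 n R) (rho b a R * (Ao k ^ i) u) (rho b a' R * (Ao k ^ i') u))
      ∈ Er (Nn k u w) := by
  simp only [Bf_rho hn j (by omega)]
  exact err_ed hwu j i i' h h' _ (eta_mul_an a a' ha)

lemma Bf_add_right (j : ℕ) (W : Wt n) (f f' g : Sm n) :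
    Bf j W g (f + f') = Bf j W g f + Bf j W g f' := by
  rw [Bf_symm, Bf_add, Bf_symm j W f, Bf_symm j W f']

lemma Bf_smul_right (j : ℕ) (W : Wt n) (c : ℝ) (f g : Sm n) :
    Bf j W g (c • f) = c * Bf j W g f := by
  rw [Bf_symm, Bf_smul, Bf_symm j W f]

lemma diag_rho (hwu : ∀ x, 0 ≤ (w * u) x) {b : ℝ} (hn : (n : ℝ) = 2 * (k + b) + 6) (j l : ℕ) (h : l + j ≤ 3) :
    bb (k + b) (W0 n) (fun R => rho b 0 R * u) j 0 l l
      - bb k (fun R => Wq k (eq2 n 0 0 R)) (fun _ => u) j 0 l l ∈ Er (Nn k u w) := by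
  have e0 : bb k (fun R => Wq k (eq2 n 0 0 R)) (fun _ => u) j 0 l l
      = fun R => Bf j (W0 n R) (rho b 0 R * (Ao k ^ l) u) (rho b 0 R * (Ao k ^ l) u) := by
    funext R
    rw [Bf_rho hn j (by omega)]; rfl
  rw [e0]
  have h1 : ∀ (j : ℕ) (f : Sm n), (Ao k ^ (j + 1)) f = Ao k ((Ao k ^ j) f) := by
    intro j f; rw [pow_succ']; rfl
  have h1' : ∀ (j : ℕ) (f : Sm n), (Ao (k + b) ^ (j + 1)) f = Ao (k + b) ((Ao (k + b) ^ j) f) := by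
    intro j f; rw [pow_succ']; rfl
  have s0 : ∀ R, (Ao (k + b) ^ 0) (rho b 0 R * u) = rho b 0 R * (Ao k ^ 0) u := by
    intro R; simp
  have s1 : ∀ R, (Ao (k + b) ^ 1) (rho b 0 R * u) = rho b 0 R * (Ao k ^ 1) u
      + rho b 1 R * (Ao k ^ 0) u := by
    intro R; rw [h1' 0, s0, Ao_rho, ← h1]
  have s2 : ∀ R, (Ao (k + b) ^ 2) (rho b 0 R * u) = rho b 0 R * (Ao k ^ 2) u
      + ((2 : ℝ) • (rho b 1 R * (Ao k ^ 1) u) + rho b 2 R * (Ao k ^ 0) u) := by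
    intro R; rw [h1' 1, s1, map_add, Ao_rho, Ao_rho, ← h1, ← h1]; module
  have s3 : ∀ R, (Ao (k + b) ^ 3) (rho b 0 R * u) = rho b 0 R * (Ao k ^ 3) u
      + ((3 : ℝ) • (rho b 1 R * (Ao k ^ 2) u) + ((3 : ℝ) • (rho b 2 R * (Ao k ^ 1) u)
      + rho b 3 R * (Ao k ^ 0) u)) := by
    intro R; rw [h1' 2, s2, map_add, map_add, map_smul, Ao_rho, Ao_rho, Ao_rho, ← h1, ← h1, ← h1]
    module
  have er := fun a a' i i' ha hi hi' => err_rho (k := k) hwu hn j a a' i i' ha hi hi'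
  have hl : l ≤ 3 := by omega
  -- first move to one-sided expansions
  have key : ∀ (y : Idx → Sm n),
      ((fun R => Bf j (W0 n R) (rho b 0 R * (Ao k ^ l) u) (y R)) ∈ Er (Nn k u w)) →
      ((fun R => Bf j (W0 n R) (y R) (y R)) ∈ Er (Nn k u w)) →
      (fun R => Bf j (W0 n R) (rho b 0 R * (Ao k ^ l) u + y R) (rho b 0 R * (Ao k ^ l) u + y R))
      - (fun R => Bf j (W0 n R) (rho b 0 R * (Ao k ^ l) u) (rho b 0 R * (Ao k ^ l) u))
      ∈ Er (Nn k u w) := by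
    intro y hy1 hy2
    have e : (fun R => Bf j (W0 n R) (rho b 0 R * (Ao k ^ l) u + y R)
        (rho b 0 R * (Ao k ^ l) u + y R))
      - (fun R => Bf j (W0 n R) (rho b 0 R * (Ao k ^ l) u) (rho b 0 R * (Ao k ^ l) u))
      = (2 : ℝ) • (fun R => Bf j (W0 n R) (rho b 0 R * (Ao k ^ l) u) (y R))
        + (fun R => Bf j (W0 n R) (y R) (y R)) := by
      funext R
      simp only [Pi.sub_apply, Pi.add_apply, Pi.smul_apply, smul_eq_mul, Bf_add, Bf_add_right]
      rw [Bf_symm j _ (y R) (rho b 0 R * (Ao k ^ l) u)]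
      ring
    rw [e]
    exact (Er _).add_mem ((Er _).smul_mem _ hy1) hy2
  have addR : ∀ (x y z : Idx → Sm n), (fun R => Bf j (W0 n R) (x R) (y R)) ∈ Er (Nn k u w) →
      (fun R => Bf j (W0 n R) (x R) (z R)) ∈ Er (Nn k u w) →
      (fun R => Bf j (W0 n R) (x R) (y R + z R)) ∈ Er (Nn k u w) := by
    intro x y z h1 h2
    simp only [Bf_add_right]
    exact (Er _).add_mem h1 h2
  have addL : ∀ (x y z : Idx → Sm n), (fun R => Bf j (W0 n R) (y R) (x R)) ∈ Er (Nn k u w) →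
      (fun R => Bf j (W0 n R) (z R) (x R)) ∈ Er (Nn k u w) →
      (fun R => Bf j (W0 n R) (y R + z R) (x R)) ∈ Er (Nn k u w) := by
    intro x y z h1 h2
    simp only [Bf_add]
    exact (Er _).add_mem h1 h2
  have smR : ∀ (c : ℝ) (x y : Idx → Sm n), (fun R => Bf j (W0 n R) (x R) (y R)) ∈ Er (Nn k u w) →
      (fun R => Bf j (W0 n R) (x R) (c • y R)) ∈ Er (Nn k u w) := by
    intro c x y h1
    simp only [Bf_smul_right]
    exact (Er _).smul_mem c h1
  have smL : ∀ (c : ℝ) (x y : Idx → Sm n), (fun R => Bf j (W0 n R) (y R) (x R)) ∈ Er (Nn k u w) →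
      (fun R => Bf j (W0 n R) (c • y R) (x R)) ∈ Er (Nn k u w) := by
    intro c x y h1
    simp only [Bf_smul]
    exact (Er _).smul_mem c h1
  unfold bb
  simp only [Function.iterate_zero, id]
  interval_cases l
  · simp only [s0]; rw [sub_self]; exact (Er _).zero_mem
  · simp only [s1]
    refine key _ (er _ _ _ _ (by omega) (by omega) (by omega))
      (er _ _ _ _ (by omega) (by omega) (by omega))
  · simp only [s2]
    have t : ∀ a i, i + j ≤ 3 → (fun R => Bf j (W0 n R) (rho b a R * (Ao k ^ i) u)
      ((2 : ℝ) • (rho b 1 R * (Ao k ^ 1) u) + rho b 2 R * (Ao k ^ 0) u)) ∈ Er (Nn k u w) :=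
      fun a i hi => addR _ _ _ (smR _ _ _ (er _ _ _ _ (by omega) (by omega) (by omega)))
        (er _ _ _ _ (by omega) (by omega) (by omega))
    refine key _ (t _ _ (by omega)) ?_
    exact addL _ _ _ (smL _ _ _ (t _ _ (by omega))) (t _ _ (by omega))
  · simp only [s3]
    have t : ∀ a i, i + j ≤ 3 → (fun R => Bf j (W0 n R) (rho b a R * (Ao k ^ i) u)
      ((3 : ℝ) • (rho b 1 R * (Ao k ^ 2) u) + ((3 : ℝ) • (rho b 2 R * (Ao k ^ 1) u)
      + rho b 3 R * (Ao k ^ 0) u))) ∈ Er (Nn k u w) :=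
      fun a i hi => addR _ _ _ (smR _ _ _ (er _ _ _ _ (by omega) (by omega) (by omega)))
        (addR _ _ _ (smR _ _ _ (er _ _ _ _ (by omega) (by omega) (by omega)))
        (er _ _ _ _ (by omega) (by omega) (by omega)))
    refine key _ (t _ _ (by omega)) ?_
    exact addL _ _ _ (smL _ _ _ (t _ _ (by omega)))
      (addL _ _ _ (smL _ _ _ (t _ _ (by omega))) (t _ _ (by omega)))

lemma diag_nonneg (hwu : ∀ x, 0 ≤ (w * u) x) (j l : ℕ) (hj : j ≤ 3) (R : Idx) :
    0 ≤ bb k (fun R => Wq k (eq2 n 0 0 R)) (fun _ => u) j 0 l l R := by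
  simp only [bb, Function.iterate_zero, id]
  rw [Bf_ed j hj]
  refine integral_nonneg fun x => ?_
  simp only [Pi.zero_apply, Sm.mul_ap]
  refine mul_nonneg (ed_nonneg _ _ _) ?_
  simp only [Wq, eq2, Sm.mul_ap]
  by_cases hx : x ∈ shell n R
  · rw [Tp_ap _ _ _ (by linarith [hx.1])]
    exact mul_nonneg (Real.rpow_nonneg (r2_nonneg x) _) (mul_self_nonneg _)
  · rw [eta_van 0 R x hx]; simp

end Main


/-! ### Stage 2: the integral inequality -/

/-- Families bounded above by a multiple of `N`. -/
def Up (N : Idx → ℝ) (v : Idx → ℝ) : Prop := ∃ C, ∀ R, v R ≤ C * N R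

lemma Er.up {N v : Idx → ℝ} (h : v ∈ Er N) : Up N v := by
  obtain ⟨C, hC⟩ := h
  exact ⟨C, fun R => (le_abs_self _).trans (hC R)⟩

lemma Up.add {N v w : Idx → ℝ} (h : Up N v) (h' : Up N w) : Up N (v + w) := by
  obtain ⟨C, hC⟩ := h
  obtain ⟨C', hC'⟩ := h'
  exact ⟨C + C', fun R => by rw [Pi.add_apply]; linarith [hC R, hC' R]⟩

lemma Up.er {N v : Idx → ℝ} (h : Up N v) (h0 : ∀ R, 0 ≤ v R) : v ∈ Er N := by
  obtain ⟨C, hC⟩ := h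
  exact ⟨C, fun R => by rw [abs_of_nonneg (h0 R)]; exact hC R⟩

lemma Up.mono {N v w : Idx → ℝ} (h : Up N w) (h0 : ∀ R, v R ≤ w R) : Up N v := by
  obtain ⟨C, hC⟩ := h
  exact ⟨C, fun R => (h0 R).trans (hC R)⟩

lemma Er.of_smul {N v : Idx → ℝ} {c : ℝ} (hc : c ≠ 0) (h : c • v ∈ Er N) : v ∈ Er N := by
  have := (Er N).smul_mem c⁻¹ h
  rwa [smul_smul, inv_mul_cancel₀ hc, one_smul] at this

lemma Up.split {N v w : Idx → ℝ} {c : ℝ} (hc : 0 < c) (hv : ∀ R, 0 ≤ v R) (hw : ∀ R, 0 ≤ w R)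
    (h : Up N (w + c • v)) : Up N w ∧ v ∈ Er N := by
  constructor
  · refine h.mono fun R => ?_
    simp only [Pi.add_apply, Pi.smul_apply, smul_eq_mul]
    have := mul_nonneg hc.le (hv R); linarith
  · refine Er.of_smul hc.ne' (Up.er (h.mono fun R => ?_) fun R => ?_)
    · simp only [Pi.add_apply, Pi.smul_apply, smul_eq_mul]
      linarith [hw R]
    · simp only [Pi.smul_apply, smul_eq_mul]
      exact mul_nonneg hc.le (hv R)

/-- Stable solutions. -/
structure Sol (p : ℝ) (u w : Sm n) : Prop where
  hp : 1 < p
  hw : w = - Lap (Lap (Lap u))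
  hwp : ∀ x, w x = |u x| ^ (p - 1) * u x
  stab : ∀ φ : Sm n, HasCompactSupport φ.1 →
    p * (∫ x, |u x| ^ (p - 1) * φ x ^ 2) ≤ ∫ x, (- Lap (Lap (Lap φ)) * φ) x

section Stage2
variable {p k b M : ℝ} {u w : Sm n}

lemma Sol.wu (S : Sol p u w) (x) : (w * u) x = |u x| ^ (p - 1) * u x ^ 2 := by
  rw [Sm.mul_ap, S.hwp]; ring

lemma Sol.wu_nn (S : Sol p u w) (x) : 0 ≤ (w * u) x := by
  rw [S.wu]; positivity

lemma Sol.wu' (S : Sol p u w) (x) : (w * u) x = |u x| ^ (p + 1) := by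
  rw [S.wu, ← sq_abs]
  rcases eq_or_ne (u x) 0 with h | h
  · have := S.hp
    rw [h, abs_zero, Real.zero_rpow (by linarith), Real.zero_rpow (by linarith)]; simp
  · rw [← Real.rpow_natCast, ← Real.rpow_add (abs_pos.mpr h)]
    congr 1; push_cast; ring

lemma Sol.pd_wu (S : Sol p u w) (i : Fin n) : pd i (w * u) = (p + 1) • (w * pd i u) := by
  have hp := S.hp
  ext x
  have e : (w * u).1 = fun x => |u x| ^ (p + 1) := funext S.wu'
  have h1 : HasDerivAt (fun t : ℝ => |t| ^ (p + 1)) ((p + 1) * |u x| ^ (p + 1 - 2) * u x) (u x) :=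
    hasDerivAt_abs_rpow (u x) (by linarith)
  have h2 := h1.comp_hasFDerivAt x (smdiff u x).hasFDerivAt
  have h3 : fderiv ℝ (w * u).1 x = ((p + 1) * |u x| ^ (p + 1 - 2) * u x) • fderiv ℝ u x := by
    rw [e]; exact h2.fderiv
  rw [pd_ap, h3, Sm.smul_ap, Sm.mul_ap, pd_ap, S.hwp]
  simp only [_root_.smul_apply, smul_eq_mul]
  rw [show p + 1 - 2 = p - 1 by ring]; ring

lemma Sol.Eu_wu (S : Sol p u w) : Eu (w * u) = (p + 1) • (w * Eu u) := by
  rw [Eu_eq, Eu_eq, Finset.mul_sum, Finset.smul_sum]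
  refine Finset.sum_congr rfl fun i _ => ?_
  rw [S.pd_wu, mul_smul_comm]; congr 1; ring

lemma Eu_r2_3 : Eu ((r2 : Sm n) ^ 3) = (6 : ℝ) • r2 ^ 3 := by
  have e : (r2 : Sm n) ^ 3 = r2 * (r2 * r2) := by ring
  rw [e, Eu_mul, Eu_mul, Eu_r2]
  ext x
  simp only [Sm.add_ap, Sm.mul_ap, Sm.smul_ap]; ring

/-- The diagonal forms. -/
abbrev DD (k : ℝ) (u : Sm n) (j l : ℕ) : Idx → ℝ :=
  bb k (fun R => Wq k (eq2 n 0 0 R)) (fun _ => u) j 0 l l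

/-- The nonlinear term. -/
def KK (k : ℝ) (u w : Sm n) : Idx → ℝ := fun R => Jw (Wq k (eq2 n 0 0 R)) u (r2 ^ 3 * w)

lemma Sol.c (S : Sol p u w) (hk : k * (p - 1) = 6) :
    (fun R => Jw (Wq k (eq2 n 0 0 R)) (Ao k u) (r2 ^ 3 * w)) ∈ Er (Nn k u w) := by
  have hp := S.hp
  have e : (fun R => Jw (Wq k (eq2 n 0 0 R)) (Ao k u) (r2 ^ 3 * w)) =
      (-(1 / (p + 1))) • fun R => ∫ x, ((r2 ^ 3 * (w * u)) * (Wq k (EuQ (eq2 n 0 0 R))).1 : Sm n) x := by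
    funext R
    rw [Pi.smul_apply, smul_eq_mul, Jw_eq]
    set W := Wq k (eq2 n 0 0 R)
    rw [← Th_Wq]
    have cs := W.2.2
    have h1 := int_Eu (r2 ^ 3 * (w * u) * W.1) (cs_mul_right _ _ cs)
    have e1 : Eu (r2 ^ 3 * (w * u) * W.1) =
        (p + 1) • (r2 ^ 3 * w * Ao k u * W.1)
        + ((-(n : ℝ)) • (r2 ^ 3 * (w * u) * W.1) + r2 ^ 3 * (w * u) * (Th k W).1) := by
      have e2 : (Th k W).1 = Eu W.1 + ((n : ℝ) - 2 * k) • W.1 := by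
        simp only [Th, Ao_eq]
      rw [e2, Eu_mul, Eu_mul, Eu_r2_3, S.Eu_wu, Ao_eq]
      ext x
      simp only [Sm.add_ap, Sm.mul_ap, Sm.smul_ap, Sm.pow_ap]
      have : (p + 1) * k = 6 + 2 * k := by linarith
      linear_combination ((r2 : Sm n) x ^ 3 * w x * u x * W.1 x) * (-this)
    rw [e1, int_add' (cs_smul _ (cs_mul_right _ _ cs)) (cs_add (cs_smul _ (cs_mul_right _ _ cs))
      (cs_mul_right _ _ (Th k W).2.2)), int_add' (cs_smul _ (cs_mul_right _ _ cs))
      (cs_mul_right _ _ (Th k W).2.2), int_smul', int_smul'] at h1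
    have hp1 : p + 1 ≠ 0 := by linarith
    field_simp
    linarith
  rw [e]
  refine (Er _).smul_mem _ (err_mem S.wu_nn _ (C := 1) (fun x => ?_) _ ?_)
  · rw [abs_of_nonneg (wu_nonneg S.wu_nn x), one_mul]
    exact wu_le_Dn x
  · exact eta_sq_an 1 le_rfl

lemma Sol.cc (S : Sol p u w) (hk : k * (p - 1) = 6) (hn : (n : ℝ) = 2 * (k + b) + 6)
    (hM : M = k + b + 2) (hb : b ≠ 0) :
    ((3 * (M^2 - b^2)^2 + 16 - 16 * b^2) • DD k u 0 1
      + (6*M^2+16-10*b^2) • DD k u 0 2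
      + (3 : ℝ) • DD k u 0 3
      + (6*(M^2-b^2)) • DD k u 1 1
      + (6 : ℝ) • DD k u 1 2
      + (3 : ℝ) • DD k u 2 1) ∈ Er (Nn k u w) := by
  have h1 := red_c (k := k) (W := fun R => Wq k (eq2 n 0 0 R)) (f := fun _ => u) (Er (Nn k u w))
    hM hn (fun j s l hs hl => err_bb S.wu_nn j s l hs hl)
  have h2 := S.c hk
  rw [S.hw] at h2
  rw [S.hw] at h1 ⊢
  have h3 := (Er _).sub_mem h2 h1
  rw [sub_sub_cancel] at h3
  exact Er.of_smul (by simpa using hb) h3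

lemma Sol.bb (S : Sol p u w) (hn : (n : ℝ) = 2 * (k + b) + 6) (hM : M = k + b + 2) :
    KK k u w - ((M^6-8*M^4+16*M^2-3*M^4*b^2+3*M^2*b^4-16*b^2+8*b^4-b^6) • DD k u 0 0
      + (16-48*b^2+15*b^4-18*M^2*b^2+3*M^4) • DD k u 0 1
      + (8-15*b^2+3*M^2) • DD k u 0 2
      + DD k u 0 3
      + (16+3*b^4-16*M^2-6*M^2*b^2+3*M^4) • DD k u 1 0
      + (6*M^2-18*b^2) • DD k u 1 1
      + (3 : ℝ) • DD k u 1 2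
      + (-8-3*b^2+3*M^2) • DD k u 2 0
      + (3 : ℝ) • DD k u 2 1
      + DD k u 3 0) ∈ Er (Nn k u w) := by
  have h1 := red_b (k := k) (W := fun R => Wq k (eq2 n 0 0 R)) (f := fun _ => u) (Er (Nn k u w))
    hM hn (fun j s l hs hl => err_bb S.wu_nn j s l hs hl)
  rw [← S.hw] at h1
  exact h1

lemma Sol.aa (S : Sol p u w) (hn : (n : ℝ) = 2 * (k + b) + 6) (hM : M = k + b + 2) :
    Up (Nn k u w) (p • KK k u w - ((M^6-8*M^4+16*M^2) • DD k u 0 0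
      + (16+3*M^4) • DD k u 0 1
      + (8+3*M^2) • DD k u 0 2
      + DD k u 0 3
      + (16-16*M^2+3*M^4) • DD k u 1 0
      + (6*M^2) • DD k u 1 1
      + (3 : ℝ) • DD k u 1 2
      + (-8+3*M^2) • DD k u 2 0
      + (3 : ℝ) • DD k u 2 1
      + DD k u 3 0)) := by
  have csf : ∀ R, HasCompactSupport (rho b 0 R * u : Sm n).1 := fun R =>
    cs_of_van (shell_compact R) fun x hx => by rw [Sm.mul_ap, rho_van b 0 R x hx, zero_mul]
  have h1 := red_b (k := k + b) (W := W0 n) (f := fun R => rho b 0 R * u) (Er (Nn k u w))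
    (b := 0) (M := M) (by linarith) (by linarith) (fun j s l hs hl => by
      have e : _root_.bb (k + b) (W0 n) (fun R => rho b 0 R * u) j s l l = 0 := by
        funext R
        simp only [_root_.bb]
        rw [Bf_ed j (by omega)]
        have h0 : ∀ x, (ed j ((Ao (k + b) ^ l) (rho b 0 R * u)) ((Ao (k + b) ^ l) (rho b 0 R * u))
            * ((Th (k + b))^[s] (W0 n R)).1 : Sm n) x = 0 := by
          intro x
          rw [Sm.mul_ap]
          by_cases hx : x ∈ shell n R
          · rw [Th_W0_iter hn R s hs x (shell_Om R hx), mul_zero]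
          · have hv : ∀ l, ∀ x ∈ (shell n R)ᶜ, ((Ao (k + b) ^ l) (rho b 0 R * u : Sm n)) x = 0 := by
              intro l
              induction l with
              | zero => intro x hx; simp [Sm.mul_ap, rho_van b 0 R x hx]
              | succ l ih =>
                intro x hx
                have := Eu_van (shell_compact R).isClosed.isOpen_compl ih x hx
                rw [pow_succ', Module.End.mul_apply, Ao_eq, Sm.add_ap, Sm.smul_ap, this, ih x hx]
                simp
            have hg : ∀ g : Sm n, (∀ x ∈ (shell n R)ᶜ, g x = 0) → (ed j g g) x = 0 := by
              intro g hg
              have hop : IsOpen (shell n R)ᶜ := (shell_compact R).isClosed.isOpen_compl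
              have hGa : ∀ f : Sm n, (∀ x ∈ (shell n R)ᶜ, f x = 0) →
                  ∀ h : Sm n, ∀ x ∈ (shell n R)ᶜ, (Ga f h) x = 0 := by
                intro f hf h x hx
                simp only [Ga, Sm.sub_ap, Sm.mul_ap, Sm.sum_ap]
                rw [Eu_van hop hf x hx, Finset.sum_eq_zero fun i _ => by
                  rw [pd_van i hop hf x hx, zero_mul]]
                simp
              have hZ : ∀ x ∈ (shell n R)ᶜ, (Zo g) x = 0 := by
                intro x hx
                have hE := Eu_van hop hg
                rw [Zo_eq]
                simp only [Sm.sub_ap, Sm.add_ap, Sm.smul_ap, Sm.mul_ap, Sm.neg_ap, hE x hx,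
                  Eu_van hop hE x hx]
                have hL : (Lap g) x = 0 := by
                  rw [Lap_eq, Sm.sum_ap]
                  exact Finset.sum_eq_zero fun i _ => pd_van i hop (pd_van i hop hg) x hx
                rw [hL]; simp
              have hj : j ≤ 3 := by omega
              interval_cases j
              · simp only [ed, Sm.mul_ap, hg x hx, mul_zero]
              · exact hGa g hg g x hx
              · simp only [ed, Sm.mul_ap, hZ x hx, mul_zero]
              · exact hGa _ hZ _ x hx
            rw [hg _ (hv l), zero_mul]
        simp only [h0]; simp
      rw [e]; exact (Er _).zero_mem)
  have h2 : Up (Nn k u w) (p • KK k u w - fun R =>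
      Jw (W0 n R) (rho b 0 R * u) (r2 ^ 3 * (- Lap (Lap (Lap (rho b 0 R * u)))))) := by
    refine ⟨0, fun R => ?_⟩
    have st := S.stab (rho b 0 R * u) (csf R)
    have r3 : ∀ x ∈ shell n R, (r2 : Sm n) x ^ 3 * (W0 n R).1 x = 1 := by
      intro x hx
      have h0 : 0 < (r2 : Sm n) x := ti_pos (R := R) (c := 1 / 3) (by norm_num) (by linarith [hx.1])
      rw [W0_ap R x (shell_Om R hx), Real.rpow_neg h0.le]
      norm_cast
      exact mul_inv_cancel₀ (by positivity)
    have e1 : KK k u w R = ∫ x, |u x| ^ (p - 1) * (rho b 0 R * u : Sm n) x ^ 2 := by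
      rw [KK, Jw_eq, ← rho_W0 hn]
      congr 1; funext x
      have hx1 := S.hwp x
      by_cases hx : x ∈ shell n R
      · simp only [Sm.mul_ap, Sm.pow_ap, hx1]
        linear_combination (|u x| ^ (p - 1) * (rho b 0 R : Sm n) x ^ 2 * u x ^ 2) * r3 x hx
      · simp only [Sm.mul_ap, rho_van b 0 R x hx]; ring
    have e2 : Jw (W0 n R) (rho b 0 R * u) (r2 ^ 3 * (- Lap (Lap (Lap (rho b 0 R * u)))))
        = ∫ x, (- Lap (Lap (Lap (rho b 0 R * u))) * (rho b 0 R * u) : Sm n) x := by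
      rw [Jw_eq]
      congr 1; funext x
      by_cases hx : x ∈ shell n R
      · simp only [Sm.mul_ap, Sm.pow_ap]
        linear_combination ((- Lap (Lap (Lap (rho b 0 R * u))) : Sm n) x * ((rho b 0 R : Sm n) x * u x)) * r3 x hx
      · simp only [Sm.mul_ap, rho_van b 0 R x hx]; ring
    simp only [Pi.sub_apply, Pi.smul_apply, smul_eq_mul]
    rw [e1, e2]; linarith
  have h3 := fun j l h => diag_rho (k := k) S.wu_nn hn j l h
  have h4 := h2.add (Er.up h1)
  have h5 := (Er (Nn k u w)).add_mem ((Er _).add_mem ((Er _).add_mem ((Er _).add_mem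
    ((Er _).smul_mem (M^6-8*M^4+16*M^2) (h3 0 0 (by norm_num)))
    ((Er _).smul_mem (16+3*M^4) (h3 0 1 (by norm_num))))
    ((Er _).smul_mem (8+3*M^2) (h3 0 2 (by norm_num)))) (h3 0 3 (by norm_num)))
    ((Er _).add_mem ((Er _).add_mem ((Er _).add_mem ((Er _).add_mem ((Er _).add_mem
    ((Er _).smul_mem (16-16*M^2+3*M^4) (h3 1 0 (by norm_num)))
    ((Er _).smul_mem (6*M^2) (h3 1 1 (by norm_num))))
    ((Er _).smul_mem (3 : ℝ) (h3 1 2 (by norm_num))))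
    ((Er _).smul_mem (-8+3*M^2) (h3 2 0 (by norm_num))))
    ((Er _).smul_mem (3 : ℝ) (h3 2 1 (by norm_num)))) (h3 3 0 (by norm_num)))
  have h6 := h4.add (Er.up h5)
  refine h6.mono fun R => le_of_eq ?_
  simp only [Pi.sub_apply, Pi.add_apply, Pi.smul_apply, smul_eq_mul]
  ring

/-- The algebraic conditions on the parameters. -/
def Coef (p b M : ℝ) : Prop :=
  0 < b ∧ 0 < 3 * (M^2 - b^2)^2 + 16 - 16 * b^2 ∧ 0 < 6*M^2+16-10*b^2 ∧ 0 < M^2 - b^2 ∧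
  0 < p * (M^6-8*M^4+16*M^2-3*M^4*b^2+3*M^2*b^4-16*b^2+8*b^4-b^6) - (M^6-8*M^4+16*M^2) ∧
  0 < p * (16+3*b^4-16*M^2-6*M^2*b^2+3*M^4) - (16-16*M^2+3*M^4) ∧
  0 < p * (-8-3*b^2+3*M^2) - (-8+3*M^2)

lemma Sol.dd (S : Sol p u w) (hk : k * (p - 1) = 6) (hn : (n : ℝ) = 2 * (k + b) + 6)
    (hM : M = k + b + 2) (hc : (b = 0 ∧ 2 < M) ∨ Coef p b M) :
    ∀ j l, l + j ≤ 3 → DD k u j l ∈ Er (Nn k u w) := by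
  have hp := S.hp
  have d := fun j l hj => diag_nonneg (k := k) S.wu_nn j l hj
  have A := S.aa hn hM
  have B := S.bb hn hM
  have B' := Er.up ((Er _).smul_mem (-p) B)
  have AB := A.add B'
  have nn : ∀ (v w : Idx → ℝ) (c : ℝ), 0 < c → (∀ R, 0 ≤ v R) → (∀ R, 0 ≤ w R) →
      ∀ R, 0 ≤ (v + c • w) R := by
    intro v w c hc hv hw R
    simp only [Pi.add_apply, Pi.smul_apply, smul_eq_mul]
    exact add_nonneg (hv R) (mul_nonneg hc.le (hw R))
  have n0 : ∀ R : Idx, 0 ≤ (0 : Idx → ℝ) R := fun R => le_rfl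
  rcases hc with ⟨rfl, hM2⟩ | ⟨hb, g1, g2, g3, f0, f1, f2⟩
  · have p1 : 0 < p - 1 := by linarith
    have M4 : 4 < M ^ 2 := by nlinarith
    have c1 : 0 < (p - 1) * (M^6-8*M^4+16*M^2) := by
      have : M^6-8*M^4+16*M^2 = M^2 * (M^2-4)^2 := by ring
      rw [this]
      have : 0 < M^2 - 4 := by linarith
      positivity
    have c2 : 0 < (p - 1) * (16+3*M^4) := by positivity
    have c3 : 0 < (p - 1) * (8+3*M^2) := by positivity
    have c5 : 0 < (p - 1) * (16-16*M^2+3*M^4) := by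
      have : 16-16*M^2+3*M^4 = (3*M^2-4)*(M^2-4) := by ring
      rw [this]
      have : 0 < M^2 - 4 := by linarith
      have : 0 < 3*M^2 - 4 := by linarith
      positivity
    have c6 : 0 < (p - 1) * (6*M^2) := by positivity
    have c7 : 0 < (p - 1) * 3 := by positivity
    have c8 : 0 < (p - 1) * (-8+3*M^2) := by
      have : 0 < -8+3*M^2 := by linarith
      positivity
    have key : Up (Nn k u w) (0 + ((p - 1) * (M^6-8*M^4+16*M^2)) • DD k u 0 0
      + ((p - 1) * (16+3*M^4)) • DD k u 0 1
      + ((p - 1) * (8+3*M^2)) • DD k u 0 2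
      + (p - 1) • DD k u 0 3
      + ((p - 1) * (16-16*M^2+3*M^4)) • DD k u 1 0
      + ((p - 1) * (6*M^2)) • DD k u 1 1
      + ((p - 1) * 3) • DD k u 1 2
      + ((p - 1) * (-8+3*M^2)) • DD k u 2 0
      + ((p - 1) * 3) • DD k u 2 1
      + (p - 1) • DD k u 3 0) := by
      refine AB.mono fun R => le_of_eq ?_
      simp only [Pi.sub_apply, Pi.add_apply, Pi.smul_apply, smul_eq_mul, Pi.zero_apply]
      ring
    have m1 := nn _ _ _ c1 n0 (d 0 0 (by norm_num))
    have m2 := nn _ _ _ c2 m1 (d 0 1 (by norm_num))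
    have m3 := nn _ _ _ c3 m2 (d 0 2 (by norm_num))
    have m4 := nn _ _ _ p1 m3 (d 0 3 (by norm_num))
    have m5 := nn _ _ _ c5 m4 (d 1 0 (by norm_num))
    have m6 := nn _ _ _ c6 m5 (d 1 1 (by norm_num))
    have m7 := nn _ _ _ c7 m6 (d 1 2 (by norm_num))
    have m8 := nn _ _ _ c8 m7 (d 2 0 (by norm_num))
    have m9 := nn _ _ _ c7 m8 (d 2 1 (by norm_num))
    obtain ⟨key, r30⟩ := key.split p1 (d 3 0 (by norm_num)) m9
    obtain ⟨key, r21⟩ := key.split c7 (d 2 1 (by norm_num)) m8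
    obtain ⟨key, r20⟩ := key.split c8 (d 2 0 (by norm_num)) m7
    obtain ⟨key, r12⟩ := key.split c7 (d 1 2 (by norm_num)) m6
    obtain ⟨key, r11⟩ := key.split c6 (d 1 1 (by norm_num)) m5
    obtain ⟨key, r10⟩ := key.split c5 (d 1 0 (by norm_num)) m4
    obtain ⟨key, r03⟩ := key.split p1 (d 0 3 (by norm_num)) m3
    obtain ⟨key, r02⟩ := key.split c3 (d 0 2 (by norm_num)) m2
    obtain ⟨key, r01⟩ := key.split c2 (d 0 1 (by norm_num)) m1
    obtain ⟨key, r00⟩ := key.split c1 (d 0 0 (by norm_num)) n0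
    intro j l h
    have hj : j ≤ 3 := by omega
    interval_cases j
    · have hl : l ≤ 3 := by omega
      interval_cases l <;> assumption
    · have hl : l ≤ 2 := by omega
      interval_cases l <;> assumption
    · have hl : l ≤ 1 := by omega
      interval_cases l <;> assumption
    · have hl : l ≤ 0 := by omega
      interval_cases l; assumption
  · have p1 : 0 < p - 1 := by linarith
    have C := Er.up (S.cc hk hn hM hb.ne')
    have key : Up (Nn k u w) (0 + (3 * (M^2 - b^2)^2 + 16 - 16 * b^2) • DD k u 0 1
      + (6*M^2+16-10*b^2) • DD k u 0 2
      + (3 : ℝ) • DD k u 0 3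
      + (6*(M^2-b^2)) • DD k u 1 1
      + (6 : ℝ) • DD k u 1 2
      + (3 : ℝ) • DD k u 2 1) := by rw [zero_add]; exact C
    have g4 : 0 < 6*(M^2-b^2) := by linarith
    have t3 : (0 : ℝ) < 3 := by norm_num
    have t6 : (0 : ℝ) < 6 := by norm_num
    have m1 := nn _ _ _ g1 n0 (d 0 1 (by norm_num))
    have m2 := nn _ _ _ g2 m1 (d 0 2 (by norm_num))
    have m3 := nn _ _ _ t3 m2 (d 0 3 (by norm_num))
    have m4 := nn _ _ _ g4 m3 (d 1 1 (by norm_num))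
    have m5 := nn _ _ _ t6 m4 (d 1 2 (by norm_num))
    obtain ⟨key, r21⟩ := key.split t3 (d 2 1 (by norm_num)) m5
    obtain ⟨key, r12⟩ := key.split t6 (d 1 2 (by norm_num)) m4
    obtain ⟨key, r11⟩ := key.split g4 (d 1 1 (by norm_num)) m3
    obtain ⟨key, r03⟩ := key.split t3 (d 0 3 (by norm_num)) m2
    obtain ⟨key, r02⟩ := key.split g2 (d 0 2 (by norm_num)) m1
    obtain ⟨key, r01⟩ := key.split g1 (d 0 1 (by norm_num)) n0
    have X := Er.up ((Er (Nn k u w)).add_mem ((Er _).add_mem ((Er _).add_mem ((Er _).add_mem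
      ((Er _).add_mem
      ((Er _).smul_mem ((16+3*M^4) - p * (16-48*b^2+15*b^4-18*M^2*b^2+3*M^4)) r01)
      ((Er _).smul_mem ((8+3*M^2) - p * (8-15*b^2+3*M^2)) r02))
      ((Er _).smul_mem (1 - p) r03))
      ((Er _).smul_mem ((6*M^2) - p * (6*M^2-18*b^2)) r11))
      ((Er _).smul_mem (3 - p * 3) r12))
      ((Er _).smul_mem (3 - p * 3) r21))
    have key : Up (Nn k u w) (0 + (p * (M^6-8*M^4+16*M^2-3*M^4*b^2+3*M^2*b^4-16*b^2+8*b^4-b^6)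
        - (M^6-8*M^4+16*M^2)) • DD k u 0 0
      + (p * (16+3*b^4-16*M^2-6*M^2*b^2+3*M^4) - (16-16*M^2+3*M^4)) • DD k u 1 0
      + (p * (-8-3*b^2+3*M^2) - (-8+3*M^2)) • DD k u 2 0
      + (p - 1) • DD k u 3 0) := by
      refine (AB.add X).mono fun R => le_of_eq ?_
      simp only [Pi.sub_apply, Pi.add_apply, Pi.smul_apply, smul_eq_mul, Pi.zero_apply]
      ring
    have m1 := nn _ _ _ f0 n0 (d 0 0 (by norm_num))
    have m2 := nn _ _ _ f1 m1 (d 1 0 (by norm_num))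
    have m3 := nn _ _ _ f2 m2 (d 2 0 (by norm_num))
    obtain ⟨key, r30⟩ := key.split p1 (d 3 0 (by norm_num)) m3
    obtain ⟨key, r20⟩ := key.split f2 (d 2 0 (by norm_num)) m2
    obtain ⟨key, r10⟩ := key.split f1 (d 1 0 (by norm_num)) m1
    obtain ⟨key, r00⟩ := key.split f0 (d 0 0 (by norm_num)) n0
    intro j l h
    have hj : j ≤ 3 := by omega
    interval_cases j
    · have hl : l ≤ 3 := by omega
      interval_cases l <;> assumption
    · have hl : l ≤ 2 := by omega
      interval_cases l <;> assumption
    · have hl : l ≤ 1 := by omega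
      interval_cases l <;> assumption
    · have hl : l ≤ 0 := by omega
      interval_cases l; assumption

lemma Sol.main (S : Sol p u w) (hk : k * (p - 1) = 6) (hn : (n : ℝ) = 2 * (k + b) + 6)
    (hM : M = k + b + 2) (hc : (b = 0 ∧ 2 < M) ∨ Coef p b M) :
    ∃ C, ∀ R, ∫ x in core n R, Fn k u w x ≤ C * Nn k u w R := by
  have D := S.dd hk hn hM hc
  have hK : KK k u w ∈ Er (Nn k u w) := by
    have B := S.bb hn hM
    have X := (Er (Nn k u w)).add_mem ((Er _).add_mem ((Er _).add_mem ((Er _).add_mem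
      ((Er _).smul_mem (M^6-8*M^4+16*M^2-3*M^4*b^2+3*M^2*b^4-16*b^2+8*b^4-b^6) (D 0 0 (by norm_num)))
      ((Er _).smul_mem (16-48*b^2+15*b^4-18*M^2*b^2+3*M^4) (D 0 1 (by norm_num))))
      ((Er _).smul_mem (8-15*b^2+3*M^2) (D 0 2 (by norm_num)))) (D 0 3 (by norm_num)))
      ((Er _).add_mem ((Er _).add_mem ((Er _).add_mem ((Er _).add_mem ((Er _).add_mem
      ((Er _).smul_mem (16+3*b^4-16*M^2-6*M^2*b^2+3*M^4) (D 1 0 (by norm_num)))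
      ((Er _).smul_mem (6*M^2-18*b^2) (D 1 1 (by norm_num))))
      ((Er _).smul_mem (3 : ℝ) (D 1 2 (by norm_num))))
      ((Er _).smul_mem (-8-3*b^2+3*M^2) (D 2 0 (by norm_num))))
      ((Er _).smul_mem (3 : ℝ) (D 2 1 (by norm_num)))) (D 3 0 (by norm_num)))
    have Y := (Er _).add_mem B X
    convert Y using 1
    module
  have hT : (∑ q ∈ ix, DD k u q.2 q.1) + KK k u w ∈ Er (Nn k u w) := by
    refine (Er _).add_mem ((Er _).sum_mem fun q hq => D _ _ ?_) hK
    simp only [ix, Finset.mem_filter] at hq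
    exact hq.2
  obtain ⟨C, hC⟩ := Er.up hT
  refine ⟨C, fun R => le_trans ?_ (hC R)⟩
  set W := Wq k (eq2 n 0 0 R) with hW
  have e : ((∑ q ∈ ix, DD k u q.2 q.1) + KK k u w) R = ∫ x, (Dn k u w * W.1) x := by
    rw [Pi.add_apply, Finset.sum_apply, Dn, add_mul, Finset.sum_mul,
      int_add' (cs_sum _ _ fun i => cs_mul_right _ _ W.2.2) (cs_mul_right _ _ W.2.2)]
    congr 1
    · simp only [Sm.sum_ap]
      rw [integral_finsetSum _ fun i _ => cs_int (cs_mul_right _ _ W.2.2)]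
      refine Finset.sum_congr rfl fun q hq => ?_
      simp only [ix, Finset.mem_filter] at hq
      simp only [_root_.bb]
      rw [Bf_ed _ (by omega)]; rfl
    · rw [KK, Jw_eq]
      congr 1; funext x
      simp only [Sm.mul_ap]; ring
  rw [e]
  have hWn : ∀ x, 0 ≤ (Dn k u w * W.1) x := by
    intro x
    rw [Sm.mul_ap]
    refine mul_nonneg (Dn_nonneg S.wu_nn x) ?_
    simp only [hW, Wq, eq2, Sm.mul_ap]
    by_cases hx : x ∈ shell n R
    · rw [Tp_ap _ _ _ (by linarith [hx.1])]
      exact mul_nonneg (Real.rpow_nonneg (r2_nonneg x) _) (mul_self_nonneg _)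
    · rw [eta_van 0 R x hx]; simp
  have h1 : ∫ x in core n R, Fn k u w x = ∫ x in core n R, (Dn k u w * W.1) x := by
    refine setIntegral_congr_fun (core_closed R).measurableSet fun x hx => ?_
    have h3 := (core_sub R hx).1
    simp only [Fn, hW, Wq, eq2, Sm.mul_ap]
    rw [eta_core R x hx, Tp_ap _ _ _ (by linarith)]; ring
  rw [h1]
  exact setIntegral_le_integral (cs_int (cs_mul_right _ _ W.2.2)) (Eventually.of_forall hWn)

end Stage2


/-! ### Differential operators and pointwise bounds -/

/-- Sum of squares of the derivatives up to order `d`. -/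
def En : ℕ → Sm n → Sm n
  | 0, v => v ^ 2
  | d + 1, v => v ^ 2 + ∑ i, En d (pd i v)

lemma En_nonneg (d : ℕ) : ∀ (v : Sm n) (x), 0 ≤ (En d v) x := by
  induction d with
  | zero => intro v x; simp only [En, Sm.pow_ap]; positivity
  | succ d ih =>
    intro v x
    simp only [En, Sm.add_ap, Sm.pow_ap, Sm.sum_ap]
    have := Finset.sum_nonneg fun i (_ : i ∈ Finset.univ) => ih (pd i v) x
    positivity

lemma En_mono1 (d : ℕ) : ∀ (v : Sm n) (x), (En d v) x ≤ (En (d + 1) v) x := by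
  induction d with
  | zero =>
    intro v x
    simp only [En, Sm.add_ap, Sm.pow_ap, Sm.sum_ap]
    have := Finset.sum_nonneg fun i (_ : i ∈ Finset.univ) => sq_nonneg ((pd i v) x)
    linarith
  | succ d ih =>
    intro v x
    rw [En, En]
    simp only [Sm.add_ap, Sm.pow_ap, Sm.sum_ap]
    have := Finset.sum_le_sum fun i (_ : i ∈ Finset.univ) => ih (pd i v) x
    linarith

lemma En_mono {d d' : ℕ} (h : d ≤ d') (v : Sm n) (x) : (En d v) x ≤ (En d' v) x := by
  induction d', h using Nat.le_induction with
  | base => exact le_rfl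
  | succ d' _ ih => exact ih.trans (En_mono1 d' v x)

lemma En_pd (d : ℕ) (i : Fin n) (v : Sm n) (x) : (En d (pd i v)) x ≤ (En (d + 1) v) x := by
  rw [En]
  simp only [Sm.add_ap, Sm.pow_ap, Sm.sum_ap]
  have := Finset.single_le_sum (f := fun i => (En d (pd i v)) x)
    (fun i (_ : i ∈ Finset.univ) => En_nonneg d (pd i v) x) (Finset.mem_univ i)
  have h2 := sq_nonneg (v x)
  linarith

/-- Linear differential operators with smooth coefficients. -/
inductive DO : ℕ → (Sm n →ₗ[ℝ] Sm n) → Prop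
  | id : DO 0 LinearMap.id
  | comp (d : ℕ) (T) (i : Fin n) : DO d T → DO (d + 1) (T ∘ₗ (pd i).toLinearMap)
  | mul (d : ℕ) (T) (f : Sm n) : DO d T → DO d (LinearMap.mulLeft ℝ f ∘ₗ T)
  | add (d : ℕ) (T T') : DO d T → DO d T' → DO d (T + T')
  | mono (d d' : ℕ) (T) : d ≤ d' → DO d T → DO d' T

lemma DO.bound {K : Set (EuclideanSpace ℝ (Fin n))} (hK : IsCompact K) {d : ℕ}
    {T : Sm n →ₗ[ℝ] Sm n} (h : DO d T) :
    ∃ C, 0 ≤ C ∧ ∀ (v : Sm n), ∀ x ∈ K, (T v) x ^ 2 ≤ C * (En d v) x := by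
  induction h with
  | id => exact ⟨1, zero_le_one, fun v x _ => by simp [En]⟩
  | comp d T i _ ih =>
    obtain ⟨C, hC, h⟩ := ih
    exact ⟨C, hC, fun v x hx => (h (pd i v) x hx).trans
      (mul_le_mul_of_nonneg_left (En_pd d i v x) hC)⟩
  | mul d T f _ ih =>
    obtain ⟨C, hC, h⟩ := ih
    obtain ⟨B, hB⟩ := hK.exists_bound_of_continuousOn (smcont f).continuousOn
    refine ⟨B ^ 2 * C, by positivity, fun v x hx => ?_⟩
    have h1 : (f x) ^ 2 ≤ B ^ 2 := by
      have := hB x hx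
      rw [Real.norm_eq_abs] at this
      exact sq_le_sq' (by linarith [(abs_le.mp this).1]) (abs_le.mp this).2
    have e : ((LinearMap.mulLeft ℝ f ∘ₗ T) v) x = f x * (T v) x := rfl
    rw [e, mul_pow, mul_assoc]
    exact mul_le_mul h1 (h v x hx) (sq_nonneg _) (sq_nonneg _)
  | add d T T' _ _ ih ih' =>
    obtain ⟨C, hC, h⟩ := ih
    obtain ⟨C', hC', h'⟩ := ih'
    refine ⟨2 * C + 2 * C', by positivity, fun v x hx => ?_⟩
    have e : ((T + T') v) x = (T v) x + (T' v) x := rfl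
    rw [e]
    nlinarith [h v x hx, h' v x hx, sq_nonneg ((T v) x - (T' v) x)]
  | mono d d' T hd _ ih =>
    obtain ⟨C, hC, h⟩ := ih
    exact ⟨C, hC, fun v x hx => (h v x hx).trans (mul_le_mul_of_nonneg_left (En_mono hd v x) hC)⟩

lemma DO.pdl {d : ℕ} {T : Sm n →ₗ[ℝ] Sm n} (h : DO d T) (i : Fin n) :
    DO (d + 1) ((pd i).toLinearMap ∘ₗ T) := by
  induction h with
  | id => exact DO.comp 0 _ i DO.id
  | comp d T j _ ih => exact DO.comp _ _ j ih
  | mul d T f hT ih =>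
    have e : (pd i).toLinearMap ∘ₗ (LinearMap.mulLeft ℝ f ∘ₗ T)
        = LinearMap.mulLeft ℝ f ∘ₗ ((pd i).toLinearMap ∘ₗ T)
          + LinearMap.mulLeft ℝ (pd i f) ∘ₗ T := by
      ext1 v
      change pd i (f * T v) = f * pd i (T v) + pd i f * T v
      rw [pd_mul]; ring
    rw [e]
    exact DO.add _ _ _ (DO.mul _ _ _ ih) (DO.mul _ _ _ (DO.mono _ _ _ (by omega) hT))
  | add d T T' _ _ ih ih' =>
    rw [LinearMap.comp_add]; exact DO.add _ _ _ ih ih'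
  | mono d d' T hd _ ih => exact DO.mono _ _ _ (by omega) ih

lemma DO.smul {d : ℕ} {T : Sm n →ₗ[ℝ] Sm n} (h : DO d T) (c : ℝ) : DO d (c • T) := by
  have e : c • T = LinearMap.mulLeft ℝ (c • (1 : Sm n)) ∘ₗ T := by
    ext1 v
    change c • T v = (c • (1 : Sm n)) * T v
    rw [smul_mul_assoc, one_mul]
  rw [e]; exact DO.mul _ _ _ h

lemma DO.zero (d : ℕ) : DO d (0 : Sm n →ₗ[ℝ] Sm n) := by
  have := DO.mono 0 d _ (by omega) ((DO.id (n := n)).smul 0)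
  rwa [zero_smul] at this

lemma DO.sum {ι : Type*} (s : Finset ι) {d : ℕ} (T : ι → Sm n →ₗ[ℝ] Sm n)
    (h : ∀ i, DO d (T i)) : DO d (∑ i ∈ s, T i) := by
  classical
  induction s using Finset.induction_on with
  | empty => exact DO.zero d
  | insert i s hi ih => rw [Finset.sum_insert hi]; exact DO.add _ _ _ (h i) ih

lemma DO.Eul {d : ℕ} {T : Sm n →ₗ[ℝ] Sm n} (h : DO d T) :
    ∃ T', DO (d + 1) T' ∧ ∀ v, T' v = Eu (T v) := by
  refine ⟨∑ i, LinearMap.mulLeft ℝ (co i) ∘ₗ ((pd i).toLinearMap ∘ₗ T),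
    DO.sum _ _ fun i => DO.mul _ _ _ (h.pdl i), fun v => ?_⟩
  rw [Eu_eq, LinearMap.sum_apply]; rfl

lemma DO.Lapl {d : ℕ} {T : Sm n →ₗ[ℝ] Sm n} (h : DO d T) : DO (d + 2) (Lap ∘ₗ T) := by
  have e : Lap ∘ₗ T = ∑ i, (pd i).toLinearMap ∘ₗ ((pd i).toLinearMap ∘ₗ T) := by
    ext1 v
    rw [LinearMap.sum_apply, LinearMap.comp_apply, Lap_eq]; rfl
  rw [e]
  exact DO.sum _ _ fun i => (h.pdl i).pdl i

/-! ### Stage 1: local energy estimate -/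

/-- cutoff -/
def zz : Sm n := cm 1 ⟨fun t => Real.smoothTransition (4 - t),
    Real.smoothTransition.contDiff.comp (by fun_prop)⟩
/-- wider cutoff -/
def zw : Sm n := cm 1 ⟨fun t => Real.smoothTransition (6 - t),
    Real.smoothTransition.contDiff.comp (by fun_prop)⟩

lemma zz_ap (x : EuclideanSpace ℝ (Fin n)) :
    (zz : Sm n) x = Real.smoothTransition (4 - (r2 : Sm n) x) := by
  rw [zz, cm_ap]; simp
lemma zw_ap (x : EuclideanSpace ℝ (Fin n)) :
    (zw : Sm n) x = Real.smoothTransition (6 - (r2 : Sm n) x) := by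
  rw [zw, cm_ap]; simp

lemma zz_nonneg (x : EuclideanSpace ℝ (Fin n)) : 0 ≤ (zz : Sm n) x := by
  rw [zz_ap]; exact Real.smoothTransition.nonneg _
lemma zz_le_one (x : EuclideanSpace ℝ (Fin n)) : (zz : Sm n) x ≤ 1 := by
  rw [zz_ap]; exact Real.smoothTransition.le_one _
lemma zw_nonneg (x : EuclideanSpace ℝ (Fin n)) : 0 ≤ (zw : Sm n) x := by
  rw [zw_ap]; exact Real.smoothTransition.nonneg _

/-- The compact set. -/
def KB (n : ℕ) : Set (EuclideanSpace ℝ (Fin n)) := {x | (r2 : Sm n) x ≤ 6}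

lemma KB_compact : IsCompact (KB n) := by
  have : KB n ⊆ Metric.closedBall 0 3 := by
    intro x hx
    have h : (r2 : Sm n) x ≤ 6 := hx
    rw [r2_norm] at h
    rw [mem_closedBall_zero_iff]
    nlinarith [norm_nonneg x]
  exact (isCompact_closedBall _ _).of_isClosed_subset
    (isClosed_le (smcont r2) continuous_const) this

lemma zw_cs : HasCompactSupport (zw : Sm n).1 :=
  cs_of_van KB_compact fun x hx => by
    have h : ¬ (r2 : Sm n) x ≤ 6 := hx
    rw [zw_ap, Real.smoothTransition.zero_of_nonpos (by linarith)]

/-- Local integral, a linear functional on all smooth functions. -/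
def JJ : Sm n →ₗ[ℝ] ℝ where
  toFun f := ∫ x, (f * zw : Sm n) x
  map_add' f g := by
    rw [add_mul]; exact int_add' (cs_mul_right _ _ zw_cs) (cs_mul_right _ _ zw_cs)
  map_smul' c f := by
    rw [smul_mul_assoc, int_smul']; rfl

lemma JJ_mono {f g : Sm n} (h : ∀ x ∈ KB n, f x ≤ g x) : JJ f ≤ JJ g := by
  refine integral_mono (cs_int (cs_mul_right _ _ zw_cs)) (cs_int (cs_mul_right _ _ zw_cs)) ?_
  intro x
  change (f * zw : Sm n) x ≤ (g * zw : Sm n) x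
  rw [Sm.mul_ap, Sm.mul_ap]
  by_cases hx : x ∈ KB n
  · exact mul_le_mul_of_nonneg_right (h x hx) (zw_nonneg x)
  · have h : ¬ (r2 : Sm n) x ≤ 6 := hx
    rw [zw_ap, Real.smoothTransition.zero_of_nonpos (by linarith)]; simp

lemma JJ_nonneg {f : Sm n} (h : ∀ x ∈ KB n, 0 ≤ f x) : 0 ≤ JJ f := by
  have := JJ_mono (f := 0) (g := f) (fun x hx => by simpa using h x hx)
  simpa using this

lemma zz_van (g : Sm n) : ∀ x ∈ {x : EuclideanSpace ℝ (Fin n) | 4 < (r2 : Sm n) x},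
    (zz * g : Sm n) x = 0 := by
  intro x hx
  have : 4 < (r2 : Sm n) x := hx
  rw [Sm.mul_ap, zz_ap, Real.smoothTransition.zero_of_nonpos (by linarith), zero_mul]

lemma zz_cs (g : Sm n) : HasCompactSupport (zz * g : Sm n).1 :=
  cs_of_van KB_compact fun x hx => by
    have h : ¬ (r2 : Sm n) x ≤ 6 := hx
    exact zz_van g x (show 4 < (r2 : Sm n) x by linarith)

lemma JJ_of_van {f : Sm n} (h : ∀ x ∈ {x : EuclideanSpace ℝ (Fin n) | 4 < (r2 : Sm n) x}, f x = 0) :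
    JJ f = ∫ x, f x := by
  change ∫ x, (f * zw : Sm n) x = _
  congr 1; funext x
  rw [Sm.mul_ap]
  by_cases hx : 4 < (r2 : Sm n) x
  · rw [h x hx, zero_mul]
  · rw [zw_ap, Real.smoothTransition.one_of_one_le (by linarith), mul_one]

lemma JJ_zz (g : Sm n) : JJ (zz * g) = ∫ x, (zz * g : Sm n) x := JJ_of_van (zz_van g)

lemma op4 : IsOpen {x : EuclideanSpace ℝ (Fin n) | 4 < (r2 : Sm n) x} :=
  isOpen_lt continuous_const (smcont r2)

lemma JJ_pd (i : Fin n) (g : Sm n) : JJ (pd i (zz * g)) = 0 := by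
  rw [JJ_of_van (pd_van i op4 (zz_van g))]
  exact int_pd i _ (zz_cs g)

/-- squared gradient -/
def gr (f : Sm n) : Sm n := ∑ i, (pd i f) ^ 2
/-- squared Hessian -/
def hs (f : Sm n) : Sm n := ∑ i, gr (pd i f)

lemma gr_nonneg (f : Sm n) (x) : 0 ≤ (gr f) x := by
  simp only [gr, Sm.sum_ap, Sm.pow_ap]
  exact Finset.sum_nonneg fun i _ => sq_nonneg _
lemma hs_nonneg (f : Sm n) (x) : 0 ≤ (hs f) x := by
  simp only [hs, Sm.sum_ap]
  exact Finset.sum_nonneg fun i _ => gr_nonneg _ _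

/-- gradient pairing -/
def gd (f g : Sm n) : Sm n := ∑ i, pd i f * pd i g

lemma gd_cs (f g : Sm n) (x) : (gd f g) x ^ 2 ≤ (gr f) x * (gr g) x := by
  simp only [gd, gr, Sm.sum_ap, Sm.mul_ap, Sm.pow_ap]
  exact Finset.sum_mul_sq_le_sq_mul_sq _ _ _

lemma gr_zz_bound : ∃ B, 1 ≤ B ∧ ∀ x ∈ KB n, (gr (zz : Sm n)) x ≤ B := by
  obtain ⟨B, hB⟩ := (KB_compact (n := n)).exists_bound_of_continuousOn
    (smcont (gr (zz : Sm n))).continuousOn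
  exact ⟨max B 1, le_max_right _ _, fun x hx => (le_abs_self _).trans
    ((hB x hx).trans (le_max_left _ _))⟩

lemma pd_zz_pow (i : Fin n) (m : ℕ) : pd i ((zz : Sm n) ^ (m + 1)) = (m + 1 : ℝ) • (zz ^ m * pd i zz) := by
  rw [Derivation.leibniz_pow]
  ext x
  simp [Sm.smul_ap, Sm.mul_ap, Sm.pow_ap]

lemma JJ_ibp (m : ℕ) (f g : Sm n) :
    JJ (zz ^ (m + 1) * gd f g) = - JJ (zz ^ (m + 1) * (f * Lap g))
      - (m + 1) * JJ (zz ^ m * (f * gd zz g)) := by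
  have h : ∑ i, JJ (pd i (zz * (zz ^ m * (f * pd i g)))) = 0 :=
    Finset.sum_eq_zero fun i _ => JJ_pd i _
  rw [← map_sum] at h
  have e : ∑ i, pd i (zz * (zz ^ m * (f * pd i g))) = zz ^ (m + 1) * gd f g
      + zz ^ (m + 1) * (f * Lap g) + (m + 1 : ℝ) • (zz ^ m * (f * gd zz g)) := by
    simp only [gd, Lap_eq, Finset.mul_sum, Finset.smul_sum, ← Finset.sum_add_distrib]
    refine Finset.sum_congr rfl fun i _ => ?_
    rw [← mul_assoc, ← pow_succ', pd_mul, pd_mul, pd_zz_pow]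
    ext x
    simp only [Sm.smul_ap, Sm.mul_ap, Sm.pow_ap, Sm.add_ap]; ring
  rw [e, map_add, map_add, map_smul, smul_eq_mul] at h
  linarith

lemma gd_self (f : Sm n) : gd f f = gr f := by
  simp only [gd, gr, sq]

lemma interp1 (c : ℕ) {ε : ℝ} (hε : 0 < ε) : ∃ C, 0 ≤ C ∧ ∀ f : Sm n,
    JJ (zz ^ (2 * c + 2) * gr f) ≤ ε * JJ (zz ^ (2 * c + 4) * (Lap f) ^ 2)
      + C * JJ (zz ^ (2 * c) * f ^ 2) := by
  obtain ⟨B, hB, hz⟩ := gr_zz_bound (n := n)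
  set q : ℝ := 2 * c + 2 with hq
  have hC : 0 ≤ 1 / ε + q ^ 2 * B := by positivity
  refine ⟨1 / ε + q ^ 2 * B, hC, fun f => ?_⟩
  have h1 := JJ_ibp (2 * c + 1) f f
  rw [gd_self] at h1
  have h2 : JJ ((1 / 2 : ℝ) • (zz ^ (2 * c + 2) * gr f) + ((ε / 2) • (zz ^ (2 * c + 4) * (Lap f) ^ 2)
      + ((1 / ε + q ^ 2 * B) / 2) • (zz ^ (2 * c) * f ^ 2)))
      ≥ JJ ((-1 : ℝ) • (zz ^ (2 * c + 1 + 1) * (f * Lap f))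
        + (-q) • (zz ^ (2 * c + 1) * (f * gd zz f))) := by
    refine JJ_mono fun x hx => ?_
    simp only [Sm.smul_ap, Sm.mul_ap, Sm.pow_ap, Sm.add_ap]
    have b1 := gd_cs zz f x
    have b2 := hz x hx
    have b3 := gr_nonneg f x
    set t := (zz : Sm n) x
    set S := (gd zz f) x
    set g := (gr f) x
    set D := (Lap f) x
    set y := f x
    have b4 : S ^ 2 ≤ B * g := b1.trans (mul_le_mul_of_nonneg_right b2 b3)
    have k1 : -(t ^ 2 * (y * D)) ≤ ε / 2 * (t ^ 4 * D ^ 2) + 1 / ε / 2 * y ^ 2 := by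
      have := sq_nonneg (ε * (t ^ 2 * D) + y)
      have e : ε / 2 * (t ^ 4 * D ^ 2) + 1 / ε / 2 * y ^ 2 + (t ^ 2 * (y * D))
        = (ε * (t ^ 2 * D) + y) ^ 2 / (2 * ε) := by field_simp; ring
      have : 0 ≤ (ε * (t ^ 2 * D) + y) ^ 2 / (2 * ε) := by positivity
      linarith
    have k2 : -(q * (t * (y * S))) ≤ 1 / 2 * (t ^ 2 * g) + q ^ 2 * B / 2 * y ^ 2 := by
      have B0 : 0 < B := by linarith
      have e : t ^ 2 * S ^ 2 / (2 * B) + q ^ 2 * B / 2 * y ^ 2 + (q * (t * (y * S)))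
        = (t * S + q * B * y) ^ 2 / (2 * B) := by field_simp; ring
      have h0 : 0 ≤ (t * S + q * B * y) ^ 2 / (2 * B) := by positivity
      have h5 : t ^ 2 * S ^ 2 / (2 * B) ≤ 1 / 2 * (t ^ 2 * g) := by
        rw [div_le_iff₀ (by positivity)]
        nlinarith [mul_le_mul_of_nonneg_left b4 (sq_nonneg t)]
      linarith
    have k3 := mul_le_mul_of_nonneg_left (add_le_add k1 k2) (sq_nonneg (t ^ c))
    calc _ = (t ^ c) ^ 2 * (-(t ^ 2 * (y * D)) + -(q * (t * (y * S)))) := by ring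
      _ ≤ _ := k3
      _ = _ := by ring
  simp only [map_add, map_smul, smul_eq_mul] at h2
  have e3 : ((2 * c + 1 : ℕ) : ℝ) + 1 = q := by push_cast; rw [hq]; ring
  rw [e3] at h1
  have e4 : 2 * c + 1 + 1 = 2 * c + 2 := by ring
  rw [e4] at h1 h2
  linarith

lemma interp2 (m : ℕ) : ∃ C, 0 ≤ C ∧ ∀ f : Sm n,
    JJ (zz ^ (2 * m + 2) * hs f) ≤ C * (JJ (zz ^ (2 * m + 2) * (Lap f) ^ 2)
      + JJ (zz ^ (2 * m) * gr f)) := by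
  obtain ⟨B, hB, hz⟩ := gr_zz_bound (n := n)
  set q : ℝ := 2 * m + 2 with hq
  have B0 : 0 < B := by linarith
  refine ⟨2 * (2 + 2 * q ^ 2 * B), by positivity, fun f => ?_⟩
  -- Hessian identity
  have h1 : JJ (zz ^ (2 * m + 1 + 1) * hs f) = - JJ (zz ^ (2 * m + 1 + 1) * gd f (Lap f))
      - q * JJ (zz ^ (2 * m + 1) * ∑ j, pd j f * gd zz (pd j f)) := by
    have := fun j => JJ_ibp (2 * m + 1) (pd j f) (pd j f)
    rw [hs, show gd f (Lap f) = ∑ j, pd j f * pd j (Lap f) from rfl, Finset.mul_sum, Finset.mul_sum,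
      Finset.mul_sum, map_sum, map_sum, map_sum, Finset.mul_sum, ← Finset.sum_neg_distrib,
      ← Finset.sum_sub_distrib]
    refine Finset.sum_congr rfl fun j _ => ?_
    have e := this j
    rw [gd_self] at e
    have e2 : Lap (pd j f) = pd j (Lap f) := by
      rw [Lap_eq, Lap_eq, map_sum]
      exact Finset.sum_congr rfl fun i _ => by rw [pd_comm i j, pd_comm i j]
    rw [e2] at e
    rw [e, hq]; push_cast; ring
  have h2 := JJ_ibp (2 * m + 1) (Lap f) f
  have e2 : gd (Lap f) f = gd f (Lap f) := by
    simp only [gd]; exact Finset.sum_congr rfl fun i _ => mul_comm _ _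
  have e3 : ((2 * m + 1 : ℕ) : ℝ) + 1 = q := by push_cast; rw [hq]; ring
  rw [e2, e3] at h2
  have h3 : JJ ((1 / 2 : ℝ) • (zz ^ (2 * m + 2) * hs f) + ((2 + 2 * q ^ 2 * B) • (zz ^ (2 * m + 2) * (Lap f) ^ 2)
      + (2 + 2 * q ^ 2 * B) • (zz ^ (2 * m) * gr f)))
      ≥ JJ (zz ^ (2 * m + 1 + 1) * (Lap f * Lap f) + q • (zz ^ (2 * m + 1) * (Lap f * gd zz f))
        + (-q) • (zz ^ (2 * m + 1) * ∑ j, pd j f * gd zz (pd j f))) := by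
    refine JJ_mono fun x hx => ?_
    simp only [Sm.smul_ap, Sm.mul_ap, Sm.pow_ap, Sm.add_ap, Sm.sum_ap]
    have b1 := gd_cs zz f x
    have b2 := hz x hx
    have b3 := gr_nonneg f x
    have b5 : (∑ j, (pd j f) x * (gd zz (pd j f)) x) ^ 2 ≤ (gr f) x * (B * (hs f) x) := by
      refine (Finset.sum_mul_sq_le_sq_mul_sq _ _ _).trans ?_
      simp only [gr, hs, Sm.sum_ap, Sm.pow_ap]
      refine mul_le_mul_of_nonneg_left ?_ (Finset.sum_nonneg fun i _ => sq_nonneg _)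
      rw [Finset.mul_sum]
      refine Finset.sum_le_sum fun j _ => (gd_cs zz (pd j f) x).trans ?_
      have := mul_le_mul_of_nonneg_right b2 (gr_nonneg (pd j f) x)
      simpa only [gr, Sm.sum_ap, Sm.pow_ap] using this
    have b6 := hs_nonneg f x
    set t := (zz : Sm n) x
    set S := (gd zz f) x
    set V := ∑ j, (pd j f) x * (gd zz (pd j f)) x
    set g := (gr f) x
    set H := (hs f) x
    set D := (Lap f) x
    have b4 : S ^ 2 ≤ B * g := b1.trans (mul_le_mul_of_nonneg_right b2 b3)
    have k1 : q * (t * (D * S)) ≤ t ^ 2 * D ^ 2 + q ^ 2 * B * g := by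
      nlinarith [sq_nonneg (2 * (t * D) - q * S), mul_le_mul_of_nonneg_left b4 (sq_nonneg q), sq_nonneg (t * D), mul_nonneg (mul_nonneg (sq_nonneg q) B0.le) b3]
    have k2 : -(q * (t * V)) ≤ 1 / 2 * (t ^ 2 * H) + q ^ 2 * B * g := by
      have hV : (q * (t * V)) ^ 2 ≤ 4 * (1 / 2 * (t ^ 2 * H)) * (q ^ 2 * B * g) := by
        nlinarith [mul_le_mul_of_nonneg_left b5 (sq_nonneg (q * t)), mul_nonneg (mul_nonneg (sq_nonneg (q*t)) B0.le) (mul_nonneg b3 b6)]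
      have p1 : 0 ≤ 1 / 2 * (t ^ 2 * H) := by positivity
      have p2 : 0 ≤ q ^ 2 * B * g := by positivity
      have h9 : (q * (t * V)) ^ 2 ≤ (1 / 2 * (t ^ 2 * H) + q ^ 2 * B * g) ^ 2 := by
        nlinarith [sq_nonneg (1 / 2 * (t ^ 2 * H) - q ^ 2 * B * g)]
      have := abs_le_of_sq_le_sq h9 (by linarith)
      linarith [(abs_le.mp this).1]
    have k4 : 0 ≤ q ^ 2 * B * (t ^ 2 * D ^ 2) := by positivity
    have k5 : 0 ≤ g * 2 := by linarith
    have k3 := mul_le_mul_of_nonneg_left (add_le_add (add_le_add k1 k2)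
      (add_le_add k4 k5)) (sq_nonneg (t ^ m))
    have k6 : 0 ≤ (t ^ m) ^ 2 * (q ^ 2 * B * (t ^ 2 * D ^ 2)) := by positivity
    calc _ = (t ^ m) ^ 2 * (q * (t * (D * S)) + -(q * (t * V)) + (0 + 0))
          + (t ^ m) ^ 2 * (t ^ 2 * D ^ 2) := by ring
      _ ≤ (t ^ m) ^ 2 * (t ^ 2 * D ^ 2 + q ^ 2 * B * g + (1 / 2 * (t ^ 2 * H) + q ^ 2 * B * g)
          + (q ^ 2 * B * (t ^ 2 * D ^ 2) + g * 2)) + (t ^ m) ^ 2 * (t ^ 2 * D ^ 2)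
          + (t ^ m) ^ 2 * (q ^ 2 * B * (t ^ 2 * D ^ 2)) := by linarith
      _ = _ := by ring
  simp only [map_add, map_smul, smul_eq_mul] at h3
  have e4 : 2 * m + 1 + 1 = 2 * m + 2 := by ring
  rw [e4] at h1 h2 h3
  linarith


lemma int_Lap' (f g : Sm n) (hg : HasCompactSupport g.1) :
    ∫ x, (∑ i, pd i f * pd i g) x = - ∫ x, (f * Lap g) x := by
  have hs : ∀ i, HasCompactSupport (f * pd i g).1 := fun i => cs_mul_right _ _ (pd_cs _ _ hg)
  have h1 := int_sum_pd (fun i => f * pd i g) hs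
  have e : (∑ i, pd i (f * pd i g)) = (∑ i, pd i f * pd i g) + f * Lap g := by
    rw [Lap_eq, Finset.mul_sum, ← Finset.sum_add_distrib]
    exact Finset.sum_congr rfl fun i _ => by rw [pd_mul]; ring
  rw [e, int_add' (cs_sum _ _ fun i => cs_mul_right _ _ (pd_cs _ _ hg))
    (cs_mul_right _ _ (Lap_cs _ hg))] at h1
  linarith

lemma int_Lap3 (f g : Sm n) (hg : HasCompactSupport g.1) :
    ∫ x, (- Lap (Lap (Lap f)) * g) x = ∫ x, (∑ i, pd i (Lap f) * pd i (Lap g)) x := by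
  have h1 := int_Lap (Lap (Lap f)) g hg
  have h2 := int_Lap' (Lap (Lap f)) g hg
  have h3 := int_Lap (Lap f) (Lap g) (Lap_cs _ hg)
  have e : ∫ x, (- Lap (Lap (Lap f)) * g) x = - ∫ x, (Lap (Lap (Lap f)) * g) x := by
    rw [← integral_neg]; congr 1; funext x; simp
  rw [e, h3]; linarith

lemma Lap_zz_pow (a : ℕ) (u : Sm n) : Lap (zz ^ (a + 2) * u) = zz ^ (a + 2) * Lap u
    + zz ^ (a + 1) * ((2 * (a + 2) : ℝ) • gd zz u + ((a + 2 : ℝ) • Lap zz) * u)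
    + zz ^ a * (((a + 2) * (a + 1) : ℝ) • gr zz * u) := by
  simp only [Lap_eq, gd, gr, Finset.mul_sum, Finset.smul_sum, Finset.sum_mul,
    ← Finset.sum_add_distrib]
  refine Finset.sum_congr rfl fun i _ => ?_
  have e1 : pd i (pd i ((zz : Sm n) ^ (a + 2))) = (a + 2 : ℝ) • (zz ^ (a + 1) * pd i (pd i zz))
      + ((a + 2) * (a + 1) : ℝ) • (zz ^ a * pd i zz ^ 2) := by
    rw [pd_zz_pow i (a + 1), Derivation.map_smul, pd_mul, pd_zz_pow]
    ext x
    simp only [Sm.smul_ap, Sm.mul_ap, Sm.pow_ap, Sm.add_ap]; push_cast; ring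
  rw [pd_mul, map_add, pd_mul, pd_mul, e1, pd_zz_pow i (a + 1)]
  ext x
  simp only [Sm.smul_ap, Sm.mul_ap, Sm.pow_ap, Sm.add_ap]; push_cast; ring

lemma comm3 (a : ℕ) (k : Fin n) : ∃ T2 T1 T0 : Sm n →ₗ[ℝ] Sm n, DO 2 T2 ∧ DO 1 T1 ∧ DO 0 T0 ∧
    ∀ u, pd k (Lap (zz ^ (a + 3) * u)) = zz ^ (a + 3) * pd k (Lap u)
      + (zz ^ (a + 2) * T2 u + zz ^ (a + 1) * T1 u + zz ^ a * T0 u) := by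
  obtain ⟨A, dA, eA⟩ : ∃ A : Sm n →ₗ[ℝ] Sm n, DO 1 A ∧ ∀ u, A u = (2 * (a + 3) : ℝ) • gd zz u
      + ((a + 3 : ℝ) • Lap zz) * u := by
    have d1 : DO 1 (∑ i, LinearMap.mulLeft ℝ (pd i zz) ∘ₗ
        (LinearMap.id ∘ₗ (pd i).toLinearMap) : Sm n →ₗ[ℝ] Sm n) :=
      DO.sum _ _ fun i => DO.mul 1 _ _ (DO.comp 0 _ i DO.id)
    have d2 : DO 1 (LinearMap.mulLeft ℝ ((a + 3 : ℝ) • Lap zz) ∘ₗ LinearMap.id : Sm n →ₗ[ℝ] Sm n) :=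
      DO.mul 1 _ _ (DO.mono 0 1 _ (by omega) DO.id)
    refine ⟨_, DO.add _ _ _ (d1.smul (2 * (a + 3) : ℝ)) d2, fun u => ?_⟩
    rw [LinearMap.add_apply, LinearMap.smul_apply, LinearMap.sum_apply]; rfl
  set c : Sm n := ((a + 3) * (a + 2) : ℝ) • gr zz with hc
  set Cc : Sm n →ₗ[ℝ] Sm n := LinearMap.mulLeft ℝ c ∘ₗ LinearMap.id with hCc
  have dC : DO 0 Cc := DO.mul _ _ _ DO.id
  have dL : DO 2 (Lap (n := n)) := by
    have := (DO.id (n := n)).Lapl; rwa [LinearMap.comp_id] at this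
  refine ⟨LinearMap.mulLeft ℝ ((a + 3 : ℝ) • pd k zz) ∘ₗ Lap + (pd k).toLinearMap ∘ₗ A,
    LinearMap.mulLeft ℝ ((a + 2 : ℝ) • pd k zz) ∘ₗ A + (pd k).toLinearMap ∘ₗ Cc,
    LinearMap.mulLeft ℝ ((a + 1 : ℝ) • pd k zz) ∘ₗ Cc,
    DO.add _ _ _ (DO.mul _ _ _ dL) (dA.pdl k), DO.add _ _ _ (DO.mul _ _ _ dA) (dC.pdl k),
    DO.mul _ _ _ dC, fun u => ?_⟩
  have eL : Lap (zz ^ (a + 3) * u) = zz ^ (a + 3) * Lap u + zz ^ (a + 2) * A u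
      + zz ^ (a + 1) * (c * u) := by
    rw [eA, hc]
    have := Lap_zz_pow (a + 1) u
    push_cast at this
    rw [show a + 1 + 2 = a + 3 by ring, show a + 1 + 1 = a + 2 by ring] at this
    rw [this]
    ext x
    simp only [Sm.smul_ap, Sm.mul_ap, Sm.pow_ap, Sm.add_ap]; ring
  rw [eL, map_add, map_add, pd_mul, pd_mul, pd_mul, pd_zz_pow k (a + 2), pd_zz_pow k (a + 1),
    pd_zz_pow k a]
  change _ = zz ^ (a + 3) * pd k (Lap u) + (zz ^ (a + 2) * (((a + 3 : ℝ) • pd k zz) * Lap u + pd k (A u))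
    + zz ^ (a + 1) * (((a + 2 : ℝ) • pd k zz) * A u + pd k (c * u))
    + zz ^ a * (((a + 1 : ℝ) • pd k zz) * (c * u)))
  ext x
  simp only [Sm.smul_ap, Sm.mul_ap, Sm.pow_ap, Sm.add_ap]; push_cast; ring

/-- lower order density -/
def Lo (a : ℕ) (u : Sm n) : Sm n :=
  zz ^ (2 * a + 4) * En 2 u + zz ^ (2 * a + 2) * En 1 u + zz ^ (2 * a) * En 0 u

lemma comb3 (a : ℕ) {T2 T1 T0 : Sm n →ₗ[ℝ] Sm n} (h2 : DO 2 T2) (h1 : DO 1 T1) (h0 : DO 0 T0) :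
    ∃ C, 0 ≤ C ∧ ∀ (u : Sm n), ∀ x ∈ KB n,
      (zz ^ (a + 2) * T2 u + zz ^ (a + 1) * T1 u + zz ^ a * T0 u : Sm n) x ^ 2 ≤ C * (Lo a u) x := by
  obtain ⟨C2, p2, b2⟩ := h2.bound (KB_compact (n := n))
  obtain ⟨C1, p1, b1⟩ := h1.bound (KB_compact (n := n))
  obtain ⟨C0, p0, b0⟩ := h0.bound (KB_compact (n := n))
  refine ⟨3 * (C2 + C1 + C0), by positivity, fun u x hx => ?_⟩
  simp only [Lo, Sm.mul_ap, Sm.pow_ap, Sm.add_ap]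
  have e2 := b2 u x hx
  have e1 := b1 u x hx
  have e0 := b0 u x hx
  have n2 := En_nonneg 2 u x
  have n1 := En_nonneg 1 u x
  have n0 := En_nonneg 0 u x
  set t := (zz : Sm n) x
  set A := (T2 u) x
  set B := (T1 u) x
  set D := (T0 u) x
  have q2 : (t ^ (a + 2) * A) ^ 2 ≤ C2 * (t ^ (2 * a + 4) * (En 2 u) x) := by
    calc _ = (t ^ (a + 2)) ^ 2 * A ^ 2 := by ring
      _ ≤ (t ^ (a + 2)) ^ 2 * (C2 * (En 2 u) x) := mul_le_mul_of_nonneg_left e2 (sq_nonneg _)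
      _ = _ := by ring
  have q1 : (t ^ (a + 1) * B) ^ 2 ≤ C1 * (t ^ (2 * a + 2) * (En 1 u) x) := by
    calc _ = (t ^ (a + 1)) ^ 2 * B ^ 2 := by ring
      _ ≤ (t ^ (a + 1)) ^ 2 * (C1 * (En 1 u) x) := mul_le_mul_of_nonneg_left e1 (sq_nonneg _)
      _ = _ := by ring
  have q0 : (t ^ a * D) ^ 2 ≤ C0 * (t ^ (2 * a) * (En 0 u) x) := by
    calc _ = (t ^ a) ^ 2 * D ^ 2 := by ring
      _ ≤ (t ^ a) ^ 2 * (C0 * (En 0 u) x) := mul_le_mul_of_nonneg_left e0 (sq_nonneg _)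
      _ = _ := by ring
  have r2 : 0 ≤ t ^ (2 * a + 4) * (En 2 u) x := by
    have : t ^ (2 * a + 4) = (t ^ (a + 2)) ^ 2 := by ring
    rw [this]; positivity
  have r1 : 0 ≤ t ^ (2 * a + 2) * (En 1 u) x := by
    have : t ^ (2 * a + 2) = (t ^ (a + 1)) ^ 2 := by ring
    rw [this]; positivity
  have r0 : 0 ≤ t ^ (2 * a) * (En 0 u) x := by
    have : t ^ (2 * a) = (t ^ a) ^ 2 := by ring
    rw [this]; positivity
  set X := t ^ (a + 2) * A
  set Y := t ^ (a + 1) * B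
  set Z := t ^ a * D
  set E2 := t ^ (2 * a + 4) * (En 2 u) x
  set E1 := t ^ (2 * a + 2) * (En 1 u) x
  set E0 := t ^ (2 * a) * (En 0 u) x
  have s1 : (X + Y + Z) ^ 2 ≤ 3 * (X ^ 2 + Y ^ 2 + Z ^ 2) := by
    nlinarith [sq_nonneg (X - Y), sq_nonneg (X - Z), sq_nonneg (Y - Z)]
  nlinarith [mul_nonneg p2 r1, mul_nonneg p2 r0, mul_nonneg p1 r2, mul_nonneg p1 r0,
    mul_nonneg p0 r2, mul_nonneg p0 r1]

/-- commutator, first kind -/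
lemma comA (a : ℕ) : ∃ C, 0 ≤ C ∧ ∀ u : Sm n, ∃ r : Fin n → Sm n,
    (∀ k, pd k (Lap (zz ^ (a + 3) * u)) = zz ^ (a + 3) * pd k (Lap u) + r k) ∧
    ∀ x ∈ KB n, ∑ k, (r k) x ^ 2 ≤ C * (Lo a u) x := by
  choose T2 T1 T0 d2 d1 d0 hT using fun k : Fin n => comm3 a k
  choose C pC hC using fun k => comb3 a (d2 k) (d1 k) (d0 k)
  refine ⟨∑ k, C k, Finset.sum_nonneg fun k _ => pC k, fun u =>
    ⟨fun k => zz ^ (a + 2) * T2 k u + zz ^ (a + 1) * T1 k u + zz ^ a * T0 k u,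
      fun k => hT k u, fun x hx => ?_⟩⟩
  rw [Finset.sum_mul]
  exact Finset.sum_le_sum fun k _ => hC k u x hx

/-- commutator, second kind -/
lemma comB (a : ℕ) : ∃ C, 0 ≤ C ∧ ∀ u : Sm n, ∃ r : Fin n → Sm n,
    (∀ k, pd k (Lap (zz ^ (2 * a + 6) * u)) = zz ^ (a + 3) * (zz ^ (a + 3) * pd k (Lap u) + r k)) ∧
    ∀ x ∈ KB n, ∑ k, (r k) x ^ 2 ≤ C * (Lo a u) x := by
  choose T2 T1 T0 d2 d1 d0 hT using fun k : Fin n => comm3 (2 * a + 3) k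
  choose C pC hC using fun k => comb3 a (d2 k) (d1 k) (d0 k)
  refine ⟨∑ k, C k, Finset.sum_nonneg fun k _ => pC k, fun u =>
    ⟨fun k => zz ^ (a + 2) * T2 k u + zz ^ (a + 1) * T1 k u + zz ^ a * T0 k u,
      fun k => ?_, fun x hx => ?_⟩⟩
  · have := hT k u
    rw [show 2 * a + 3 + 3 = 2 * a + 6 by ring] at this
    rw [this]; ring
  · rw [Finset.sum_mul]
    exact Finset.sum_le_sum fun k _ => hC k u x hx

lemma JJ_pow (m : ℕ) (g : Sm n) : JJ (zz ^ (m + 1) * g) = ∫ x, (zz ^ (m + 1) * g : Sm n) x := by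
  rw [pow_succ', mul_assoc]; exact JJ_zz _

lemma zz_pow_cs (m : ℕ) (g : Sm n) : HasCompactSupport (zz ^ (m + 1) * g : Sm n).1 := by
  rw [pow_succ', mul_assoc]; exact zz_cs _

lemma energy (p : ℝ) (hp : 1 < p) (a : ℕ) : ∃ C, 0 ≤ C ∧ ∀ u w : Sm n, Sol p u w →
    JJ (zz ^ (2 * a + 6) * gr (Lap u)) + JJ (zz ^ (2 * a + 6) * (w * u)) ≤ C * JJ (Lo a u) := by
  obtain ⟨CA, pA, hA⟩ := comA (n := n) a
  obtain ⟨CB, pB, hB⟩ := comB (n := n) a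
  have hp0 : 0 < p - 1 := by linarith
  set K1 : ℝ := (4 / (p - 1) + 1) * CA + p ^ 2 / (p - 1) * CB with hK1
  have K1p : 0 ≤ K1 := by positivity
  refine ⟨5 / 2 * (2 / (p - 1) * K1) + CB, by positivity, fun u w S => ?_⟩
  obtain ⟨r, er, br⟩ := hA u
  obtain ⟨s, es, bs⟩ := hB u
  set Y : Fin n → Sm n := fun k => zz ^ (a + 3) * pd k (Lap u) with hY
  -- the energy A
  have eA : zz ^ (2 * a + 6) * gr (Lap u) = ∑ k, Y k ^ 2 := by
    rw [gr, Finset.mul_sum]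
    exact Finset.sum_congr rfl fun k _ => by rw [hY]; ring
  -- the equation
  have eP : JJ (zz ^ (2 * a + 6) * (w * u)) = JJ (∑ k, Y k * (Y k + s k)) := by
    have h := int_Lap3 u (zz ^ (2 * a + 6) * u) (zz_pow_cs (2 * a + 5) u)
    have e1 : - Lap (Lap (Lap u)) * (zz ^ (2 * a + 6) * u) = zz ^ (2 * a + 5 + 1) * (w * u) := by
      rw [S.hw]; ring
    have e2 : ∑ i, pd i (Lap u) * pd i (Lap (zz ^ (2 * a + 6) * u)) = ∑ k, Y k * (Y k + s k) := by
      refine Finset.sum_congr rfl fun k _ => ?_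
      rw [es k, hY]; ring
    have e3 : ∑ k, Y k * (Y k + s k) = zz ^ (0 + 1) * ∑ k, zz ^ (a + 2) * pd k (Lap u) * (Y k + s k) := by
      rw [Finset.mul_sum]
      refine Finset.sum_congr rfl fun k _ => ?_
      rw [hY]; ring
    rw [e1, e2, e3] at h
    rw [e3, JJ_pow 0, ← h, ← JJ_pow]
  -- stability
  have eS : p * JJ (zz ^ (2 * a + 6) * (w * u)) ≤ JJ (∑ k, (Y k + r k) ^ 2) := by
    have h := S.stab (zz ^ (a + 3) * u) (zz_pow_cs (a + 2) u)
    rw [int_Lap3 _ _ (zz_pow_cs (a + 2) u)] at h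
    have e1 : ∫ x, |u x| ^ (p - 1) * (zz ^ (a + 3) * u : Sm n) x ^ 2
        = JJ (zz ^ (2 * a + 6) * (w * u)) := by
      rw [show 2 * a + 6 = (2 * a + 5) + 1 by ring, JJ_pow]
      congr 1; funext x
      rw [Sm.mul_ap, Sm.mul_ap _ (w * u), S.wu, Sm.pow_ap, Sm.pow_ap]; ring
    have e2 : ∑ i, pd i (Lap (zz ^ (a + 3) * u)) * pd i (Lap (zz ^ (a + 3) * u))
        = ∑ k, (Y k + r k) ^ 2 := by
      refine Finset.sum_congr rfl fun k _ => ?_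
      rw [er k, hY]; ring
    rw [e1, e2] at h
    rw [JJ_of_van (f := ∑ k, (Y k + r k) ^ 2)]
    · exact h
    · intro x hx
      rw [Sm.sum_ap]
      refine Finset.sum_eq_zero fun k _ => ?_
      have hv : ∀ x ∈ {x : EuclideanSpace ℝ (Fin n) | 4 < (r2 : Sm n) x},
          (zz ^ (a + 3) * u : Sm n) x = 0 := by
        intro x hx
        have e5 : zz ^ (a + 3) * u = zz * (zz ^ (a + 2) * u) := by ring
        rw [e5]; exact zz_van _ x hx
      have hl : ∀ x ∈ {x : EuclideanSpace ℝ (Fin n) | 4 < (r2 : Sm n) x},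
          (Lap (zz ^ (a + 3) * u)) x = 0 := by
        intro x hx
        rw [Lap_eq, Sm.sum_ap]
        exact Finset.sum_eq_zero fun i _ => pd_van i op4 (pd_van i op4 hv) x hx
      have := pd_van k op4 hl x hx
      rw [er k] at this
      rw [Sm.pow_ap, hY, this]; ring
  have b1 : JJ (∑ k, (Y k + r k) ^ 2) ≤ JJ (((p + 1) / 2) • ∑ k, Y k ^ 2
      + p • (∑ k, Y k * (Y k + s k) - ∑ k, Y k ^ 2) + K1 • Lo a u) := by
    refine JJ_mono fun x hx => ?_
    have hr := br x hx
    have hs := bs x hx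
    simp only [Sm.smul_ap, Sm.add_ap, Sm.sub_ap, Sm.sum_ap, Sm.pow_ap, Sm.mul_ap]
    have h9 : ∑ k, ((Y k) x + (r k) x) ^ 2 ≤ (p + 1) / 2 * ∑ k, (Y k) x ^ 2
        + p * (∑ k, (Y k) x * ((Y k) x + (s k) x) - ∑ k, (Y k) x ^ 2)
        + ((4 / (p - 1) + 1) * ∑ k, (r k) x ^ 2 + p ^ 2 / (p - 1) * ∑ k, (s k) x ^ 2) := by
      rw [← Finset.sum_sub_distrib]
      simp only [Finset.mul_sum, ← Finset.sum_add_distrib]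
      refine Finset.sum_le_sum fun k _ => ?_
      set y := (Y k) x
      set ρ := (r k) x
      set σ := (s k) x
      have f1 : 2 * y * ρ ≤ (p - 1) / 4 * y ^ 2 + 4 / (p - 1) * ρ ^ 2 := by
        have : (p - 1) / 4 * y ^ 2 + 4 / (p - 1) * ρ ^ 2 - 2 * y * ρ
          = ((p - 1) * y - 4 * ρ) ^ 2 / (4 * (p - 1)) := by field_simp; ring
        have : 0 ≤ ((p - 1) * y - 4 * ρ) ^ 2 / (4 * (p - 1)) := by positivity
        linarith
      have f2 : -(p * y * σ) ≤ (p - 1) / 4 * y ^ 2 + p ^ 2 / (p - 1) * σ ^ 2 := by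
        have : (p - 1) / 4 * y ^ 2 + p ^ 2 / (p - 1) * σ ^ 2 + p * y * σ
          = ((p - 1) * y + 2 * p * σ) ^ 2 / (4 * (p - 1)) := by field_simp; ring
        have : 0 ≤ ((p - 1) * y + 2 * p * σ) ^ 2 / (4 * (p - 1)) := by positivity
        linarith
      nlinarith
    have g1 := mul_le_mul_of_nonneg_left hr (show 0 ≤ 4 / (p - 1) + 1 by positivity)
    have g2 := mul_le_mul_of_nonneg_left hs (show 0 ≤ p ^ 2 / (p - 1) by positivity)
    rw [hK1]
    linarith
  have b2 : JJ (∑ k, Y k * (Y k + s k)) ≤ JJ ((3 / 2 : ℝ) • ∑ k, Y k ^ 2 + CB • Lo a u) := by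
    refine JJ_mono fun x hx => ?_
    have hs := bs x hx
    simp only [Sm.smul_ap, Sm.add_ap, Sm.sub_ap, Sm.sum_ap, Sm.pow_ap, Sm.mul_ap]
    have h9 : ∑ k, (Y k) x * ((Y k) x + (s k) x) ≤ 3 / 2 * ∑ k, (Y k) x ^ 2 + ∑ k, (s k) x ^ 2 := by
      simp only [Finset.mul_sum, ← Finset.sum_add_distrib]
      refine Finset.sum_le_sum fun k _ => ?_
      nlinarith [sq_nonneg ((Y k) x - (s k) x), sq_nonneg ((s k) x)]
    linarith
  simp only [map_add, map_sub, map_smul, smul_eq_mul] at b1 b2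
  rw [eP] at eS ⊢
  rw [eA]
  have hA1 : (p - 1) / 2 * JJ (∑ k, Y k ^ 2) ≤ K1 * JJ (Lo a u) := by linarith
  have hA2 : JJ (∑ k, Y k ^ 2) ≤ 2 / (p - 1) * K1 * JJ (Lo a u) := by
    calc JJ (∑ k, Y k ^ 2) = 2 / (p - 1) * ((p - 1) / 2 * JJ (∑ k, Y k ^ 2)) := by field_simp
      _ ≤ 2 / (p - 1) * (K1 * JJ (Lo a u)) := mul_le_mul_of_nonneg_left hA1 (by positivity)
      _ = _ := by ring
  linarith


lemma En1_eq (u : Sm n) : En 1 u = u ^ 2 + gr u := rfl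
lemma En2_eq (u : Sm n) : En 2 u = u ^ 2 + (gr u + hs u) := by
  change u ^ 2 + ∑ i, En 1 (pd i u) = _
  simp only [En1_eq, Finset.sum_add_distrib, hs]; rfl
lemma En3_eq (u : Sm n) : En 3 u = u ^ 2 + (gr u + (hs u + ∑ i, hs (pd i u))) := by
  change u ^ 2 + ∑ i, En 2 (pd i u) = _
  simp only [En2_eq, Finset.sum_add_distrib, hs]; rfl

lemma Lap_pd (j : Fin n) (f : Sm n) : Lap (pd j f) = pd j (Lap f) := by
  rw [Lap_eq, Lap_eq, map_sum]
  exact Finset.sum_congr rfl fun i _ => by rw [pd_comm i j, pd_comm i j]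

lemma Lap_sq_le (u : Sm n) (x) : (Lap u) x ^ 2 ≤ n * (hs u) x := by
  rw [Lap_eq, Sm.sum_ap, hs, Sm.sum_ap]
  have h := sq_sum_le_card_mul_sum_sq (s := Finset.univ) (f := fun i => (pd i (pd i u)) x)
  rw [Finset.card_univ, Fintype.card_fin] at h
  refine h.trans (mul_le_mul_of_nonneg_left (Finset.sum_le_sum fun i _ => ?_) (Nat.cast_nonneg n))
  rw [gr, Sm.sum_ap]
  have := Finset.single_le_sum (f := fun j => ((pd j (pd i u)) ^ 2 : Sm n) x)
    (fun j (_ : j ∈ Finset.univ) => sq_nonneg ((pd j (pd i u)) x)) (Finset.mem_univ i)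
  exact this

lemma zz_pow_le {m m' : ℕ} (h : m ≤ m') (x : EuclideanSpace ℝ (Fin n)) :
    (zz : Sm n) x ^ m' ≤ (zz : Sm n) x ^ m :=
  pow_le_pow_of_le_one (zz_nonneg x) (zz_le_one x) h

lemma young (p : ℝ) (hp : 1 < p) {a : ℕ} (ha : 12 / (p - 1) ≤ 2 * a) {δ : ℝ} (hδ : 0 < δ) :
    ∃ C, 0 ≤ C ∧ ∀ z s : ℝ, 0 ≤ z → z ≤ 1 → 0 ≤ s →
      z ^ (2 * a) * s ^ 2 ≤ δ * (z ^ (2 * a + 6) * (s ^ (p - 1) * s ^ 2)) + C := by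
  have hp0 : 0 < p - 1 := by linarith
  refine ⟨(1 / δ) ^ (2 / (p - 1)), by positivity, fun z s z0 z1 s0 => ?_⟩
  by_cases h : 1 / δ ≤ z ^ 6 * s ^ (p - 1)
  · have h1 : 1 ≤ δ * (z ^ 6 * s ^ (p - 1)) := by
      rw [div_le_iff₀ hδ] at h; linarith
    have h2 := mul_le_mul_of_nonneg_left h1 (show 0 ≤ z ^ (2 * a) * s ^ 2 by positivity)
    have h3 : (0 : ℝ) ≤ (1 / δ) ^ (2 / (p - 1)) := by positivity
    calc _ ≤ z ^ (2 * a) * s ^ 2 * (δ * (z ^ 6 * s ^ (p - 1))) := by linarith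
      _ = δ * (z ^ (2 * a + 6) * (s ^ (p - 1) * s ^ 2)) := by ring
      _ ≤ _ := by linarith
  · push Not at h
    have h1 : (z ^ 6 * s ^ (p - 1)) ^ (2 / (p - 1)) ≤ (1 / δ) ^ (2 / (p - 1)) :=
      Real.rpow_le_rpow (by positivity) h.le (by positivity)
    have h2 : (z ^ 6 * s ^ (p - 1)) ^ (2 / (p - 1)) = z ^ (12 / (p - 1)) * s ^ 2 := by
      rw [Real.mul_rpow (by positivity) (by positivity), ← Real.rpow_mul s0,
        ← Real.rpow_natCast z 6, ← Real.rpow_mul z0]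
      rw [show (p - 1) * (2 / (p - 1)) = 2 by field_simp, Real.rpow_two]
      congr 2; push_cast; ring
    have h3 : z ^ (2 * a) ≤ z ^ (12 / (p - 1)) := by
      rw [← Real.rpow_natCast z (2 * a)]
      rcases eq_or_lt_of_le z0 with h0 | h0
      · rw [← h0]
        have h12 : 0 < 12 / (p - 1) := by positivity
        rw [Real.zero_rpow (by push_cast; linarith), Real.zero_rpow h12.ne']
      · exact Real.rpow_le_rpow_of_exponent_ge h0 z1 (by push_cast; exact ha)
    have h4 := mul_le_mul_of_nonneg_right h3 (sq_nonneg s)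
    have h5 : 0 ≤ δ * (z ^ (2 * a + 6) * (s ^ (p - 1) * s ^ 2)) := by positivity
    linarith

set_option maxHeartbeats 2000000 in
lemma local_bound (p : ℝ) (hp : 1 < p) : ∃ N : ℕ, ∃ C : ℝ, ∀ u w : Sm n, Sol p u w →
    JJ (zz ^ N * (En 3 u + w * u)) ≤ C := by
  obtain ⟨a, ha⟩ := exists_nat_ge (12 / (p - 1))
  have ha2 : 12 / (p - 1) ≤ 2 * a := by
    have : (0 : ℝ) ≤ a := Nat.cast_nonneg a
    linarith
  obtain ⟨C0, p0, h0⟩ := energy (n := n) p hp a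
  set ε : ℝ := 1 / (12 * (C0 + 1)) with hε
  have εp : 0 < ε := by positivity
  obtain ⟨C1, p1, h1⟩ := interp1 (n := n) (a + 1) εp
  set ε' : ℝ := 1 / (2 * (n + 1) * (C1 + 1)) with hε'
  have εp' : 0 < ε' := by positivity
  obtain ⟨C2, p2, h2⟩ := interp1 (n := n) a εp'
  obtain ⟨C3, p3, h3⟩ := interp2 (n := n) (a + 2)
  set K : ℝ := 4 * C1 * C2 + 2 * C2 + 3 with hK
  have Kp : 0 ≤ K := by positivity
  set δ : ℝ := 1 / (2 * (C0 * K + 1)) with hδ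
  have δp : 0 < δ := by positivity
  obtain ⟨C4, p4, h4⟩ := young p hp ha2 δp
  set Q : ℝ := C4 * JJ (1 : Sm n) with hQ
  set X : ℝ := 2 * (C0 * K * Q) with hX
  have q1 : C0 * ε ≤ 1 / 12 := by
    rw [hε, mul_one_div, div_le_div_iff₀ (by positivity) (by norm_num)]; linarith
  have q2 : ε' * n * C1 ≤ 1 / 2 := by
    rw [hε', one_div_mul_eq_div, div_mul_eq_mul_div, div_le_div_iff₀ (by positivity) (by norm_num)]
    have : (0 : ℝ) ≤ n := Nat.cast_nonneg n
    nlinarith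
  have q3 : ε' * n ≤ 1 / 2 := by
    rw [hε', one_div_mul_eq_div, div_le_div_iff₀ (by positivity) (by norm_num)]
    have : (0 : ℝ) ≤ n := Nat.cast_nonneg n
    nlinarith
  have q4 : C0 * K * δ ≤ 1 / 2 := by
    rw [hδ, mul_one_div, div_le_div_iff₀ (by positivity) (by norm_num)]
    linarith
  refine ⟨2 * a + 6, (δ * X + Q) + ((2 * X + 2 * C1 * C2 * (δ * X + Q)) + C2 * (δ * X + Q))
    + (2 * X + 2 * C1 * C2 * (δ * X + Q))
    + C3 * (X + (2 * X + 2 * C1 * C2 * (δ * X + Q))) + X, fun u w S => ?_⟩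
  set A := JJ (zz ^ (2 * a + 6) * gr (Lap u)) with hA
  set P := JJ (zz ^ (2 * a + 6) * (w * u)) with hP
  set j0 := JJ (zz ^ (2 * a) * u ^ 2) with hj0
  set j1 := JJ (zz ^ (2 * a + 2) * gr u) with hj1
  set j2 := JJ (zz ^ (2 * a + 4) * hs u) with hj2
  set H := JJ (zz ^ (2 * a + 6) * ∑ k, hs (pd k u)) with hH
  have zp : ∀ (m : ℕ) (x : EuclideanSpace ℝ (Fin n)), 0 ≤ (zz : Sm n) x ^ m :=
    fun m x => pow_nonneg (zz_nonneg x) m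
  have nA : 0 ≤ A := JJ_nonneg fun x _ => mul_nonneg (zp _ x) (gr_nonneg _ x)
  have nP : 0 ≤ P := JJ_nonneg fun x _ => mul_nonneg (zp _ x) (S.wu_nn x)
  have n0 : 0 ≤ j0 := JJ_nonneg fun x _ => mul_nonneg (zp _ x) (sq_nonneg _)
  have n1 : 0 ≤ j1 := JJ_nonneg fun x _ => mul_nonneg (zp _ x) (gr_nonneg _ x)
  have n2 : 0 ≤ j2 := JJ_nonneg fun x _ => mul_nonneg (zp _ x) (hs_nonneg _ x)
  -- interpolation for the Hessian
  have i2 : j2 ≤ ε * A + C1 * j1 := by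
    have := Finset.sum_le_sum fun j (_ : j ∈ Finset.univ) => h1 (pd j u)
    rw [Finset.sum_add_distrib, ← Finset.mul_sum, ← Finset.mul_sum, ← map_sum, ← map_sum, ← map_sum,
      ← Finset.mul_sum, ← Finset.mul_sum, ← Finset.mul_sum] at this
    simp only [Lap_pd] at this
    rw [show 2 * (a + 1) + 2 = 2 * a + 4 by ring, show 2 * (a + 1) + 4 = 2 * a + 6 by ring,
      show 2 * (a + 1) = 2 * a + 2 by ring] at this
    exact this
  have i1 : j1 ≤ ε' * n * j2 + C2 * j0 := by
    have h5 := h2 u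
    have h6 : JJ (zz ^ (2 * a + 4) * (Lap u) ^ 2) ≤ JJ ((n : ℝ) • (zz ^ (2 * a + 4) * hs u)) := by
      refine JJ_mono fun x _ => ?_
      simp only [Sm.smul_ap, Sm.mul_ap, Sm.pow_ap]
      have := mul_le_mul_of_nonneg_left (Lap_sq_le u x) (zp (2 * a + 4) x)
      linarith
    rw [map_smul, smul_eq_mul] at h6
    have h7 := mul_le_mul_of_nonneg_left h6 εp'.le
    calc j1 ≤ _ := h5
      _ ≤ ε' * (n * j2) + C2 * j0 := by linarith
      _ = _ := by ring
  have iL : JJ (Lo a u) ≤ j2 + 2 * j1 + 3 * j0 := by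
    have : JJ (Lo a u) ≤ JJ (zz ^ (2 * a + 4) * hs u + (2 : ℝ) • (zz ^ (2 * a + 2) * gr u)
        + (3 : ℝ) • (zz ^ (2 * a) * u ^ 2)) := by
      refine JJ_mono fun x _ => ?_
      rw [Lo, En2_eq, En1_eq]
      simp only [En, Sm.smul_ap, Sm.mul_ap, Sm.pow_ap, Sm.add_ap]
      have y1 := mul_le_mul_of_nonneg_right (zz_pow_le (show 2 * a + 2 ≤ 2 * a + 4 by omega) x)
        (gr_nonneg u x)
      have y2 := mul_le_mul_of_nonneg_right (zz_pow_le (show 2 * a ≤ 2 * a + 4 by omega) x)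
        (sq_nonneg (u x))
      have y3 := mul_le_mul_of_nonneg_right (zz_pow_le (show 2 * a ≤ 2 * a + 2 by omega) x)
        (sq_nonneg (u x))
      linarith
    simpa only [map_add, map_smul, smul_eq_mul] using this
  have i0 : j0 ≤ δ * P + Q := by
    have : j0 ≤ JJ (δ • (zz ^ (2 * a + 6) * (w * u)) + C4 • (1 : Sm n)) := by
      refine JJ_mono fun x _ => ?_
      have := h4 ((zz : Sm n) x) |u x| (zz_nonneg x) (zz_le_one x) (abs_nonneg _)
      rw [sq_abs] at this
      rw [Sm.add_ap, Sm.smul_ap, Sm.smul_ap, Sm.mul_ap, Sm.mul_ap _ (w * u), S.wu]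
      simp only [Sm.pow_ap, Sm.one_ap, mul_one]
      exact this
    simpa only [map_add, map_smul, smul_eq_mul] using this
  have i3 : H ≤ C3 * (A + j2) := by
    have := Finset.sum_le_sum fun j (_ : j ∈ Finset.univ) => h3 (pd j u)
    rw [← Finset.mul_sum, Finset.sum_add_distrib, ← map_sum, ← map_sum, ← map_sum,
      ← Finset.mul_sum, ← Finset.mul_sum, ← Finset.mul_sum] at this
    simp only [Lap_pd] at this
    rw [show 2 * (a + 2) + 2 = 2 * a + 6 by ring, show 2 * (a + 2) = 2 * a + 4 by ring] at this
    exact this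
  have i4 := h0 u w S
  have k1 : C1 * j1 ≤ 1 / 2 * j2 + C1 * C2 * j0 := by
    have := mul_le_mul_of_nonneg_left i1 p1
    have := mul_le_mul_of_nonneg_right q2 n2
    linarith
  have k2 : j2 ≤ 2 * ε * A + 2 * C1 * C2 * j0 := by linarith
  have k3 : j1 ≤ j2 + C2 * j0 := by
    have := mul_le_mul_of_nonneg_right q3 n2
    linarith
  have k4 : j1 ≤ 1 / 2 * j2 + C2 * j0 := by
    have := mul_le_mul_of_nonneg_right q3 n2
    linarith
  have k5 : JJ (Lo a u) ≤ 4 * ε * A + K * j0 := by rw [hK]; linarith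
  have k6 : A + P ≤ 4 * (C0 * ε) * A + C0 * K * j0 := by
    have := mul_le_mul_of_nonneg_left k5 p0
    linarith
  have k7 : 4 * (C0 * ε) * A ≤ 1 / 2 * A := by nlinarith
  have k8 : C0 * K * j0 ≤ 1 / 2 * P + C0 * K * Q := by
    have := mul_le_mul_of_nonneg_left i0 (mul_nonneg p0 Kp)
    have := mul_le_mul_of_nonneg_right q4 nP
    linarith
  have k9 : A + P ≤ X := by rw [hX]; linarith
  have l0 : j0 ≤ δ * X + Q := by
    have := mul_le_mul_of_nonneg_left (show P ≤ X by linarith) δp.le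
    linarith
  have ε1 : ε ≤ 1 := by
    rw [hε, div_le_one (by positivity)]; linarith
  have l2 : j2 ≤ 2 * X + 2 * C1 * C2 * (δ * X + Q) := by
    have m1 : ε * A ≤ 1 * X := mul_le_mul ε1 (by linarith) nA zero_le_one
    have m2 := mul_le_mul_of_nonneg_left l0 (mul_nonneg p1 p2)
    linarith
  have l1 : j1 ≤ (2 * X + 2 * C1 * C2 * (δ * X + Q)) + C2 * (δ * X + Q) := by
    have m2 := mul_le_mul_of_nonneg_left l0 p2
    linarith
  have l3 : H ≤ C3 * (X + (2 * X + 2 * C1 * C2 * (δ * X + Q))) :=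
    i3.trans (mul_le_mul_of_nonneg_left (by linarith) p3)
  have fin : JJ (zz ^ (2 * a + 6) * (En 3 u + w * u)) ≤ j0 + j1 + j2 + H + P := by
    have : JJ (zz ^ (2 * a + 6) * (En 3 u + w * u)) ≤ JJ (zz ^ (2 * a) * u ^ 2
        + zz ^ (2 * a + 2) * gr u + zz ^ (2 * a + 4) * hs u + zz ^ (2 * a + 6) * ∑ k, hs (pd k u)
        + zz ^ (2 * a + 6) * (w * u)) := by
      refine JJ_mono fun x _ => ?_
      rw [En3_eq]
      simp only [Sm.smul_ap, Sm.mul_ap, Sm.pow_ap, Sm.add_ap]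
      have y1 := mul_le_mul_of_nonneg_right (zz_pow_le (show 2 * a + 2 ≤ 2 * a + 6 by omega) x)
        (gr_nonneg u x)
      have y2 := mul_le_mul_of_nonneg_right (zz_pow_le (show 2 * a ≤ 2 * a + 6 by omega) x)
        (sq_nonneg (u x))
      have y3 := mul_le_mul_of_nonneg_right (zz_pow_le (show 2 * a + 4 ≤ 2 * a + 6 by omega) x)
        (hs_nonneg u x)
      linarith
    simpa only [map_add] using this
  linarith


/-! ### Comparison of the energy density with derivatives -/

lemma DO.Aol {d : ℕ} {T : Sm n →ₗ[ℝ] Sm n} (k : ℝ) (h : DO d T) : DO (d + 1) (Ao k ∘ₗ T) := by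
  obtain ⟨T', hT', e⟩ := h.Eul
  have : Ao k ∘ₗ T = T' + k • T := by
    ext1 v
    rw [LinearMap.add_apply, LinearMap.smul_apply, LinearMap.comp_apply, Ao_eq, e]
  rw [this]
  exact DO.add _ _ _ hT' (DO.mono _ _ _ (by omega) (h.smul k))

lemma DO.Zol {d : ℕ} {T : Sm n →ₗ[ℝ] Sm n} (h : DO d T) : DO (d + 2) (Zo ∘ₗ T) := by
  obtain ⟨T', hT', e⟩ := h.Eul
  obtain ⟨T'', hT'', e'⟩ := hT'.Eul
  have d1 : DO (d + 2) (LinearMap.mulLeft ℝ (-r2 : Sm n) ∘ₗ (Lap ∘ₗ T)) := DO.mul _ _ _ h.Lapl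
  have d2 : DO (d + 2) (((n : ℝ) - 2) • T') := DO.mono (d + 1) (d + 2) _ (by omega) (hT'.smul _)
  have d3 := DO.add (d + 2) _ _ (DO.add (d + 2) _ _ d1 hT'') d2
  have : Zo ∘ₗ T = LinearMap.mulLeft ℝ (-r2 : Sm n) ∘ₗ (Lap ∘ₗ T) + T'' + ((n : ℝ) - 2) • T' := by
    refine LinearMap.ext fun v => ?_
    have e1 : (LinearMap.mulLeft ℝ (-r2 : Sm n) ∘ₗ (Lap ∘ₗ T)) v = -(r2 * Lap (T v)) := by
      rw [LinearMap.comp_apply, LinearMap.comp_apply, LinearMap.mulLeft_apply]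
      ext x; simp only [Sm.mul_ap, Sm.neg_ap, neg_mul]
    rw [LinearMap.add_apply, LinearMap.add_apply, LinearMap.smul_apply, e1,
      LinearMap.comp_apply, Zo_eq, e', e]
  rw [this]
  exact d3

lemma DO.Aopow (k : ℝ) (l : ℕ) : DO l (Ao k ^ l : Sm n →ₗ[ℝ] Sm n) := by
  induction l with
  | zero => exact DO.id
  | succ l ih => rw [pow_succ']; exact ih.Aol k

lemma Ga_le (f : Sm n) {x} (hx : x ∈ KB n) : (Ga f f) x ≤ 6 * ∑ i, (pd i f) x ^ 2 := by
  have h : (r2 : Sm n) x ≤ 6 := hx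
  simp only [Ga, Sm.sub_ap, Sm.mul_ap, Sm.sum_ap]
  have e0 : ∀ a : ℝ, a * a = a ^ 2 := fun a => (sq a).symm
  simp only [e0]
  have := mul_le_mul_of_nonneg_right h
    (Finset.sum_nonneg fun i (_ : i ∈ Finset.univ) => sq_nonneg ((pd i f) x))
  have := sq_nonneg ((Eu f) x)
  linarith

lemma DO.Ga {d : ℕ} {T : Sm n →ₗ[ℝ] Sm n} (h : DO d T) :
    ∃ C, 0 ≤ C ∧ ∀ (v : Sm n), ∀ x ∈ KB n, (Ga (T v) (T v)) x ≤ C * (En (d + 1) v) x := by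
  choose C pC hC using fun i => (h.pdl i).bound (KB_compact (n := n))
  refine ⟨6 * ∑ i, C i, mul_nonneg (by norm_num) (Finset.sum_nonneg fun i _ => pC i), fun v x hx => ?_⟩
  refine (Ga_le _ hx).trans ?_
  rw [mul_assoc, Finset.sum_mul]
  exact mul_le_mul_of_nonneg_left (Finset.sum_le_sum fun i _ => hC i v x hx) (by norm_num)

lemma ed_bound {d : ℕ} {T : Sm n →ₗ[ℝ] Sm n} (h : DO d T) (j : ℕ) (hj : d + j ≤ 3) :
    ∃ C, 0 ≤ C ∧ ∀ (v : Sm n), ∀ x ∈ KB n, (ed j (T v) (T v)) x ≤ C * (En 3 v) x := by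
  have key : ∃ C, 0 ≤ C ∧ ∀ (v : Sm n), ∀ x ∈ KB n, (ed j (T v) (T v)) x ≤ C * (En (d + j) v) x := by
    match j with
    | 0 =>
      obtain ⟨C, pC, hC⟩ := h.bound (KB_compact (n := n))
      exact ⟨C, pC, fun v x hx => by
        have := hC v x hx
        rw [sq] at this; exact this⟩
    | 1 => exact h.Ga
    | 2 =>
      obtain ⟨C, pC, hC⟩ := h.Zol.bound (KB_compact (n := n))
      exact ⟨C, pC, fun v x hx => by
        have := hC v x hx
        rw [sq] at this; exact this⟩
    | 3 => exact h.Zol.Ga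
    | j + 4 => exact absurd hj (by omega)
  obtain ⟨C, pC, hC⟩ := key
  exact ⟨C, pC, fun v x hx => (hC v x hx).trans (mul_le_mul_of_nonneg_left (En_mono hj v x) pC)⟩

lemma Dn_bound (k : ℝ) : ∃ C, 0 ≤ C ∧ ∀ u w : Sm n, (∀ x, 0 ≤ (w * u) x) → ∀ x ∈ KB n,
    (Dn k u w) x ≤ C * (En 3 u + w * u) x := by
  have h : ∀ q : ℕ × ℕ, ∃ C, 0 ≤ C ∧ (q ∈ ix → ∀ (v : Sm n), ∀ x ∈ KB n,
      (ed q.2 ((Ao k ^ q.1) v) ((Ao k ^ q.1) v)) x ≤ C * (En 3 v) x) := by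
    intro q
    by_cases hq : q ∈ ix
    · have h3 : q.1 + q.2 ≤ 3 := by
        simp only [ix, Finset.mem_filter] at hq; exact hq.2
      obtain ⟨C, pC, hC⟩ := ed_bound (n := n) (DO.Aopow k q.1) q.2 h3
      exact ⟨C, pC, fun _ => hC⟩
    · exact ⟨0, le_rfl, fun h => absurd h hq⟩
  choose C pC hC using h
  have pS : 0 ≤ ∑ q ∈ ix, C q := Finset.sum_nonneg fun q _ => pC q
  refine ⟨∑ q ∈ ix, C q + 216, by positivity, fun u w hwu x hx => ?_⟩
  rw [Dn, Sm.add_ap, Sm.sum_ap, Sm.add_ap, Sm.mul_ap, Sm.pow_ap]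
  have h1 := Finset.sum_le_sum fun q (hq : q ∈ ix) => hC q hq u x hx
  rw [← Finset.sum_mul] at h1
  have h6 : (r2 : Sm n) x ≤ 6 := hx
  have h2 : (r2 : Sm n) x ^ 3 ≤ 216 := by
    calc _ ≤ (6 : ℝ) ^ 3 := pow_le_pow_left₀ (r2_nonneg x) h6 3
      _ = 216 := by norm_num
  have h3 := mul_le_mul_of_nonneg_right h2 (hwu x)
  have h4 := En_nonneg 3 u x
  have h5 := mul_nonneg pS (hwu x)
  nlinarith

/-! ### Scaling -/

/-- Dilation. -/
def sc (R : ℝ) : Sm n →ₐ[ℝ] Sm n where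
  toFun f := ⟨fun x => f (R • x), by
    have h : ContDiff ℝ (⊤ : ℕ∞) (fun x : EuclideanSpace ℝ (Fin n) => R • x) := contDiff_const_smul R
    exact (smcd f).comp h⟩
  map_one' := rfl
  map_mul' _ _ := rfl
  map_zero' := rfl
  map_add' _ _ := rfl
  commutes' _ := rfl

lemma sc_ap (R : ℝ) (f : Sm n) (x) : (sc R f) x = f (R • x) := rfl

lemma sc_sc {R S : ℝ} (h : R * S = 1) (f : Sm n) : sc R (sc S f) = f := by
  ext x
  rw [sc_ap, sc_ap, smul_smul, mul_comm, h, one_smul]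

lemma pd_sc (R : ℝ) (i : Fin n) (f : Sm n) : pd i (sc R f) = R • sc R (pd i f) := by
  ext x
  rw [Sm.smul_ap, sc_ap, pd_ap, pd_ap]
  have h1 : HasFDerivAt (fun x : EuclideanSpace ℝ (Fin n) => R • x)
      (R • ContinuousLinearMap.id ℝ (EuclideanSpace ℝ (Fin n))) x := (hasFDerivAt_id x).const_smul R
  have h2 : HasFDerivAt (f.1 ∘ fun x => R • x) ((fderiv ℝ f.1 (R • x)).comp
      (R • ContinuousLinearMap.id ℝ (EuclideanSpace ℝ (Fin n)))) x :=
    HasFDerivAt.comp x ((smdiff f) (R • x)).hasFDerivAt h1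
  have h3 : (sc R f).1 = f.1 ∘ fun x => R • x := rfl
  rw [h3, h2.fderiv]
  simp

lemma sc_co (R : ℝ) (i : Fin n) : sc R (co i) = R • co i := by
  ext x; rfl

lemma Eu_sc (R : ℝ) (f : Sm n) : Eu (sc R f) = sc R (Eu f) := by
  rw [Eu_eq, Eu_eq, map_sum]
  refine Finset.sum_congr rfl fun i _ => ?_
  rw [pd_sc, map_mul, sc_co, mul_smul_comm, smul_mul_assoc]

lemma Lap_sc (R : ℝ) (f : Sm n) : Lap (sc R f) = R ^ 2 • sc R (Lap f) := by
  rw [Lap_eq, Lap_eq, map_sum, Finset.smul_sum]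
  refine Finset.sum_congr rfl fun i _ => ?_
  rw [pd_sc, Derivation.map_smul, pd_sc, smul_smul, sq]

lemma sc_r2 (R : ℝ) : sc R (r2 : Sm n) = R ^ 2 • r2 := by
  ext x
  rw [Sm.smul_ap, sc_ap, r2_norm, r2_norm, norm_smul, mul_pow]; simp

lemma Zo_sc (R : ℝ) (f : Sm n) : Zo (sc R f) = sc R (Zo f) := by
  rw [Zo_eq, Zo_eq, map_add, map_add, map_neg, map_mul, map_smul, Eu_sc, Eu_sc, Lap_sc, sc_r2,
    mul_smul_comm, smul_mul_assoc]

lemma Ga_sc (R : ℝ) (f g : Sm n) : Ga (sc R f) (sc R g) = sc R (Ga f g) := by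
  simp only [Ga, map_sub, map_mul, map_sum, Eu_sc, sc_r2, pd_sc, Finset.mul_sum]
  congr 1
  refine Finset.sum_congr rfl fun i _ => ?_
  simp only [mul_smul_comm, smul_mul_assoc, smul_smul, sq]

lemma Ao_sc (k R : ℝ) (f : Sm n) : Ao k (sc R f) = sc R (Ao k f) := by
  rw [Ao_eq, Ao_eq, map_add, map_smul, Eu_sc]

lemma Aopow_sc (k R : ℝ) (l : ℕ) (f : Sm n) : (Ao k ^ l) (sc R f) = sc R ((Ao k ^ l) f) := by
  induction l generalizing f with
  | zero => rfl
  | succ l ih =>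
    rw [pow_succ]
    change (Ao k ^ l) (Ao k (sc R f)) = sc R ((Ao k ^ l) (Ao k f))
    rw [Ao_sc, ih]

lemma ed_sc (j : ℕ) (R : ℝ) (f g : Sm n) : ed j (sc R f) (sc R g) = sc R (ed j f g) := by
  match j with
  | 0 => simp only [ed, map_mul]
  | 1 => exact Ga_sc _ _ _
  | 2 => simp only [ed, map_mul, Zo_sc]
  | 3 => simp only [ed, Zo_sc, Ga_sc]
  | _ + 4 => simp only [ed, map_zero]

lemma Dn_sc (k R c : ℝ) (u w : Sm n) :
    Dn k (c • sc R u) ((c * R ^ 6) • sc R w) = c ^ 2 • sc R (Dn k u w) := by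
  rw [Dn, Dn, map_add, map_sum, smul_add, Finset.smul_sum]
  congr 1
  · refine Finset.sum_congr rfl fun q _ => ?_
    rw [map_smul, Aopow_sc, ed_smul, ed_comm, ed_smul, ed_sc, smul_smul, sq]
  · rw [map_mul, map_mul, map_pow, sc_r2]
    ext x
    simp only [Sm.smul_ap, Sm.mul_ap, Sm.pow_ap]
    ring

lemma int_sc {R : ℝ} (hR : 0 < R) (f : EuclideanSpace ℝ (Fin n) → ℝ) :
    ∫ x, f (R • x) = (R ^ n)⁻¹ * ∫ x, f x := by
  rw [Measure.integral_comp_smul, finrank_euclideanSpace_fin, abs_of_pos (by positivity)]; rfl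

lemma setint_sc {R : ℝ} (hR : 0 < R) {S : Set (EuclideanSpace ℝ (Fin n))} (hS : MeasurableSet S)
    (f : EuclideanSpace ℝ (Fin n) → ℝ) :
    ∫ x in (fun x => R • x) ⁻¹' S, f (R • x) = (R ^ n)⁻¹ * ∫ x in S, f x := by
  have hm : Measurable (fun x : EuclideanSpace ℝ (Fin n) => R • x) := measurable_const_smul R
  rw [← integral_indicator hS, ← int_sc hR, ← integral_indicator (hm hS)]
  rfl

lemma Sol.scale {p k : ℝ} {u w : Sm n} (S : Sol p u w) (hk : k * (p - 1) = 6) {R : ℝ} (hR : 0 < R) :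
    Sol p (R ^ k • sc R u) ((R ^ k * R ^ 6) • sc R w) := by
  have hp := S.hp
  have c0 : 0 < R ^ k := Real.rpow_pos_of_pos hR k
  have e6 : (R ^ k) ^ (p - 1) = R ^ 6 := by
    rw [← Real.rpow_mul hR.le, hk, ← Real.rpow_natCast R 6]; norm_num
  have eabs : ∀ x, |(R ^ k • sc R u : Sm n) x| ^ (p - 1) = R ^ 6 * |u (R • x)| ^ (p - 1) := by
    intro x
    rw [Sm.smul_ap, sc_ap, abs_mul, abs_of_pos c0, Real.mul_rpow c0.le (abs_nonneg _), e6]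
  refine ⟨hp, ?_, fun x => ?_, fun φ hφ => ?_⟩
  · simp only [map_smul, Lap_sc, S.hw, map_neg]
    ext x
    simp only [Sm.smul_ap, Sm.neg_ap]
    ring
  · rw [eabs, Sm.smul_ap, Sm.smul_ap, sc_ap, sc_ap, S.hwp]; ring
  · set ψ := sc R⁻¹ φ with hψ
    have e1 : φ = sc R ψ := (sc_sc (mul_inv_cancel₀ hR.ne') φ).symm
    have hcs : HasCompactSupport ψ.1 :=
      HasCompactSupport.comp_homeomorph hφ (Homeomorph.smulOfNeZero R⁻¹ (inv_ne_zero hR.ne'))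
    have h := S.stab ψ hcs
    have l1 : ∫ x, |(R ^ k • sc R u : Sm n) x| ^ (p - 1) * φ x ^ 2
        = R ^ 6 * ((R ^ n)⁻¹ * ∫ x, |u x| ^ (p - 1) * ψ x ^ 2) := by
      rw [← int_sc hR, ← integral_const_mul]
      congr 1; funext x
      rw [eabs, e1, sc_ap]; ring
    have l2 : ∫ x, (- Lap (Lap (Lap φ)) * φ) x
        = R ^ 6 * ((R ^ n)⁻¹ * ∫ x, (- Lap (Lap (Lap ψ)) * ψ) x) := by
      rw [← int_sc hR, ← integral_const_mul]
      congr 1; funext x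
      rw [e1, Lap_sc, map_smul, Lap_sc, map_smul, map_smul, Lap_sc]
      simp only [Sm.smul_ap, Sm.mul_ap, Sm.neg_ap, sc_ap]
      ring
    rw [l1, l2]
    have := mul_le_mul_of_nonneg_left h (show 0 ≤ R ^ 6 * (R ^ n)⁻¹ by positivity)
    linarith

lemma Fn_sc (k : ℝ) (u w : Sm n) {R : ℝ} (hR : 0 < R) (x) :
    Fn k (R ^ k • sc R u) ((R ^ k * R ^ 6) • sc R w) x = R ^ n * Fn k u w (R • x) := by
  unfold Fn
  rw [Dn_sc, Sm.smul_ap, sc_ap]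
  have e : (r2 : Sm n) (R • x) = R ^ 2 * (r2 : Sm n) x := by
    rw [← sc_ap, sc_r2, Sm.smul_ap]
  rw [e, Real.mul_rpow (by positivity) (r2_nonneg x)]
  have e2 : (R ^ 2) ^ ((2 * k - n) / 2) = (R ^ k) ^ 2 / R ^ n := by
    rw [← Real.rpow_natCast R 2, ← Real.rpow_mul hR.le, ← Real.rpow_natCast (R ^ k) 2,
      ← Real.rpow_mul hR.le, ← Real.rpow_natCast R n, ← Real.rpow_sub hR]
    congr 1; push_cast; ring
  rw [e2]
  have : R ^ n ≠ 0 := by positivity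
  field_simp


/-! ### Conclusion -/

lemma JJ_set (N : ℕ) (f : Sm n) (hf : ∀ x, 0 ≤ f x) {A : Set (EuclideanSpace ℝ (Fin n))}
    (hA : MeasurableSet A) (hA3 : ∀ x ∈ A, (r2 : Sm n) x ≤ 3) :
    ∫ x in A, f x ≤ JJ (zz ^ N * f) := by
  have h1 : ∫ x in A, f x = ∫ x in A, (zz ^ N * f * zw : Sm n) x := by
    refine setIntegral_congr_fun hA fun x hx => ?_
    have := hA3 x hx
    change f x = (zz ^ N * f * zw : Sm n) x
    rw [Sm.mul_ap, Sm.mul_ap, Sm.pow_ap, zz_ap, zw_ap, Real.smoothTransition.one_of_one_le (by linarith),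
      Real.smoothTransition.one_of_one_le (by linarith)]
    simp
  rw [h1]
  refine setIntegral_le_integral (cs_int (cs_mul_right _ _ zw_cs)) (Eventually.of_forall fun x => ?_)
  change 0 ≤ (zz ^ N * f * zw : Sm n) x
  rw [Sm.mul_ap, Sm.mul_ap, Sm.pow_ap]
  exact mul_nonneg (mul_nonneg (pow_nonneg (zz_nonneg x) _) (hf x)) (zw_nonneg x)

/-- The annulus at scale `s`. -/
def an (n : ℕ) (s : ℝ) : Set (EuclideanSpace ℝ (Fin n)) :=
  {x | s ^ 2 / 2 ≤ (r2 : Sm n) x ∧ (r2 : Sm n) x ≤ 2 * s ^ 2}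

lemma an_closed (s : ℝ) : IsClosed (an n s) :=
  (isClosed_le continuous_const (smcont r2)).inter (isClosed_le (smcont r2) continuous_const)

lemma an_compact : IsCompact (an n 1) :=
  KB_compact.of_isClosed_subset (an_closed 1) fun x hx => by
    have := hx.2
    change (r2 : Sm n) x ≤ 6
    linarith

lemma wu_nn' {p : ℝ} {u w : Sm n} (S : Sol p u w) (x) : 0 ≤ (En 3 u + w * u) x := by
  rw [Sm.add_ap]; exact add_nonneg (En_nonneg 3 u x) (S.wu_nn x)

lemma unit_bound (p k : ℝ) (hp : 1 < p) :
    ∃ C, ∀ u w : Sm n, Sol p u w → ∫ x in an n 1, Fn k u w x ≤ C := by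
  obtain ⟨N, C, hC⟩ := local_bound (n := n) p hp
  obtain ⟨C', pC', hC'⟩ := Dn_bound (n := n) k
  have hcont : ContinuousOn (fun x => (r2 : Sm n) x ^ ((2 * k - n) / 2)) (an n 1) := by
    refine (smcont r2).continuousOn.rpow_const fun x hx => Or.inl ?_
    have := hx.1
    norm_num at this
    intro h0; rw [h0] at this; linarith
  obtain ⟨B, hB⟩ := (an_compact (n := n)).exists_bound_of_continuousOn hcont
  have hK : ∀ x ∈ an n 1, x ∈ KB n := fun x hx => by
    have := hx.2
    change (r2 : Sm n) x ≤ 6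
    linarith
  refine ⟨max B 0 * C' * C, fun u w S => ?_⟩
  have hle : ∀ x ∈ an n 1, Fn k u w x ≤ max B 0 * C' * (En 3 u + w * u : Sm n) x := by
    intro x hx
    have h1 := hB x hx
    rw [Real.norm_of_nonneg (Real.rpow_nonneg (r2_nonneg x) _)] at h1
    have h2 := hC' u w S.wu_nn x (hK x hx)
    unfold Fn
    rw [mul_assoc]
    exact mul_le_mul (h1.trans (le_max_left _ _)) h2 (Dn_nonneg S.wu_nn x) (le_max_right _ _)
  have i1 : IntegrableOn (Fn k u w) (an n 1) :=
    (hcont.mul (smcont (Dn k u w)).continuousOn).integrableOn_compact an_compact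
  have i2 : IntegrableOn (fun x => max B 0 * C' * (En 3 u + w * u : Sm n) x) (an n 1) :=
    (continuous_const.mul (smcont (En 3 u + w * u))).continuousOn.integrableOn_compact an_compact
  refine (setIntegral_mono_on i1 i2 (an_closed 1).measurableSet hle).trans ?_
  rw [integral_const_mul]
  refine mul_le_mul_of_nonneg_left ?_ (mul_nonneg (le_max_right _ _) pC')
  refine (JJ_set N _ (wu_nn' S) (an_closed 1).measurableSet fun x hx => ?_).trans (hC u w S)
  have := hx.2
  linarith

lemma r2_smul (s : ℝ) (x : EuclideanSpace ℝ (Fin n)) : (r2 : Sm n) (s • x) = s ^ 2 * (r2 : Sm n) x := by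
  rw [← sc_ap, sc_r2, Sm.smul_ap]

lemma scale_bound {p k : ℝ} {u w : Sm n} (S : Sol p u w) (hk : k * (p - 1) = 6) :
    ∃ C, 0 ≤ C ∧ ∀ s : ℝ, 0 < s → ∫ x in an n s, Fn k u w x ≤ C := by
  obtain ⟨C, hC⟩ := unit_bound (n := n) p k S.hp
  refine ⟨max C 0, le_max_right _ _, fun s hs => ?_⟩
  have h := hC _ _ (S.scale hk hs)
  have e1 : an n 1 = (fun x => s • x) ⁻¹' (an n s) := by
    ext x
    have hs2 : 0 < s ^ 2 := by positivity
    simp only [an, Set.mem_preimage, Set.mem_setOf_eq, r2_smul]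
    constructor
    · rintro ⟨h1, h2⟩; constructor <;> nlinarith
    · rintro ⟨h1, h2⟩
      constructor
      · refine le_of_mul_le_mul_left ?_ hs2; linarith
      · refine le_of_mul_le_mul_left ?_ hs2; linarith
  have e2 : ∫ x in an n 1, Fn k (s ^ k • sc s u) ((s ^ k * s ^ 6) • sc s w) x
      = ∫ x in an n s, Fn k u w x := by
    rw [e1]
    simp only [Fn_sc k u w hs]
    rw [integral_const_mul, setint_sc hs (an_closed s).measurableSet, ← mul_assoc,
      mul_inv_cancel₀ (by positivity), one_mul]
  rw [e2] at h
  exact h.trans (le_max_left _ _)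

lemma shell_int_an {k : ℝ} {u w : Sm n} {s : ℝ} (hs : 0 < s) : IntegrableOn (Fn k u w) (an n s) := by
  have hc : IsCompact (an n s) := by
    have : an n s ⊆ Metric.closedBall 0 (2 * s) := by
      intro x hx
      have h := hx.2
      rw [r2_norm] at h
      rw [mem_closedBall_zero_iff]
      nlinarith [norm_nonneg x]
    exact (isCompact_closedBall _ _).of_isClosed_subset (an_closed s) this
  refine ContinuousOn.integrableOn_compact hc ?_
  refine ContinuousOn.mul ?_ (smcont _).continuousOn
  refine (smcont r2).continuousOn.rpow_const fun x hx => Or.inl ?_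
  have := hx.1
  have hs2 : 0 < s ^ 2 := by positivity
  intro h0; rw [h0] at this; linarith

lemma Nn_bound {p k : ℝ} {u w : Sm n} (S : Sol p u w) (hk : k * (p - 1) = 6) :
    ∃ C, 0 ≤ C ∧ ∀ R : Idx, Nn k u w R ≤ C := by
  obtain ⟨C, pC, hC⟩ := scale_bound S hk
  refine ⟨C + C, by linarith, fun R => ?_⟩
  have hR : 0 < R.1 := lt_of_lt_of_le one_pos R.2
  have hR2 : 0 < R.1 ^ 2 := by positivity
  have hRi : 0 < R.1⁻¹ := by positivity
  have hsub : ann n R ⊆ an n R.1⁻¹ ∪ an n R.1 := by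
    rintro x (⟨h1, h2⟩ | ⟨h1, h2⟩)
    · left
      unfold ti at h1 h2
      have e : (R.1⁻¹) ^ 2 = 1 / R.1 ^ 2 := by field_simp
      constructor
      · rw [e, div_div, div_le_iff₀ (by positivity)]; linarith
      · rw [e, mul_one_div, le_div_iff₀ (by positivity)]; linarith
    · right
      unfold tq at h1 h2
      rw [inv_mul_eq_div] at h1 h2
      rw [le_div_iff₀ hR2] at h1
      rw [div_le_iff₀ hR2] at h2
      constructor <;> linarith
  have nn : ∀ x, 0 ≤ Fn k u w x := Fn_nonneg S.wu_nn
  have i1 := shell_int_an (n := n) (k := k) (u := u) (w := w) hRi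
  have i2 := shell_int_an (n := n) (k := k) (u := u) (w := w) hR
  have h1 : Nn k u w R ≤ ∫ x in an n R.1⁻¹ ∪ an n R.1, Fn k u w x :=
    setIntegral_mono_set (i1.union i2) (Eventually.of_forall nn) hsub.eventuallyLE
  have h2 : ∫ x in an n R.1⁻¹ ∪ an n R.1, Fn k u w x
      = (∫ x in an n R.1⁻¹ \ an n R.1, Fn k u w x) + ∫ x in an n R.1, Fn k u w x := by
    rw [← Set.diff_union_self, setIntegral_union Set.disjoint_sdiff_left (an_closed _).measurableSet
      (i1.mono_set Set.diff_subset) i2]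
  have h3 : ∫ x in an n R.1⁻¹ \ an n R.1, Fn k u w x ≤ ∫ x in an n R.1⁻¹, Fn k u w x :=
    setIntegral_mono_set i1 (Eventually.of_forall nn) Set.diff_subset.eventuallyLE
  linarith [hC _ hRi, hC _ hR]

lemma cover_zero {φ : ℕ → Set (EuclideanSpace ℝ (Fin n))} (hφ : AECover volume atTop φ)
    {f : EuclideanSpace ℝ (Fin n) → ℝ} (nn : ∀ x, 0 ≤ f x) (hf : Integrable f)
    {a : ℕ → ℝ} (ha : Tendsto a atTop (nhds 0)) (hfa : ∀ m, ∫ x in φ m, f x ≤ a m) :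
    f =ᵐ[volume] 0 := by
  have h1 := hφ.integral_tendsto_of_countably_generated hf
  have h2 : ∫ x, f x ≤ 0 := le_of_tendsto_of_tendsto' h1 ha hfa
  have h3 : ∫ x, f x = 0 := le_antisymm h2 (integral_nonneg nn)
  exact (integral_eq_zero_iff_of_nonneg nn hf).1 h3

lemma Sol.zero_of_ae {p : ℝ} {u w : Sm n} (S : Sol p u w) (h : ∀ᵐ x, (w * u : Sm n) x = 0) :
    u.1 = 0 := by
  have hp := S.hp
  have h1 : u.1 =ᵐ[volume] (fun _ => (0 : ℝ)) := by
    filter_upwards [h] with x hx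
    rw [S.wu', Real.rpow_eq_zero (abs_nonneg _) (by linarith), abs_eq_zero] at hx
    exact hx
  have := (Continuous.ae_eq_iff_eq volume (smcont u) continuous_const).1 h1
  exact this

/-- The sequence of radii. -/
def rad (m : ℕ) : Idx := ⟨(m : ℝ) + 1, by have : (0 : ℝ) ≤ m := m.cast_nonneg; linarith⟩

lemma rad_t : Tendsto (fun m => (rad m).1 ^ 2) atTop atTop := by
  have h : Tendsto (fun m : ℕ => (m : ℝ) + 1) atTop atTop :=
    tendsto_atTop_add_const_right _ _ tendsto_natCast_atTop_atTop
  exact (tendsto_pow_atTop (two_ne_zero)).comp h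

lemma ae_pos (hn : 1 ≤ n) : ∀ᵐ x : EuclideanSpace ℝ (Fin n), 0 < (r2 : Sm n) x := by
  haveI : Nonempty (Fin n) := ⟨⟨0, hn⟩⟩
  haveI : Nontrivial (EuclideanSpace ℝ (Fin n)) := inferInstance
  have : ∀ᵐ x : EuclideanSpace ℝ (Fin n), x ≠ 0 := by
    rw [ae_iff]; simp
  filter_upwards [this] with x hx
  rw [r2_norm]
  have := norm_pos_iff.2 hx
  positivity

lemma ev_rad {x : EuclideanSpace ℝ (Fin n)} (hx : 0 < (r2 : Sm n) x) :
    ∀ᶠ m in atTop, 1 < ti (rad m) x ∧ tq (rad m) x < 1 := by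
  have h1 := rad_t.eventually_gt_atTop ((r2 : Sm n) x)
  have h2 := rad_t.eventually_gt_atTop (1 / (r2 : Sm n) x)
  filter_upwards [h1, h2] with m h1 h2
  unfold ti tq
  constructor
  · rwa [div_lt_iff₀ hx] at h2
  · rw [inv_mul_eq_div, div_lt_one (by linarith)]; exact h1

lemma core_cover (hn : 1 ≤ n) : AECover volume atTop (fun m => core n (rad m)) where
  ae_eventually_mem := by
    filter_upwards [ae_pos hn] with x hx
    filter_upwards [ev_rad hx] with m h
    exact ⟨h.1.le, h.2.le⟩
  measurableSet m := (core_closed _).measurableSet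

lemma Sol.concl1 (hn1 : 1 ≤ n) {p k b M : ℝ} {u w : Sm n} (S : Sol p u w) (hk : k * (p - 1) = 6)
    (hn : (n : ℝ) = 2 * (k + b) + 6) (hM : M = k + b + 2) (hc : (b = 0 ∧ 2 < M) ∨ Coef p b M) :
    u.1 = 0 := by
  obtain ⟨C, hC⟩ := S.main hk hn hM hc
  obtain ⟨B, pB, hB⟩ := Nn_bound S hk
  have nn : ∀ x, 0 ≤ Fn k u w x := Fn_nonneg S.wu_nn
  have hC' : ∀ R, ∫ x in core n R, Fn k u w x ≤ max C 0 * Nn k u w R := fun R =>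
    (hC R).trans (mul_le_mul_of_nonneg_right (le_max_left _ _) (Nn_nonneg S.wu_nn R))
  have hcov := core_cover hn1
  have hFi : Integrable (Fn k u w) := by
    refine hcov.integrable_of_integral_bounded_of_nonneg_ae (max C 0 * B)
      (fun m => (Fn_int _).mono_set (core_sub _)) (Eventually.of_forall nn)
      (Eventually.of_forall fun m => ?_)
    exact (hC' _).trans (mul_le_mul_of_nonneg_left (hB _) (le_max_right _ _))
  have hN : Tendsto (fun m => Nn k u w (rad m)) atTop (nhds 0) := by
    have h := tendsto_integral_of_dominated_convergence (μ := volume)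
      (F := fun m => (ann n (rad m)).indicator (Fn k u w)) (f := fun _ => (0 : ℝ)) (Fn k u w)
      (fun m => hFi.aestronglyMeasurable.indicator (ann_closed _).measurableSet) hFi
      (fun m => Eventually.of_forall fun x => ?_) ?_
    · rw [integral_zero] at h
      refine h.congr fun m => ?_
      rw [integral_indicator (ann_closed _).measurableSet]; rfl
    · rw [Real.norm_of_nonneg (Set.indicator_nonneg (fun x _ => nn x) x)]
      exact Set.indicator_le_self' (fun x _ => nn x) x
    · filter_upwards [ae_pos hn1] with x hx
      refine tendsto_const_nhds.congr' ?_
      filter_upwards [ev_rad hx] with m h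
      rw [Set.indicator_of_notMem]
      rintro (⟨h1, h2⟩ | ⟨h1, h2⟩)
      · linarith [h.1]
      · linarith [h.2]
  have hz := cover_zero hcov nn hFi (a := fun m => max C 0 * Nn k u w (rad m))
    (by simpa using hN.const_mul (max C 0)) (fun m => hC' _)
  refine S.zero_of_ae ?_
  filter_upwards [hz, ae_pos hn1] with x hx h0
  have hx' : (r2 : Sm n) x ^ ((2 * k - n) / 2) * (Dn k u w) x = 0 := hx
  have h2 : (Dn k u w) x = 0 := by
    rcases mul_eq_zero.1 hx' with h | h
    · exact absurd h (Real.rpow_pos_of_pos h0 _).ne'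
    · exact h
  have h3 := wu_le_Dn (k := k) (u := u) (w := w) x
  rw [h2, Sm.mul_ap, Sm.pow_ap] at h3
  have h4 := S.wu_nn x
  have h5 : 0 < (r2 : Sm n) x ^ 3 := by positivity
  nlinarith

/-- Balls. -/
def ba (n : ℕ) (s : ℝ) : Set (EuclideanSpace ℝ (Fin n)) := {x | (r2 : Sm n) x ≤ s ^ 2}

lemma ba_closed (s : ℝ) : IsClosed (ba n s) := isClosed_le (smcont r2) continuous_const

lemma ba_compact {s : ℝ} (hs : 0 < s) : IsCompact (ba n s) := by
  have : ba n s ⊆ Metric.closedBall 0 s := by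
    intro x hx
    have h : (r2 : Sm n) x ≤ s ^ 2 := hx
    rw [r2_norm] at h
    rw [mem_closedBall_zero_iff]
    exact le_of_sq_le_sq h hs.le
  exact (isCompact_closedBall _ _).of_isClosed_subset (ba_closed s) this

lemma Sol.concl2 {p k : ℝ} {u w : Sm n} (S : Sol p u w) (hk : k * (p - 1) = 6)
    (hn : (n : ℝ) < 2 * k + 6) : u.1 = 0 := by
  obtain ⟨N, C, hC⟩ := local_bound (n := n) p S.hp
  set a : ℝ := 2 * k + 6 - n with ha
  have a0 : 0 < a := by linarith
  have key : ∀ s : ℝ, 0 < s → ∫ x in ba n s, (w * u : Sm n) x ≤ C * s ^ (-a) := by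
    intro s hs
    have SS := S.scale hk hs
    have h := hC _ _ SS
    have h1 : ∫ x in ba n 1, (((s ^ k * s ^ 6) • sc s w) * (s ^ k • sc s u) : Sm n) x ≤ C := by
      refine (JJ_set N _ SS.wu_nn (ba_closed 1).measurableSet fun x hx => ?_).trans
        ((JJ_mono fun x _ => ?_).trans h)
      · have : (r2 : Sm n) x ≤ 1 ^ 2 := hx
        linarith
      · rw [Sm.mul_ap, Sm.mul_ap]
        refine mul_le_mul_of_nonneg_left ?_ (by rw [Sm.pow_ap]; exact pow_nonneg (zz_nonneg x) _)
        rw [Sm.add_ap, Sm.mul_ap]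
        linarith [En_nonneg 3 (s ^ k • sc s u : Sm n) x]
    have e1 : ba n 1 = (fun x => s • x) ⁻¹' (ba n s) := by
      ext x
      have hs2 : 0 < s ^ 2 := by positivity
      simp only [ba, Set.mem_preimage, Set.mem_setOf_eq, r2_smul]
      constructor
      · intro h; nlinarith
      · intro h; refine le_of_mul_le_mul_left ?_ hs2; linarith
    have e2 : ∀ x, (((s ^ k * s ^ 6) • sc s w) * (s ^ k • sc s u) : Sm n) x
        = ((s ^ k) ^ 2 * s ^ 6) * (w * u : Sm n) (s • x) := by
      intro x
      simp only [Sm.mul_ap, Sm.smul_ap, sc_ap]; ring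
    simp only [e2] at h1
    rw [integral_const_mul, e1, setint_sc hs (ba_closed s).measurableSet (fun x => (w * u : Sm n) x)] at h1
    have e3 : (s ^ k) ^ 2 * s ^ 6 * (s ^ n)⁻¹ = s ^ a := by
      rw [ha, Real.rpow_sub hs, Real.rpow_add hs, Real.rpow_natCast, two_mul, Real.rpow_add hs, sq]
      norm_num
      rfl
    rw [← mul_assoc, e3] at h1
    rw [Real.rpow_neg hs.le, ← div_eq_mul_inv, le_div_iff₀ (Real.rpow_pos_of_pos hs a)]
    linarith
  have hrad : Tendsto (fun m => (rad m).1) atTop atTop :=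
    tendsto_atTop_add_const_right _ _ tendsto_natCast_atTop_atTop
  have hr0 : ∀ m, 0 < (rad m).1 := fun m => lt_of_lt_of_le one_pos (rad m).2
  have hcov : AECover volume atTop (fun m => ba n (rad m).1) :=
    { ae_eventually_mem := Eventually.of_forall fun x =>
        (rad_t.eventually_ge_atTop ((r2 : Sm n) x))
      measurableSet := fun m => (ba_closed _).measurableSet }
  have ht : Tendsto (fun m => C * (rad m).1 ^ (-a)) atTop (nhds 0) := by
    simpa using ((tendsto_rpow_neg_atTop a0).comp hrad).const_mul C
  have hFi : Integrable (fun x => (w * u : Sm n) x) := by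
    refine hcov.integrable_of_integral_bounded_of_nonneg_ae 1
      (fun m => (smcont (w * u)).continuousOn.integrableOn_compact (ba_compact (hr0 m)))
      (Eventually.of_forall S.wu_nn) ?_
    filter_upwards [ht.eventually_le_const one_pos] with m hm
    exact (key _ (hr0 m)).trans hm
  exact S.zero_of_ae (cover_zero hcov S.wu_nn hFi ht fun m => key _ (hr0 m))


/-! ### The algebra of the Joseph–Lundgren exponent -/

/-- The critical cubic. -/
def GG (M z : ℝ) : ℝ := ((M + 3) ^ 2 - z) * ((M + 1) ^ 2 - z) * ((M - 1) ^ 2 - z)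

lemma GG_mono {M z z' : ℝ} (hM : 0 < M) (h : z ≤ z') (h' : z' ≤ (M - 1) ^ 2) : GG M z' ≤ GG M z := by
  unfold GG
  have h1 : (M - 1) ^ 2 < (M + 1) ^ 2 := by nlinarith
  have h2 : (M + 1) ^ 2 < (M + 3) ^ 2 := by nlinarith
  refine mul_le_mul (mul_le_mul (by linarith) (by linarith) (by linarith) (by linarith)) (by linarith)
    (by linarith) (mul_nonneg (by linarith) (by linarith))

lemma GG_strict {M z z' : ℝ} (hM : 0 < M) (h : z < z') (h' : z' < (M - 1) ^ 2) : GG M z' < GG M z := by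
  unfold GG
  have h1 : (M - 1) ^ 2 < (M + 1) ^ 2 := by nlinarith
  have h2 : (M + 1) ^ 2 < (M + 3) ^ 2 := by nlinarith
  refine mul_lt_mul'' (mul_lt_mul'' (by linarith) (by linarith) (by linarith) (by linarith)) (by linarith)
    (mul_nonneg (by linarith) (by linarith)) (by linarith)

lemma dd1_neg {x : ℝ} (hx : 15 ≤ x) : dd1 x < 0 := by
  obtain ⟨t, ht, rfl⟩ : ∃ t, 0 ≤ t ∧ x = 15 + t := ⟨x - 15, by linarith, by ring⟩
  have e : dd1 (15 + t) = -(108 * t ^ 6 + 8424 * t ^ 5 + 270324 * t ^ 4 + 4565808 * t ^ 3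
    + 42718356 * t ^ 2 + 208733544 * t + 410705036) := by unfold dd1; ring
  rw [e]
  have : 0 < 108 * t ^ 6 + 8424 * t ^ 5 + 270324 * t ^ 4 + 4565808 * t ^ 3
    + 42718356 * t ^ 2 + 208733544 * t + 410705036 := by positivity
  linarith

lemma dd2_pos {x : ℝ} (hx : 15 ≤ x) : 0 < dd2 x := by
  obtain ⟨t, ht, rfl⟩ : ∃ t, 0 ≤ t ∧ x = 15 + t := ⟨x - 15, by linarith, by ring⟩
  have e : dd2 (15 + t) = 9 * t ^ 12 + 1404 * t ^ 11 + 99810 * t ^ 10 + 4275180 * t ^ 9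
    + 122860311 * t ^ 8 + 2494830456 * t ^ 7 + 36687653148 * t ^ 6 + 393377921336 * t ^ 5
    + 3048957353415 * t ^ 4 + 16630573432844 * t ^ 3 + 60426347513634 * t ^ 2
    + 130684714202588 * t + 126100750123257 := by unfold dd2; ring
  rw [e]; positivity

lemma dfn_root {x M : ℝ} (hx : 15 ≤ x) (hM : x = 2 * M + 2) (hd : 0 < dfn x) :
    GG M (dfn x ^ 2) = M ^ 2 * (M ^ 2 - 4) ^ 2 := by
  have h1 := dd1_neg hx
  have h2 := dd2_pos hx
  have hid : dd1 x ^ 2 - 1296 * dd2 x = (768 * x ^ 2 + 1024) ^ 3 := by unfold dd1 dd2; ring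
  set r := Real.sqrt (dd2 x) with hr
  have r0 : 0 ≤ r := Real.sqrt_nonneg _
  have r2' : r ^ 2 = dd2 x := Real.sq_sqrt h2.le
  set q := -(dd1 x + 36 * r) with hq
  have hq0 : 0 < q := by
    have h3 : (36 * r) ^ 2 < (-dd1 x) ^ 2 := by
      have : 0 < (768 * x ^ 2 + 1024) ^ 3 := by positivity
      nlinarith
    have := lt_of_pow_lt_pow_left₀ 2 (by linarith) h3
    linarith
  have hqq : q ^ 2 + 2 * dd1 x * q + (768 * x ^ 2 + 1024) ^ 3 = 0 := by
    rw [← hid, ← r2', hq]; ring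
  have hc0 : 0 < dd0 x := Real.rpow_pos_of_pos hq0 _
  have hc3 : dd0 x ^ 3 = q := by
    change (q ^ ((1 : ℝ) / 3)) ^ 3 = q
    rw [← Real.rpow_natCast, ← Real.rpow_mul hq0.le]; norm_num
  set c := dd0 x with hc
  have hA : 0 < 9 * x ^ 2 + 96 - (1536 + 1152 * x ^ 2) / c - 3 / 2 * c := by
    by_contra hcon
    push Not at hcon
    unfold dfn at hd
    rw [Real.sqrt_eq_zero_of_nonpos hcon] at hd
    linarith
  obtain ⟨t, ht⟩ : ∃ t, t = (128 / 3 + 32 * x ^ 2) / c := ⟨_, rfl⟩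
  have hct : c * t = 128 / 3 + 32 * x ^ 2 := by rw [ht]; field_simp
  have hz : dfn x ^ 2 = x ^ 2 / 4 + 8 / 3 - c / 24 - t := by
    unfold dfn
    rw [mul_pow, Real.sq_sqrt hA.le, ht]; field_simp; ring
  have hs : (c / 24) * t = 16 / 9 + 4 * x ^ 2 / 3 := by linear_combination hct / 24
  have hst : (c / 24) ^ 3 + t ^ 3 = -2 * dd1 x / 13824 := by
    have ht3 : (24 * t) ^ 3 * q = (768 * x ^ 2 + 1024) ^ 3 := by
      rw [← hc3, ← mul_pow]
      congr 1
      linear_combination 24 * hct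
    have : q * (q + (24 * t) ^ 3 + 2 * dd1 x) = 0 := by linear_combination hqq + ht3
    have := (mul_eq_zero.1 this).resolve_left hq0.ne'
    linear_combination this / 13824 + hc3 / 13824
  rw [hz]
  obtain ⟨s, hs'⟩ : ∃ s, s = c / 24 := ⟨_, rfl⟩
  rw [← hs'] at hs hst ⊢
  unfold GG
  unfold dd1 at hst
  subst hM
  linear_combination hst + 3 * (s + t) * hs

lemma G_pos {n : ℕ} {p k b M : ℝ} (hp : 1 < p) (hk : k * (p - 1) = 6)
    (hn : (n : ℝ) = 2 * (k + b) + 6) (hM : M = k + b + 2) (hb : 0 < b) (hpc : 15 ≤ n → p < pc n) :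
    M ^ 2 * (M ^ 2 - 4) ^ 2 < GG M ((b - 1) ^ 2) := by
  have hk0 : 0 < k := by
    by_contra h; push Not at h; nlinarith
  have hM2 : 2 < M := by linarith
  have hnM : (n : ℝ) = 2 * M + 2 := by linarith
  have hbM : b < M - 2 := by linarith
  have hone : (b - 1) ^ 2 ≤ 1 → M ^ 2 * (M ^ 2 - 4) ^ 2 < GG M ((b - 1) ^ 2) := by
    intro h
    by_cases hM3 : 1 ≤ (M - 1) ^ 2
    · refine lt_of_lt_of_le ?_ (GG_mono (by linarith) h hM3)
      have e : GG M 1 - M ^ 2 * (M ^ 2 - 4) ^ 2 = 6 * (M ^ 2 * (M + 2) ^ 2 * (M - 2)) := by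
        unfold GG; ring
      have : 0 < M ^ 2 * (M + 2) ^ 2 * (M - 2) := by
        have : 0 < M - 2 := by linarith
        positivity
      linarith
    · exfalso; nlinarith
  rcases le_or_gt b 2 with hb2 | hb2
  · exact hone (by nlinarith)
  rcases le_or_gt 15 n with h15 | h15
  · have hx : (15 : ℝ) ≤ n := by exact_mod_cast h15
    have h := hpc h15
    set d := dfn n with hd
    have epc : pc n = (n + 4 - 2 * d) / (n - 8 - 2 * d) := rfl
    rw [epc] at h
    have hpos : 0 < (n : ℝ) - 8 - 2 * d := by
      by_contra hc
      push Not at hc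
      have : ((n : ℝ) + 4 - 2 * d) / (n - 8 - 2 * d) ≤ 1 := by
        rcases hc.eq_or_lt with hc | hc
        · rw [hc]; norm_num
        · rw [div_le_one_of_neg hc]; linarith
      linarith
    rw [lt_div_iff₀ hpos] at h
    have hbd : b - 1 < d := by
      by_contra hc
      push Not at hc
      nlinarith
    have hroot := dfn_root hx hnM (show 0 < dfn n by rw [← hd]; linarith)
    rw [← hd] at hroot
    rw [← hroot]
    refine GG_strict (by linarith) ?_ ?_
    · nlinarith
    · nlinarith
  · have hx : (n : ℝ) ≤ 14 := by
      have : n ≤ 14 := by omega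
      exact_mod_cast this
    have hM6 : M ≤ 6 := by linarith
    have h1 : (b - 1) ^ 2 ≤ (M - 3) ^ 2 := by nlinarith
    refine lt_of_lt_of_le ?_ (GG_mono (by linarith) h1 (by nlinarith))
    have e : GG M ((M - 3) ^ 2) - M ^ 2 * (M ^ 2 - 4) ^ 2
        = M * (M - 2) * (384 * (M - 1) - M * (M - 2) * (M + 2) ^ 2) := by
      unfold GG; ring
    have h2 : 0 < 384 * (M - 1) - M * (M - 2) * (M + 2) ^ 2 := by
      have h3 : M * (M - 2) * (M + 2) ^ 2 ≤ M * (M - 2) * 64 := by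
        refine mul_le_mul_of_nonneg_left (by nlinarith) (mul_nonneg (by linarith) (by linarith))
      nlinarith
    have : 0 < M * (M - 2) * (384 * (M - 1) - M * (M - 2) * (M + 2) ^ 2) :=
      mul_pos (mul_pos (by linarith) (by linarith)) h2
    linarith

lemma c3_pos {b M : ℝ} (hb : 0 < b) (hM2 : 2 < M) (hbM : b < M - 2)
    (hG : M ^ 2 * (M ^ 2 - 4) ^ 2 < GG M ((b - 1) ^ 2)) : 0 < 6 * M ^ 2 + 16 - 10 * b ^ 2 := by
  rcases le_or_gt M 9 with h9 | h9
  · have : b ^ 2 ≤ (M - 2) ^ 2 := pow_le_pow_left₀ hb.le hbM.le 2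
    nlinarith
  by_contra hc
  push Not at hc
  have hb34 : 3 / 4 * M ≤ b := by
    by_contra h
    push Not at h
    have : b ^ 2 ≤ (3 / 4 * M) ^ 2 := pow_le_pow_left₀ hb.le h.le 2
    nlinarith
  have h1 : (3 / 4 * M - 1) ^ 2 ≤ (b - 1) ^ 2 := pow_le_pow_left₀ (by linarith) (by linarith) 2
  have h1' : (b - 1) ^ 2 ≤ (M - 1) ^ 2 := pow_le_pow_left₀ (by linarith) (by linarith) 2
  have h2 := GG_mono (show 0 < M by linarith) h1 h1'
  have h3 : GG M ((3 / 4 * M - 1) ^ 2) < M ^ 2 * (M ^ 2 - 4) ^ 2 := by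
    obtain ⟨t, ht, rfl⟩ : ∃ t, 0 ≤ t ∧ M = 9 + t := ⟨M - 9, by linarith, by ring⟩
    have : 0 < (9 + t) ^ 2 * ((9 + t) ^ 2 - 4) ^ 2 - GG (9 + t) ((3 / 4 * (9 + t) - 1) ^ 2) := by
      unfold GG
      ring_nf
      positivity
    linarith
  linarith

lemma coef_ok {n : ℕ} {p k b M : ℝ} (hp : 1 < p) (hk : k * (p - 1) = 6)
    (hn : (n : ℝ) = 2 * (k + b) + 6) (hM : M = k + b + 2) (hb : 0 ≤ b) (hpc : 15 ≤ n → p < pc n) :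
    (b = 0 ∧ 2 < M) ∨ Coef p b M := by
  have hk0 : 0 < k := by
    by_contra h; push Not at h; nlinarith
  have hM2 : 2 < M := by linarith
  rcases hb.eq_or_lt with hb | hb
  · exact Or.inl ⟨hb.symm, hM2⟩
  right
  have hG := G_pos hp hk hn hM hb hpc
  have hbM : b < M - 2 := by linarith
  have hnM : (n : ℝ) = 2 * M + 2 := by linarith
  have hM5 : 5 / 2 ≤ M := by
    have h6 : (6 : ℝ) < n := by linarith
    have h7 : 7 ≤ n := by exact_mod_cast h6
    have : (7 : ℝ) ≤ n := by exact_mod_cast h7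
    linarith
  have hX : 4 * (M - 1) < M ^ 2 - b ^ 2 := by nlinarith
  have hX' : 4 * (b + 1) < M ^ 2 - b ^ 2 := by nlinarith
  have hpk : k * p = k + 6 := by linarith
  -- reduction to inequalities without p
  have red : ∀ e q : ℝ, (k + 6) * e - k * q > 0 → 0 < p * e - q := by
    intro e q h
    have : 0 < k * (p * e - q) := by
      have e1 : k * (p * e - q) = (k + 6) * e - k * q := by rw [← hpk]; ring
      rw [e1]; exact h
    exact pos_of_mul_pos_right this hk0.le
  obtain ⟨L, hL⟩ : ∃ L, L = M ^ 2 := ⟨_, rfl⟩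
  obtain ⟨B, hB⟩ : ∃ B, B = b ^ 2 := ⟨_, rfl⟩
  have hB0 : 0 < B := by rw [hB]; positivity
  have hL6 : 25 / 4 ≤ L := by rw [hL]; nlinarith
  have hkk : k = M - b - 2 := by linarith
  have hQ : 6 * (L * (L - 4) ^ 2) > (k + 6) * B * (3 * L ^ 2 - 3 * B * L + (4 - B) ^ 2) := by
    have e : 6 * (L * (L - 4) ^ 2) - (k + 6) * B * (3 * L ^ 2 - 3 * B * L + (4 - B) ^ 2)
        = k * (GG M ((b - 1) ^ 2) - M ^ 2 * (M ^ 2 - 4) ^ 2) := by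
      rw [hL, hB, hkk]; unfold GG; ring
    have := mul_pos hk0 (sub_pos.2 hG)
    linarith
  set D := 3 * L ^ 2 - 3 * B * L + (4 - B) ^ 2 with hD
  have hX1 : 4 < L - B := by rw [hL, hB]; linarith
  have hDe : D = (L - 4) ^ 2 + (L - B) * (2 * L + 8 - B) := by rw [hD]; ring
  have hD0 : 0 < D := by
    rw [hDe]
    have : 0 < (L - B) * (2 * L + 8 - B) := mul_pos (by linarith) (by linarith)
    positivity
  have hKB : ∀ c e : ℝ, 0 < c → 6 * (L * (L - 4) ^ 2) * c ≤ D * e → (k + 6) * B * c < e := by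
    intro c e hc h
    have h1 := mul_lt_mul_of_pos_right hQ hc
    have h2 : D * ((k + 6) * B * c) < D * e := by linarith
    exact lt_of_mul_lt_mul_left h2 hD0.le
  have c7 : (k + 6) * B * 1 < 2 * (3 * L - 8) := by
    refine hKB _ _ one_pos ?_
    have h1 : 8 * (L - 4) ^ 2 ≤ (L - B) * (2 * L + 8 - B) * (3 * L - 8) := by
      have h2 : 4 * L ≤ (L - B) * (2 * L + 8 - B) :=
        mul_le_mul hX1.le (by linarith) (by linarith) (by linarith)
      have h3 : 4 * L * (3 * L - 8) ≤ (L - B) * (2 * L + 8 - B) * (3 * L - 8) :=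
        mul_le_mul_of_nonneg_right h2 (by linarith)
      nlinarith
    rw [hDe]
    linarith
  have c6 : (k + 6) * B * (2 * L - B) < 2 * ((3 * L - 4) * (L - 4)) := by
    refine hKB _ _ (by linarith) ?_
    have h1 : 3 * L * (L - 4) * (2 * L - B) ≤ D * (3 * L - 4) := by
      have e : D * (3 * L - 4) - 3 * L * (L - 4) * (2 * L - B)
          = (L - 4) * (3 * (L - B) ^ 2 - 16 * (L - 4)) + (L - 4) * (32 * (L - B) - 48)
            + 96 * (L - B) + 8 * (L - B) ^ 2 := by rw [hD]; ring
      have h2 : 0 ≤ 3 * (L - B) ^ 2 - 16 * (L - 4) := by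
        have h3 : (4 * (M - 1)) ^ 2 ≤ (L - B) ^ 2 := by
          refine pow_le_pow_left₀ (by linarith) ?_ 2
          rw [hL, hB]; exact hX.le
        nlinarith [sq_nonneg (M - 3 / 2)]
      have h4 := mul_nonneg (show 0 ≤ L - 4 by linarith) h2
      have h5 := mul_nonneg (show 0 ≤ L - 4 by linarith) (show 0 ≤ 32 * (L - B) - 48 by linarith)
      have h6 := sq_nonneg (L - B)
      linarith
    have h7 := mul_le_mul_of_nonneg_left h1 (show 0 ≤ 2 * (L - 4) by linarith)
    linarith
  have c3 : 0 < 6 * M ^ 2 + 16 - 10 * b ^ 2 := c3_pos hb hM2 hbM hG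
  refine ⟨hb, ?_, c3, by linarith, red _ _ ?_, red _ _ ?_, red _ _ ?_⟩
  · have h1 : (4 * (b + 1)) ^ 2 ≤ (M ^ 2 - b ^ 2) ^ 2 := pow_le_pow_left₀ (by linarith) hX'.le 2
    have h2 : 0 < b ^ 2 := by positivity
    have e : (4 * (b + 1)) ^ 2 = 16 * b ^ 2 + 32 * b + 16 := by ring
    linarith
  · have e : (k + 6) * (M ^ 6 - 8 * M ^ 4 + 16 * M ^ 2 - 3 * M ^ 4 * b ^ 2 + 3 * M ^ 2 * b ^ 4
        - 16 * b ^ 2 + 8 * b ^ 4 - b ^ 6) - k * (M ^ 6 - 8 * M ^ 4 + 16 * M ^ 2)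
        = 6 * (L * (L - 4) ^ 2) - (k + 6) * B * D := by rw [hD, hL, hB]; ring
    rw [e]; linarith
  · have e : (k + 6) * (16 + 3 * b ^ 4 - 16 * M ^ 2 - 6 * M ^ 2 * b ^ 2 + 3 * M ^ 4)
        - k * (16 - 16 * M ^ 2 + 3 * M ^ 4)
        = 3 * (2 * ((3 * L - 4) * (L - 4)) - (k + 6) * B * (2 * L - B)) := by rw [hL, hB]; ring
    rw [e]; linarith
  · have e : (k + 6) * (-8 - 3 * b ^ 2 + 3 * M ^ 2) - k * (-8 + 3 * M ^ 2)
        = 3 * (2 * (3 * L - 8) - (k + 6) * B * 1) := by rw [hL, hB]; ring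
    rw [e]; linarith


/-- The final theorem for bundled smooth functions. -/
lemma Sol.final (hn1 : 1 ≤ n) {p : ℝ} {u w : Sm n} (S : Sol p u w) (hpc : 15 ≤ n → p < pc n) :
    u.1 = 0 := by
  have hp := S.hp
  have hk : (6 / (p - 1)) * (p - 1) = 6 := div_mul_cancel₀ _ (by linarith)
  rcases lt_or_ge (n : ℝ) (2 * (6 / (p - 1)) + 6) with h | h
  · exact S.concl2 hk h
  · have e : (n : ℝ) = 2 * (6 / (p - 1) + (((n : ℝ) - 6) / 2 - 6 / (p - 1))) + 6 := by ring
    exact S.concl1 hn1 hk e rfl (coef_ok hp hk e rfl (by linarith) hpc)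


end Helpers

/-- **Theorem 1.1.** Let `u` be a smooth stable solution of the triharmonic Lane–Emden
equation `(-Δ)³ u = |u|^{p-1} u` on `ℝⁿ` with `1 < p`, and `p < p_c(n)` in case `n ≥ 15`
(no upper restriction when `n ≤ 14`). Then `u ≡ 0`. -/
theorem triharmonic_stable_liouville (n : ℕ) (hn : 1 ≤ n) (p : ℝ) (hp : 1 < p)
    (u : EuclideanSpace ℝ (Fin n) → ℝ) (hu : ContDiff ℝ (⊤ : ℕ∞) u)
    (heq : ∀ x, laplacian (laplacian (laplacian u)) x = -(|u x| ^ (p - 1) * u x))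
    (hstab : ∀ φ : EuclideanSpace ℝ (Fin n) → ℝ, ContDiff ℝ (⊤ : ℕ∞) φ →
      HasCompactSupport φ →
      p * (∫ x, |u x| ^ (p - 1) * φ x ^ 2) ≤ ∫ x, ‖gradient (laplacian φ) x‖ ^ 2)
    (hpc : 15 ≤ n → p < pc n) :
    u = 0 := by
  set U : Sm n := ⟨u, hu⟩ with hU
  have hL : laplacian (laplacian (laplacian u)) = (Lap (Lap (Lap U))).1 := by
    have e : u = U.1 := rfl
    rw [e, laplacian_eq, laplacian_eq, laplacian_eq]
  have S : Sol p U (- Lap (Lap (Lap U))) := by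
    refine ⟨hp, rfl, fun x => ?_, fun φ hφ => ?_⟩
    · have h := heq x
      rw [hL] at h
      rw [Sm.neg_ap]
      change -((Lap (Lap (Lap U))).1 x) = |u x| ^ (p - 1) * u x
      rw [h, neg_neg]
    · rw [← int_grad_Lap φ hφ]
      exact hstab φ.1 (smcd φ) hφ
  exact S.final hn hpc
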